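/- Gundy's decomposition of continuous-time martingales: Let X be a Banach space and let M : [0,∞) × Ω → X be a càdlàg martingale. Then for every λ > 0 there exist càdlàg martingales M¹, M², M³ : [0,∞) × Ω → X such that M_t = M¹_t + M²_t + M³_t for all t ≥ 0 and, for every t ≥ 0: (i) ‖M¹_t‖ ≤ 2λ almost surely and E‖M¹_t‖ ≤ 5·E‖M_t‖; (ii) λ·P( sup_{0≤s≤t} ‖M²_s‖ > 0 ) ≤ 4·E‖M_t‖; (iii) E[(Var M³)_t] ≤ 7·E‖M_t‖. -/

import Mathlib

open MeasureTheory Filter Set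
open scoped NNReal ENNReal

/-- A function `f : [0,∞) → X` is càdlàg: it is right-continuous and has left limits
at every positive time. -/
def CadlagPath {X : Type*} [TopologicalSpace X] (f : ℝ≥0 → X) : Prop :=
  (∀ t : ℝ≥0, ContinuousWithinAt f (Set.Ici t) t) ∧
    ∀ t : ℝ≥0, 0 < t → ∃ l : X, Tendsto f (nhdsWithin t (Set.Iio t)) (nhds l)

/-- The filtration `ℱ` is right-continuous. -/
def RightContinuousFiltration {Ω : Type*} {m : MeasurableSpace Ω}
    (ℱ : MeasureTheory.Filtration ℝ≥0 m) : Prop :=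
  ∀ t : ℝ≥0, (ℱ t : MeasurableSpace Ω) = ⨅ (s : ℝ≥0) (_ : t < s), (ℱ s : MeasurableSpace Ω)

/-- The filtration `ℱ` contains all `μ`-null sets. -/
def CompleteFiltration {Ω : Type*} {m : MeasurableSpace Ω} (μ : Measure Ω)
    (ℱ : MeasureTheory.Filtration ℝ≥0 m) : Prop :=
  ∀ s : Set Ω, μ s = 0 → MeasurableSet[ℱ 0] s

namespace Gundy

section Dyadic

/-- The `k`-th dyadic time of level `n`. -/
noncomputable def dy (n k : ℕ) : ℝ≥0 := k / 2 ^ n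

/-- The smallest dyadic time of level `n` that is strictly larger than `t`. -/
noncomputable def dyUp (n : ℕ) (t : ℝ≥0) : ℝ≥0 := dy n (⌊t * 2 ^ n⌋₊ + 1)

lemma dy_mono (n : ℕ) {k l : ℕ} (h : k ≤ l) : dy n k ≤ dy n l := by
  unfold dy; gcongr

lemma dy_le_iff {n k : ℕ} {t : ℝ≥0} : dy n k ≤ t ↔ k ≤ ⌊t * 2 ^ n⌋₊ := by
  unfold dy
  rw [div_le_iff₀ (by positivity), Nat.le_floor_iff (by positivity)]

lemma lt_dyUp (n : ℕ) (t : ℝ≥0) : t < dyUp n t := by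
  unfold dyUp
  rw [← not_le, dy_le_iff]
  omega

lemma dyUp_le (n : ℕ) (t : ℝ≥0) : dyUp n t ≤ t + (1 / 2) ^ n := by
  unfold dyUp dy
  rw [div_le_iff₀ (by positivity), add_mul, ← mul_pow]
  have := Nat.floor_le (show 0 ≤ t * 2 ^ n by positivity)
  push_cast
  simpa using this

lemma dyUp_mono (n : ℕ) : Monotone (dyUp n) := fun s t h => by
  unfold dyUp
  exact dy_mono n (by gcongr)

lemma dy_refine {n m : ℕ} (h : n ≤ m) (k : ℕ) : dy n k = dy m (k * 2 ^ (m - n)) := by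
  unfold dy
  obtain ⟨d, rfl⟩ := Nat.exists_eq_add_of_le h
  rw [div_eq_div_iff (by positivity) (by positivity)]
  simp [pow_add]
  ring

lemma dyUp_le_dy {n k : ℕ} {t : ℝ≥0} (h : t < dy n k) {m : ℕ} (hm : n ≤ m) :
    dyUp m t ≤ dy n k := by
  rw [dy_refine hm] at h ⊢
  unfold dyUp
  refine dy_mono m ?_
  rw [← not_le, dy_le_iff] at h
  omega

lemma dyUp_anti {n m : ℕ} (h : n ≤ m) (t : ℝ≥0) : dyUp m t ≤ dyUp n t :=
  dyUp_le_dy (lt_dyUp n t) h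

lemma tendsto_dyUp (t : ℝ≥0) : Tendsto (fun n => dyUp n t) atTop (nhdsWithin t (Ici t)) := by
  refine tendsto_nhdsWithin_iff.2 ⟨?_, .of_forall fun n => (lt_dyUp n t).le⟩
  refine tendsto_of_tendsto_of_tendsto_of_le_of_le tendsto_const_nhds ?_
    (fun n => (lt_dyUp n t).le) (fun n => dyUp_le n t)
  have : Tendsto (fun n : ℕ => (1 / 2 : ℝ≥0) ^ n) atTop (nhds 0) :=
    NNReal.tendsto_pow_atTop_nhds_zero_of_lt_one (by rw [← NNReal.coe_lt_coe]; norm_num)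
  simpa using this.const_add t

lemma tendsto_min_dyUp {t T : ℝ≥0} (h : t ≤ T) :
    Tendsto (fun n => min T (dyUp n t)) atTop (nhdsWithin t (Ici t)) := by
  refine tendsto_nhdsWithin_iff.2 ⟨?_, .of_forall fun n => le_min h (lt_dyUp n t).le⟩
  simpa [h] using (tendsto_const_nhds (x := T)).min (tendsto_nhdsWithin_iff.1 (tendsto_dyUp t)).1

lemma exists_dyUp_lt {t u : ℝ≥0} (h : t < u) : ∃ n, dyUp n t < u :=
  ((tendsto_nhdsWithin_iff.1 (tendsto_dyUp t)).1.eventually (gt_mem_nhds h)).exists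

end Dyadic

section Filtration

variable {Ω : Type*} {m : MeasurableSpace Ω} {μ : Measure Ω} {ℱ : Filtration ℝ≥0 m}
  {E : Type*} [NormedAddCommGroup E]

lemma measurableSet_of_forall_gt (hright : RightContinuousFiltration ℱ) {t : ℝ≥0} {A : Set Ω}
    (h : ∀ s, t < s → MeasurableSet[ℱ s] A) : MeasurableSet[ℱ t] A := by
  rw [hright t]
  simp only [MeasurableSpace.measurableSet_iInf]
  exact h

lemma stronglyMeasurable_of_forall_gt (hright : RightContinuousFiltration ℱ) {t : ℝ≥0}
    {f : Ω → E} (h : ∀ s, t < s → StronglyMeasurable[ℱ s] f) : StronglyMeasurable[ℱ t] f := by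
  borelize E
  have h' := fun s hs => stronglyMeasurable_iff_measurable_separable.1 (h s hs)
  refine stronglyMeasurable_iff_measurable_separable.2 ⟨fun B hB => ?_, (h' (t + 1) (by simp)).2⟩
  exact measurableSet_of_forall_gt hright fun s hs => (h' s hs).1 hB

lemma stronglyMeasurable_of_tendsto_dyUp (hright : RightContinuousFiltration ℱ) {t : ℝ≥0}
    {g : ℝ≥0 → Ω → E} {f : Ω → E} (hg : ∀ s, t < s → StronglyMeasurable[ℱ s] (g s))
    (h : ∀ ω, Tendsto (fun n => g (dyUp n t) ω) atTop (nhds (f ω))) :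
    StronglyMeasurable[ℱ t] f := by
  refine stronglyMeasurable_of_forall_gt hright fun s hs => ?_
  obtain ⟨N, hN⟩ := exists_dyUp_lt hs
  refine stronglyMeasurable_of_tendsto (m := ℱ s) atTop (f := fun n => g (dyUp (n + N) t))
    (fun n => (hg _ (lt_dyUp _ t)).mono (ℱ.mono ?_)) ?_
  · exact (dyUp_anti (by omega) t).trans hN.le
  · exact tendsto_pi_nhds.2 fun ω => (h ω).comp (tendsto_add_atTop_nat N)

end Filtration

section OptionalSampling

variable {Ω : Type*} {m : MeasurableSpace Ω} {μ : Measure Ω} {ℱ : Filtration ℝ≥0 m}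
  {E : Type*} [NormedAddCommGroup E] 

/-- `τ`, with values in `[0, ∞]`, is a stopping time. -/
def IsStop {Ω : Type*} {m : MeasurableSpace Ω} (ℱ : Filtration ℝ≥0 m) (τ : Ω → ℝ≥0∞) : Prop :=
  ∀ t : ℝ≥0, MeasurableSet[ℱ t] {ω | τ ω ≤ t}

/-- `τ`, with values in `[0, ∞)`, is a stopping time. -/
def IsStop' {Ω : Type*} {m : MeasurableSpace Ω} (ℱ : Filtration ℝ≥0 m) (τ : Ω → ℝ≥0) : Prop :=
  ∀ t : ℝ≥0, MeasurableSet[ℱ t] {ω | τ ω ≤ t}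

/-- The minimum of `t` and `τ`. -/
noncomputable def capAt {Ω : Type*} (τ : Ω → ℝ≥0∞) (t : ℝ≥0) (ω : Ω) : ℝ≥0 :=
  (min (t : ℝ≥0∞) (τ ω)).toNNReal

lemma coe_capAt (τ : Ω → ℝ≥0∞) (t : ℝ≥0) (ω : Ω) :
    (capAt τ t ω : ℝ≥0∞) = min (t : ℝ≥0∞) (τ ω) := by
  unfold capAt
  rw [ENNReal.coe_toNNReal]
  exact ne_top_of_le_ne_top ENNReal.coe_ne_top (min_le_left _ _)

lemma capAt_le (τ : Ω → ℝ≥0∞) (t : ℝ≥0) (ω : Ω) : capAt τ t ω ≤ t := by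
  rw [← ENNReal.coe_le_coe, coe_capAt]; exact min_le_left _ _

lemma capAt_le_iff {τ : Ω → ℝ≥0∞} {t u : ℝ≥0} {ω : Ω} :
    capAt τ t ω ≤ u ↔ t ≤ u ∨ τ ω ≤ u := by
  rw [← ENNReal.coe_le_coe, coe_capAt, min_le_iff, ENNReal.coe_le_coe]

lemma capAt_of_le {τ : Ω → ℝ≥0∞} {t : ℝ≥0} {ω : Ω} (h : (t : ℝ≥0∞) ≤ τ ω) : capAt τ t ω = t := by
  rw [← ENNReal.coe_inj, coe_capAt, min_eq_left h]

lemma coe_capAt_of_ge {τ : Ω → ℝ≥0∞} {t : ℝ≥0} {ω : Ω} (h : τ ω ≤ t) :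
    (capAt τ t ω : ℝ≥0∞) = τ ω := by
  rw [coe_capAt, min_eq_right h]

lemma capAt_capAt (τ : Ω → ℝ≥0∞) {s t : ℝ≥0} (h : s ≤ t) (ω : Ω) (hs : capAt τ t ω ≤ s) :
    capAt τ t ω = capAt τ s ω := by
  rw [← ENNReal.coe_inj, coe_capAt, coe_capAt]
  rw [← ENNReal.coe_le_coe, coe_capAt] at hs
  have h' : (s : ℝ≥0∞) ≤ t := by exact_mod_cast h
  rcases le_total (τ ω) s with h1 | h1
  · rw [min_eq_right h1, min_eq_right (h1.trans h')]
  · rw [min_eq_left h1]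
    exact le_antisymm hs (le_min h' h1)

lemma IsStop.isStop_capAt {τ : Ω → ℝ≥0∞} (h : IsStop ℱ τ) (t : ℝ≥0) : IsStop' ℱ (capAt τ t) := by
  intro s
  simp only [capAt_le_iff]
  by_cases hts : t ≤ s
  · simp [hts]
  · simpa [hts] using h s

lemma IsStop'.measurable {τ : Ω → ℝ≥0} (h : IsStop' ℱ τ) {T : ℝ≥0} (hT : ∀ ω, τ ω ≤ T) :
    Measurable[ℱ T] τ := by
  refine measurable_of_Iic (mδ := ℱ T) fun s => ?_
  rcases le_total s T with hs | hs
  · exact ℱ.mono hs _ (h s)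
  · convert MeasurableSet.univ (α := Ω) (m := ℱ T) using 1
    exact eq_univ_of_forall fun ω => (hT ω).trans hs

/-- The evaluation of a process at a dyadic random time. -/
lemma stronglyMeasurable_eval_dyUp {Z : ℝ≥0 → Ω → E} (hZ : ∀ t, StronglyMeasurable[ℱ t] (Z t))
    {ρ : Ω → ℝ≥0} {T : ℝ≥0} (hρ : IsStop' ℱ ρ) (hT : ∀ ω, ρ ω ≤ T) (n : ℕ) :
    StronglyMeasurable[ℱ T] fun ω => Z (min T (dyUp n (ρ ω))) ω := by
  have hk : Measurable[ℱ T] fun ω => ⌊ρ ω * 2 ^ n⌋₊ :=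
    Nat.measurable_floor.comp ((hρ.measurable hT).mul_const _)
  have : (fun ω => Z (min T (dyUp n (ρ ω))) ω) = fun ω => ∑ k ∈ Finset.range (⌊T * 2 ^ n⌋₊ + 1),
      indicator {ω | ⌊ρ ω * 2 ^ n⌋₊ = k} (Z (min T (dy n (k + 1)))) ω := by
    ext ω
    rw [Finset.sum_eq_single ⌊ρ ω * 2 ^ n⌋₊]
    · rw [indicator_of_mem (by rfl)]; rfl
    · intro b _ hb
      rw [indicator_of_notMem]
      exact fun h => hb h.symm
    · intro h
      exact absurd (Finset.mem_range.2 (Nat.lt_succ_of_le (by gcongr; exact hT ω))) h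
  rw [this]
  refine Finset.stronglyMeasurable_fun_sum (m := ℱ T) _ fun k _ => ?_
  exact ((hZ _).mono (ℱ.mono (min_le_left _ _))).indicator (hk (measurableSet_singleton k))

lemma stronglyMeasurable_eval {Z : ℝ≥0 → Ω → E} (hZ : ∀ t, StronglyMeasurable[ℱ t] (Z t))
    (hrc : ∀ ω t, ContinuousWithinAt (fun s => Z s ω) (Ici t) t)
    {ρ : Ω → ℝ≥0} {T : ℝ≥0} (hρ : IsStop' ℱ ρ) (hT : ∀ ω, ρ ω ≤ T) :
    StronglyMeasurable[ℱ T] fun ω => Z (ρ ω) ω := by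
  refine stronglyMeasurable_of_tendsto (m := ℱ T) atTop
    (stronglyMeasurable_eval_dyUp hZ hρ hT) ?_
  refine tendsto_pi_nhds.2 fun ω => ?_
  exact (hrc ω (ρ ω)).tendsto.comp (tendsto_min_dyUp (hT ω))

end OptionalSampling

section StoppedMartingale

variable {Ω : Type*} {m : MeasurableSpace Ω} {μ : Measure Ω} {ℱ : Filtration ℝ≥0 m}

lemma IsStop'.isStoppingTime {ρ : Ω → ℝ≥0} (hρ : IsStop' ℱ ρ) :
    IsStoppingTime ℱ fun ω => (ρ ω : WithTop ℝ≥0) := fun t => by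
  simpa only [WithTop.coe_le_coe] using hρ t

lemma IsStop'.min_dyUp {ρ : Ω → ℝ≥0} (hρ : IsStop' ℱ ρ) (T : ℝ≥0) (n : ℕ) :
    IsStop' ℱ fun ω => min T (dyUp n (ρ ω)) := fun s => by
  by_cases hs : T ≤ s
  · simp [hs]
  · have : {ω | min T (dyUp n (ρ ω)) ≤ s} = {ω | ρ ω < dy n ⌊s * 2 ^ n⌋₊} := by
      ext ω
      simp only [mem_ofPred_eq, min_le_iff, hs, false_or]
      rw [dyUp, dy_le_iff, ← not_le, dy_le_iff]
      omega
    rw [this]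
    have h := hρ.isStoppingTime.measurableSet_lt (dy n ⌊s * 2 ^ n⌋₊)
    simp only [WithTop.coe_lt_coe] at h
    exact ℱ.mono (dy_le_iff.2 le_rfl) _ h

lemma countable_range_min_dyUp (ρ : Ω → ℝ≥0) (T : ℝ≥0) (n : ℕ) :
    (range fun ω => min T (dyUp n (ρ ω))).Countable := by
  refine (countable_range fun k : ℕ => min T (dy n (k + 1))).mono ?_
  rintro _ ⟨ω, rfl⟩
  exact ⟨_, rfl⟩

variable {E : Type*} [NormedAddCommGroup E] [NormedSpace ℝ E] [CompleteSpace E]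

lemma ae_eq_condExp_of_countable [IsFiniteMeasure μ] {Z : ℝ≥0 → Ω → E} (hZ : Martingale Z ℱ μ)
    {ρ : Ω → ℝ≥0} (hρ : IsStop' ℱ ρ) {T : ℝ≥0} (hT : ∀ ω, ρ ω ≤ T) (hc : (range ρ).Countable) :
    (fun ω => Z (ρ ω) ω) =ᵐ[μ] μ[Z T | hρ.isStoppingTime.measurableSpace] := by
  refine hZ.stoppedValue_ae_eq_condExp_of_le_const_of_countable_range hρ.isStoppingTime
    (fun ω => WithTop.coe_le_coe.2 (hT ω)) ?_
  exact (hc.image (fun x => (x : WithTop ℝ≥0))).mono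
    (by rintro _ ⟨ω, rfl⟩; exact ⟨_, ⟨ω, rfl⟩, rfl⟩)

lemma liminf_le_of_forall_le {u : ℕ → ℝ≥0∞} {a : ℝ≥0∞} (h : ∀ n, u n ≤ a) :
    liminf u atTop ≤ a :=
  (liminf_le_liminf (.of_forall h)).trans (liminf_const a).le

/-- Optional sampling for a bounded stopping time: the dyadic approximations converge in `L¹`. -/
lemma integrable_eval_and_tendsto [IsFiniteMeasure μ] {Z : ℝ≥0 → Ω → E} (hZ : Martingale Z ℱ μ)
    (hrc : ∀ ω t, ContinuousWithinAt (fun s => Z s ω) (Ici t) t)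
    {ρ : Ω → ℝ≥0} (hρ : IsStop' ℱ ρ) {T : ℝ≥0} (hT : ∀ ω, ρ ω ≤ T) :
    Integrable (fun ω => Z (ρ ω) ω) μ ∧
      Tendsto (fun n => eLpNorm ((fun ω => Z (min T (dyUp n (ρ ω))) ω) - fun ω => Z (ρ ω) ω) 1 μ)
        atTop (nhds 0) := by
  have hsm : StronglyMeasurable (fun ω => Z (ρ ω) ω) :=
    (stronglyMeasurable_eval hZ.1 hrc hρ hT).mono (ℱ.le T)
  have hsm' n : StronglyMeasurable (fun ω => Z (min T (dyUp n (ρ ω))) ω) :=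
    (stronglyMeasurable_eval_dyUp hZ.1 hρ hT n).mono (ℱ.le T)
  have hlim : ∀ ω, Tendsto (fun n => Z (min T (dyUp n (ρ ω))) ω) atTop (nhds (Z (ρ ω) ω)) :=
    fun ω => (hrc ω (ρ ω)).tendsto.comp (tendsto_min_dyUp (hT ω))
  have hst n := hρ.min_dyUp T n
  have hce n := ae_eq_condExp_of_countable hZ (hst n) (T := T) (fun ω => min_le_left _ _)
    (countable_range_min_dyUp ρ T n)
  have hbd n : eLpNorm (fun ω => Z (min T (dyUp n (ρ ω))) ω) 1 μ ≤ eLpNorm (Z T) 1 μ := by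
    rw [eLpNorm_congr_ae (hce n)]
    exact eLpNorm_condExp_le_eLpNorm _ le_rfl
  have hmem : MemLp (fun ω => Z (ρ ω) ω) 1 μ := by
    refine ⟨hsm.aestronglyMeasurable, lt_of_le_of_lt
      (Lp.eLpNorm_lim_le_liminf_eLpNorm (fun n => (hsm' n).aestronglyMeasurable) _
        (.of_forall hlim)) ?_⟩
    exact lt_of_le_of_lt (liminf_le_of_forall_le hbd)
      ((memLp_one_iff_integrable.2 (hZ.integrable T)).eLpNorm_lt_top)
  refine ⟨memLp_one_iff_integrable.1 hmem, ?_⟩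
  refine tendsto_Lp_finite_of_tendsto_ae le_rfl ENNReal.one_ne_top
    (fun n => (hsm' n).aestronglyMeasurable) hmem ?_ (.of_forall hlim)
  have hui := ((hZ.integrable T).norm.uniformIntegrable_condExp
    fun n => (hst n).isStoppingTime.measurableSpace_le).2.1
  intro ε hε
  obtain ⟨δ, hδ, h⟩ := hui hε
  refine ⟨δ, hδ, fun n s hs hμs => (eLpNorm_mono_ae ?_).trans (h n s hs hμs)⟩
  filter_upwards [hce n,
    norm_condExp_le (μ := μ) (m := (hst n).isStoppingTime.measurableSpace) (Z T)]
    with ω h1 h2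
  by_cases hω : ω ∈ s
  · rw [indicator_of_mem hω, indicator_of_mem hω, h1]
    exact h2.trans (le_abs_self _)
  · simp [hω]

lemma integrable_eval [IsFiniteMeasure μ] {Z : ℝ≥0 → Ω → E} (hZ : Martingale Z ℱ μ)
    (hrc : ∀ ω t, ContinuousWithinAt (fun s => Z s ω) (Ici t) t)
    {ρ : Ω → ℝ≥0} (hρ : IsStop' ℱ ρ) {T : ℝ≥0} (hT : ∀ ω, ρ ω ≤ T) :
    Integrable (fun ω => Z (ρ ω) ω) μ := (integrable_eval_and_tendsto hZ hrc hρ hT).1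

lemma integral_eval [IsFiniteMeasure μ] {Z : ℝ≥0 → Ω → E} (hZ : Martingale Z ℱ μ)
    (hrc : ∀ ω t, ContinuousWithinAt (fun s => Z s ω) (Ici t) t)
    {ρ : Ω → ℝ≥0} (hρ : IsStop' ℱ ρ) {T : ℝ≥0} (hT : ∀ ω, ρ ω ≤ T) :
    ∫ ω, Z (ρ ω) ω ∂μ = ∫ ω, Z T ω ∂μ := by
  have hst n := hρ.min_dyUp T n
  have h := tendsto_integral_of_L1' (fun ω => Z (ρ ω) ω) (integrable_eval hZ hrc hρ hT).1
    (.of_forall fun n => integrable_eval hZ hrc (hst n) (T := T) fun ω => min_le_left _ _)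
    (integrable_eval_and_tendsto hZ hrc hρ hT).2
  refine tendsto_nhds_unique h (tendsto_const_nhds.congr fun n => ?_)
  rw [integral_congr_ae (ae_eq_condExp_of_countable hZ (hst n) (T := T) (fun ω => min_le_left _ _)
    (countable_range_min_dyUp ρ T n)), integral_condExp]

lemma eLpNorm_eval_le [IsFiniteMeasure μ] {Z : ℝ≥0 → Ω → E} (hZ : Martingale Z ℱ μ)
    (hrc : ∀ ω t, ContinuousWithinAt (fun s => Z s ω) (Ici t) t)
    {ρ : Ω → ℝ≥0} (hρ : IsStop' ℱ ρ) {T : ℝ≥0} (hT : ∀ ω, ρ ω ≤ T) :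
    eLpNorm (fun ω => Z (ρ ω) ω) 1 μ ≤ eLpNorm (Z T) 1 μ := by
  have hst n := hρ.min_dyUp T n
  have hlim : ∀ ω, Tendsto (fun n => Z (min T (dyUp n (ρ ω))) ω) atTop (nhds (Z (ρ ω) ω)) :=
    fun ω => (hrc ω (ρ ω)).tendsto.comp (tendsto_min_dyUp (hT ω))
  refine (Lp.eLpNorm_lim_le_liminf_eLpNorm (fun n => (integrable_eval hZ hrc (hst n) (T := T)
    fun ω => min_le_left _ _).1) _ (.of_forall hlim)).trans ?_
  refine liminf_le_of_forall_le fun n => ?_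
  rw [eLpNorm_congr_ae (ae_eq_condExp_of_countable hZ (hst n) (T := T) (fun ω => min_le_left _ _)
    (countable_range_min_dyUp ρ T n))]
  exact eLpNorm_condExp_le_eLpNorm _ le_rfl

omit [NormedSpace ℝ E] [CompleteSpace E] in
lemma integral_norm_le_of_eLpNorm_le {f g : Ω → E} (hf : Integrable f μ) (hg : Integrable g μ)
    (h : eLpNorm f 1 μ ≤ eLpNorm g 1 μ) : ∫ ω, ‖f ω‖ ∂μ ≤ ∫ ω, ‖g ω‖ ∂μ := by
  rw [eLpNorm_one_eq_lintegral_enorm, eLpNorm_one_eq_lintegral_enorm,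
    ← ofReal_integral_norm_eq_lintegral_enorm hf, ← ofReal_integral_norm_eq_lintegral_enorm hg] at h
  exact (ENNReal.ofReal_le_ofReal_iff (integral_nonneg fun _ => norm_nonneg _)).1 h

lemma integral_norm_eval_le [IsFiniteMeasure μ] {Z : ℝ≥0 → Ω → E} (hZ : Martingale Z ℱ μ)
    (hrc : ∀ ω t, ContinuousWithinAt (fun s => Z s ω) (Ici t) t)
    {ρ : Ω → ℝ≥0} (hρ : IsStop' ℱ ρ) {T : ℝ≥0} (hT : ∀ ω, ρ ω ≤ T) :
    ∫ ω, ‖Z (ρ ω) ω‖ ∂μ ≤ ∫ ω, ‖Z T ω‖ ∂μ :=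
  integral_norm_le_of_eLpNorm_le (integrable_eval hZ hrc hρ hT) (hZ.integrable T)
    (eLpNorm_eval_le hZ hrc hρ hT)

/-- An adapted integrable process with constant integrals over past events is a martingale. -/
lemma martingale_of_setIntegral [IsFiniteMeasure μ] {Z : ℝ≥0 → Ω → E}
    (hZ : ∀ t, StronglyMeasurable[ℱ t] (Z t)) (hi : ∀ t, Integrable (Z t) μ)
    (h : ∀ s t, s ≤ t → ∀ G, MeasurableSet[ℱ s] G → ∫ ω in G, Z s ω ∂μ = ∫ ω in G, Z t ω ∂μ) :
    Martingale Z ℱ μ := by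
  refine ⟨hZ, fun s t hst => ?_⟩
  refine (ae_eq_condExp_of_forall_setIntegral_eq (ℱ.le s) (hi t)
    (fun G _ _ => (hi s).integrableOn) (fun G hG _ => h s t hst G hG)
    (hZ s).aestronglyMeasurable).symm

/-- The stopped process of a right-continuous martingale is a martingale. -/
lemma martingale_stopped [IsFiniteMeasure μ] {Z : ℝ≥0 → Ω → E} (hZ : Martingale Z ℱ μ)
    (hrc : ∀ ω t, ContinuousWithinAt (fun s => Z s ω) (Ici t) t)
    {τ : Ω → ℝ≥0∞} (hτ : IsStop ℱ τ) :
    Martingale (fun t ω => Z (capAt τ t ω) ω) ℱ μ := by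
  refine martingale_of_setIntegral
    (fun t => stronglyMeasurable_eval hZ.1 hrc (hτ.isStop_capAt t) (capAt_le τ t))
    (fun t => integrable_eval hZ hrc (hτ.isStop_capAt t) (capAt_le τ t)) fun s t hst G hG => ?_
  classical
  have hi u := integrable_eval hZ hrc (hτ.isStop_capAt u) (capAt_le τ u)
  let ρ : Ω → ℝ≥0 := fun ω => if ω ∈ G then capAt τ s ω else capAt τ t ω
  have hρT : ∀ ω, ρ ω ≤ t := fun ω => by
    by_cases hω : ω ∈ G <;> simp [ρ, hω, capAt_le, (capAt_le τ s ω).trans hst]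
  have hρ : IsStop' ℱ ρ := by
    intro u
    rcases le_or_gt s u with hu | hu
    · have h1 := (ℱ.mono hu _ hG).inter (hτ.isStop_capAt s u)
      have h2 := (ℱ.mono hu _ hG).compl.inter (hτ.isStop_capAt t u)
      convert h1.union h2 using 1
      ext ω
      by_cases hω : ω ∈ G <;> simp [ρ, hω]
    · convert hτ.isStop_capAt t u using 1
      ext ω
      have h1 : ¬ s ≤ u := hu.not_ge
      have h2 : ¬ t ≤ u := fun h => h1 (hst.trans h)
      by_cases hω : ω ∈ G <;> simp [ρ, hω, capAt_le_iff, h1, h2]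
  have e := (integral_eval hZ hrc hρ hρT).trans
    (integral_eval hZ hrc (hτ.isStop_capAt t) (capAt_le τ t)).symm
  have hG' := ℱ.le s _ hG
  rw [← integral_add_compl hG' (integrable_eval hZ hrc hρ hρT),
    ← integral_add_compl hG' (hi t)] at e
  have e1 : ∫ ω in G, Z (ρ ω) ω ∂μ = ∫ ω in G, Z (capAt τ s ω) ω ∂μ :=
    setIntegral_congr_fun hG' fun ω hω => by simp [ρ, hω]
  have e2 : ∫ ω in Gᶜ, Z (ρ ω) ω ∂μ = ∫ ω in Gᶜ, Z (capAt τ t ω) ω ∂μ :=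
    setIntegral_congr_fun hG'.compl fun ω hω => by
      have : ω ∉ G := hω
      simp [ρ, this]
  rw [e1, e2] at e
  exact add_right_cancel e

end StoppedMartingale

section Hilbert

/-- `w n` is a sequence of convex weights on the integers `j ≥ n`. -/
structure IsConvexWeights (w : ℕ → ℕ →₀ ℝ) : Prop where
  nonneg : ∀ n j, 0 ≤ w n j
  zero_of_lt : ∀ n j, j < n → w n j = 0
  sum_eq_one : ∀ n, ∑ j ∈ (w n).support, w n j = 1

variable {H : Type*} [NormedAddCommGroup H] [InnerProductSpace ℝ H]

lemma exists_isConvexWeights_cauchySeq_aux (y : ℕ → H) (hy : ∀ j, ‖y j‖ ≤ 1) :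
    ∃ w : ℕ → ℕ →₀ ℝ, IsConvexWeights w ∧
      CauchySeq fun n => ∑ j ∈ (w n).support, w n j • y j := by
  let L := Finsupp.linearCombination ℝ y
  let I := Finsupp.linearCombination ℝ (fun _ : ℕ => (1 : ℝ))
  let A : ℕ → Set (ℕ →₀ ℝ) := fun n => {w | (∀ j, 0 ≤ w j) ∧ (∀ j, j < n → w j = 0) ∧ I w = 1}
  let D : ℕ → Set ℝ := fun n => (fun w => ‖L w‖) '' A n
  have hAne n : (A n).Nonempty := by
    refine ⟨Finsupp.single n 1, fun j => ?_, fun j hj => ?_, ?_⟩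
    · rw [Finsupp.single_apply]; split_ifs <;> norm_num
    · rw [Finsupp.single_apply, if_neg hj.ne']
    · simp [I]
  have hAmono {k n : ℕ} (h : k ≤ n) : A n ⊆ A k := fun w hw =>
    ⟨hw.1, fun j hj => hw.2.1 j (hj.trans_le h), hw.2.2⟩
  have hDb n : BddBelow (D n) := ⟨0, by rintro _ ⟨w, -, rfl⟩; exact norm_nonneg _⟩
  have hDne n : (D n).Nonempty := (hAne n).image _
  let d : ℕ → ℝ := fun n => sInf (D n)
  have hd0 n : 0 ≤ d n := Real.sInf_nonneg (by rintro _ ⟨w, -, rfl⟩; exact norm_nonneg _)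
  have hdmono : Monotone d := fun k n h =>
    csInf_le_csInf (hDb k) (hDne n) (image_mono (hAmono h))
  have hd1 n : d n ≤ 1 := by
    refine csInf_le_of_le (hDb n) ⟨Finsupp.single n 1, ⟨fun j => ?_, fun j hj => ?_, ?_⟩, rfl⟩ ?_
    · rw [Finsupp.single_apply]; split_ifs <;> norm_num
    · rw [Finsupp.single_apply, if_neg hj.ne']
    · simp [I]
    · simpa [L] using hy n
  have hdlim : Tendsto d atTop (nhds (⨆ n, d n)) :=
    tendsto_atTop_ciSup hdmono ⟨1, by rintro _ ⟨n, rfl⟩; exact hd1 n⟩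
  set δ := ⨆ n, d n
  have hdδ n : d n ≤ δ := le_ciSup (f := d) ⟨1, by rintro _ ⟨n, rfl⟩; exact hd1 n⟩ n
  have hex n : ∃ w ∈ A n, ‖L w‖ < d n + 1 / (n + 1) := by
    obtain ⟨_, ⟨w, hw, rfl⟩, h⟩ := exists_lt_of_csInf_lt (hDne n)
      (show sInf (D n) < d n + 1 / (n + 1) from lt_add_of_pos_right _ (by positivity))
    exact ⟨w, hw, h⟩
  choose w hwA hw using hex
  have hsum n : I (w n) = ∑ j ∈ (w n).support, w n j := by
    simp [I, Finsupp.linearCombination_apply, Finsupp.sum]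
  refine ⟨w, ⟨fun n => (hwA n).1, fun n => (hwA n).2.1, fun n => (hsum n) ▸ (hwA n).2.2⟩, ?_⟩
  change CauchySeq fun n => L (w n)
  let b : ℕ → ℝ := fun k => 4 * (δ + 1 / (k + 1)) ^ 2 - 4 * d k ^ 2
  have hb : Tendsto (fun k => Real.sqrt (b k)) atTop (nhds 0) := by
    have h1 : Tendsto b atTop (nhds (4 * (δ + 0) ^ 2 - 4 * δ ^ 2)) :=
      (((tendsto_const_nhds.add tendsto_one_div_add_atTop_nhds_zero_nat).pow 2).const_mul 4).sub
        ((hdlim.pow 2).const_mul 4)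
    have h2 := h1.sqrt
    simpa using h2
  refine cauchySeq_of_le_tendsto_0' (fun k => Real.sqrt (b k)) (fun k n hkn => ?_) hb
  rw [dist_eq_norm]
  refine Real.le_sqrt_of_sq_le ?_
  have hpar := parallelogram_law_with_norm ℝ (L (w k)) (L (w n))
  have hmid : 2 * d k ≤ ‖L (w k) + L (w n)‖ := by
    have hmem : (1 / 2 : ℝ) • (w k + w n) ∈ A k := by
      refine ⟨fun j => ?_, fun j hj => ?_, ?_⟩
      · have := (hwA k).1 j
        have := (hwA n).1 j
        simp; positivity
      · simp [(hwA k).2.1 j hj, (hAmono hkn (hwA n)).2.1 j hj]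
      · rw [map_smul, map_add, (hwA k).2.2, (hwA n).2.2]; norm_num
    have : d k ≤ ‖L ((1 / 2 : ℝ) • (w k + w n))‖ := csInf_le (hDb k) ⟨_, hmem, rfl⟩
    rw [map_smul, map_add, norm_smul] at this
    norm_num at this
    linarith
  have hk : ‖L (w k)‖ ≤ δ + 1 / (k + 1) := (hw k).le.trans (by gcongr; exact hdδ k)
  have hn : ‖L (w n)‖ ≤ δ + 1 / (k + 1) := (hw n).le.trans (by
    gcongr; exact hdδ n)
  have h0 := hd0 k
  have h1 := norm_nonneg (L (w k))
  have h2 := norm_nonneg (L (w n))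
  simp only [b]
  nlinarith [mul_self_le_mul_self h1 hk, mul_self_le_mul_self h2 hn,
    mul_self_le_mul_self (by positivity : 0 ≤ 2 * d k) hmid]

/-- Countably many bounded sequences in a Hilbert space have convex combinations, with common
weights moving off to infinity, that are Cauchy sequences. -/
lemma exists_isConvexWeights_cauchySeq (x : ℕ → ℕ → H) (C : ℕ → ℝ) (hx : ∀ i j, ‖x i j‖ ≤ C i) :
    ∃ w : ℕ → ℕ →₀ ℝ, IsConvexWeights w ∧
      ∀ i, CauchySeq fun n => ∑ j ∈ (w n).support, w n j • x i j := by
  have hC i : 0 ≤ C i := (norm_nonneg _).trans (hx i 0)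
  let c : ℕ → ℝ := fun i => (1 / 2) ^ (i + 1) / (1 + C i)
  have hc i : 0 < c i := by have := hC i; positivity
  have hcx i j : ‖c i • x i j‖ ≤ (1 / 2) ^ (i + 1) := by
    have := hC i
    rw [norm_smul, Real.norm_of_nonneg (hc i).le, div_mul_eq_mul_div,
      div_le_iff₀ (by positivity)]
    gcongr
    linarith [hx i j]
  have hsum : HasSum (fun i : ℕ => (1 / 2 : ℝ) ^ (i + 1)) 1 := by
    simpa [pow_succ] using hasSum_geometric_two.mul_right (1 / 2 : ℝ)
  have hle1 i : (1 / 2 : ℝ) ^ (i + 1) ≤ 1 := pow_le_one₀ (by norm_num) (by norm_num)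
  have hsq i j : ‖c i • x i j‖ ^ (2 : ℝ≥0∞).toReal ≤ (1 / 2) ^ (i + 1) := by
    have h1 := hcx i j
    have h2 := hle1 i
    have h3 := norm_nonneg (c i • x i j)
    simp only [ENNReal.toReal_ofNat, Real.rpow_ofNat]
    nlinarith
  have hmem j : Memℓp (fun i => c i • x i j) 2 := by
    refine memℓp_gen (Summable.of_nonneg_of_le (fun i => ?_) (fun i => hsq i j) hsum.summable)
    positivity
  let y : ℕ → lp (fun _ : ℕ => H) 2 := fun j => ⟨fun i => c i • x i j, hmem j⟩
  have hy j : ‖y j‖ ≤ 1 := by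
    refine lp.norm_le_of_tsum_le (by norm_num) (by norm_num) ?_
    simp only [Real.one_rpow]
    rw [← hsum.tsum_eq]
    exact (Summable.of_nonneg_of_le (fun i => by positivity) (fun i => hsq i j)
      hsum.summable).tsum_le_tsum (fun i => hsq i j) hsum.summable
  obtain ⟨w, hw, hcau⟩ := exists_isConvexWeights_cauchySeq_aux y hy
  refine ⟨w, hw, fun i => ?_⟩
  rw [Metric.cauchySeq_iff] at hcau ⊢
  intro ε hε
  obtain ⟨N, hN⟩ := hcau (c i * ε) (mul_pos (hc i) hε)
  refine ⟨N, fun a ha b hb => ?_⟩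
  have h1 := hN a ha b hb
  rw [dist_eq_norm] at h1 ⊢
  have h2 := (lp.norm_apply_le_norm (by norm_num) _ i).trans_lt h1
  have h3 : ∀ n, (((∑ j ∈ (w n).support, w n j • y j : lp (fun _ : ℕ => H) 2)) : ℕ → H) i =
      c i • ∑ j ∈ (w n).support, w n j • x i j := by
    intro n
    rw [lp.coeFn_sum, Finset.sum_apply, Finset.smul_sum]
    refine Finset.sum_congr rfl fun j _ => ?_
    rw [lp.coeFn_smul, Pi.smul_apply, smul_comm]
  rw [lp.coeFn_sub, Pi.sub_apply, h3, h3, ← smul_sub, norm_smul,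
    Real.norm_of_nonneg (hc i).le] at h2
  exact lt_of_mul_lt_mul_left h2 (hc i).le

end Hilbert

section Compensator

variable {Ω : Type*} {m : MeasurableSpace Ω} {μ : Measure Ω}
  {𝒢 : ℕ → MeasurableSpace Ω} {D : ℕ → Set Ω}

/-- The discrete compensator of `∑ i, (D i).indicator η` along the σ-algebras `𝒢 i`. -/
noncomputable def discComp {E : Type*} [NormedAddCommGroup E] [NormedSpace ℝ E] [CompleteSpace E]
    (μ : Measure Ω) (𝒢 : ℕ → MeasurableSpace Ω) (D : ℕ → Set Ω) (k : ℕ) (η : Ω → E) : Ω → E :=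
  ∑ i ∈ Finset.range k, μ[(D i).indicator η | 𝒢 i]

lemma condExp_indicator_one_mem_Icc :
    ∀ᵐ ω ∂μ, ∀ i, μ[(D i).indicator (fun _ => (1 : ℝ)) | 𝒢 i] ω ∈ Icc (0 : ℝ) 1 := by
  refine ae_all_iff.2 fun i => ?_
  have h0 : (0 : Ω → ℝ) ≤ᵐ[μ] (D i).indicator (fun _ => (1 : ℝ)) :=
    .of_forall fun ω => indicator_nonneg (fun _ _ => zero_le_one) ω
  have h1 : ∀ᵐ ω ∂μ, |(D i).indicator (fun _ => (1 : ℝ)) ω| ≤ 1 := .of_forall fun ω => by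
    by_cases h : ω ∈ D i <;> simp [h]
  filter_upwards [condExp_nonneg (m := 𝒢 i) h0, ae_bdd_abs_condExp_of_ae_bdd_abs (m := 𝒢 i) h1]
    with ω h2 h3
  exact ⟨h2, (le_abs_self _).trans h3⟩

lemma memLp_and_integral_sq_discComp_le [IsProbabilityMeasure μ] (h𝒢 : ∀ i, 𝒢 i ≤ m)
    (hmono : Monotone 𝒢)
    (hD : ∀ i, MeasurableSet (D i)) (hdisj : Pairwise fun i j => Disjoint (D i) (D j)) (k : ℕ) :
    MemLp (discComp μ 𝒢 D k fun _ => (1 : ℝ)) 2 μ ∧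
      ∫ ω, discComp μ 𝒢 D k (fun _ => (1 : ℝ)) ω ^ 2 ∂μ ≤ 2 := by
  set e : ℕ → Ω → ℝ := fun i => μ[(D i).indicator (fun _ => (1 : ℝ)) | 𝒢 i] with he
  set S : ℕ → Ω → ℝ := fun k => discComp μ 𝒢 D k fun _ => (1 : ℝ) with hS
  have hSe k ω : S k ω = ∑ i ∈ Finset.range k, e i ω := by simp [S, discComp, e]
  have hee := condExp_indicator_one_mem_Icc (μ := μ) (𝒢 := 𝒢) (D := D)
  have hem i : StronglyMeasurable[𝒢 i] (e i) := stronglyMeasurable_condExp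
  have hSm i : StronglyMeasurable[𝒢 i] (S (i + 1)) :=
    Finset.stronglyMeasurable_sum _ fun j hj =>
      (hem j).mono (hmono (Nat.lt_succ_iff.1 (Finset.mem_range.1 hj)))
  have hSm' k : StronglyMeasurable (S k) :=
    Finset.stronglyMeasurable_sum _ fun j _ => (hem j).mono (h𝒢 j)
  have hSb : ∀ᵐ ω ∂μ, ∀ k : ℕ, S k ω ∈ Icc (0 : ℝ) k := by
    filter_upwards [hee] with ω h k
    rw [hSe]
    refine ⟨Finset.sum_nonneg fun i _ => (h i).1, ?_⟩
    refine (Finset.sum_le_sum fun i _ => (h i).2).trans ?_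
    simp
  have hSmem k (p : ℝ≥0∞) : MemLp (S k) p μ := by
    refine MemLp.of_bound (hSm' k).aestronglyMeasurable k ?_
    filter_upwards [hSb] with ω h
    rw [Real.norm_of_nonneg (h k).1]; exact (h k).2
  have hei i : Integrable (e i) μ := integrable_condExp
  have hbd {f : Ω → ℝ} (hf : Integrable f μ) (k : ℕ) : Integrable (fun ω => f ω * S k ω) μ := by
    refine hf.mul_bdd (c := k) (hSm' k).aestronglyMeasurable ?_
    filter_upwards [hSb] with ω h
    rw [Real.norm_of_nonneg (h k).1]; exact (h k).2
  have hDi i : Integrable ((D i).indicator (fun _ => (1 : ℝ))) μ :=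
    (integrable_const _).indicator (hD i)
  have hpull i : ∫ ω, e i ω * S (i + 1) ω ∂μ =
      ∫ ω, (D i).indicator (fun _ => (1 : ℝ)) ω * S (i + 1) ω ∂μ := by
    have h1 := condExp_stronglyMeasurable_mul_of_bound (h𝒢 i) (hSm i) (hDi i) ((i + 1 : ℕ) : ℝ)
      (μ := μ) (by
        filter_upwards [hSb] with ω h
        rw [Real.norm_of_nonneg (h _).1]; exact (h _).2)
    have h2 := integral_congr_ae h1
    rw [integral_condExp (h𝒢 i)] at h2
    simpa [mul_comm, e] using h2.symm
  have hsq k : Integrable (fun ω => S k ω ^ 2) μ := (hSmem k 2).integrable_sq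
  have hstep i (hi : i < k) : ∫ ω, S (i + 1) ω ^ 2 ∂μ - ∫ ω, S i ω ^ 2 ∂μ ≤
      2 * ∫ ω, (D i).indicator (fun _ => (1 : ℝ)) ω * S k ω ∂μ := by
    have h1 : ∫ ω, S (i + 1) ω ^ 2 ∂μ - ∫ ω, S i ω ^ 2 ∂μ ≤ 2 * ∫ ω, e i ω * S (i + 1) ω ∂μ := by
      rw [← integral_sub (hsq _) (hsq _), ← integral_const_mul]
      refine integral_mono_ae ((hsq _).sub (hsq _)) ((hbd (hei i) _).const_mul 2) ?_
      filter_upwards [hee] with ω h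
      have h2 : S (i + 1) ω = S i ω + e i ω := by rw [hSe, hSe, Finset.sum_range_succ]
      have h3 := (h i).1
      simp only [h2]
      nlinarith
    refine h1.trans (mul_le_mul_of_nonneg_left ?_ zero_le_two)
    rw [hpull]
    refine integral_mono_ae (hbd (hDi i) _) (hbd (hDi i) _) ?_
    filter_upwards [hee] with ω h
    refine mul_le_mul_of_nonneg_left ?_ (indicator_nonneg (fun _ _ => zero_le_one) ω)
    rw [hSe, hSe]
    exact Finset.sum_le_sum_of_subset_of_nonneg (Finset.range_mono hi) fun i _ _ => (h i).1
  have hdisj' ω (c : ℝ) (hc : 0 ≤ c) :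
      ∑ i ∈ Finset.range k, (D i).indicator (fun _ => (1 : ℝ)) ω * c ≤ c := by
    by_cases h : ∃ i, ω ∈ D i
    · obtain ⟨i, hi⟩ := h
      refine (Finset.sum_le_sum_of_subset_of_nonneg (Finset.subset_insert i (Finset.range k))
        fun _ _ _ => mul_nonneg (indicator_nonneg (fun _ _ => zero_le_one) ω) hc).trans ?_
      rw [Finset.sum_eq_single_of_mem i (Finset.mem_insert_self _ _)]
      · simp [hi]
      · intro j _ hj
        rw [indicator_of_notMem (fun hj' => (hdisj hj).le_bot ⟨hj', hi⟩), zero_mul]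
    · push Not at h
      simp [h, hc]
  refine ⟨hSmem k 2, ?_⟩
  have hS0 : ∫ ω, S 0 ω ^ 2 ∂μ = 0 := by simp [hSe]
  calc ∫ ω, S k ω ^ 2 ∂μ = ∑ i ∈ Finset.range k, (∫ ω, S (i + 1) ω ^ 2 ∂μ - ∫ ω, S i ω ^ 2 ∂μ) := by
        rw [Finset.sum_range_sub (fun i => ∫ ω, S i ω ^ 2 ∂μ), hS0, sub_zero]
    _ ≤ ∑ i ∈ Finset.range k, 2 * ∫ ω, (D i).indicator (fun _ => (1 : ℝ)) ω * S k ω ∂μ :=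
        Finset.sum_le_sum fun i hi => hstep i (Finset.mem_range.1 hi)
    _ = 2 * ∫ ω, ∑ i ∈ Finset.range k, (D i).indicator (fun _ => (1 : ℝ)) ω * S k ω ∂μ := by
        rw [integral_finsetSum _ fun i _ => hbd (hDi i) k, Finset.mul_sum]
    _ ≤ 2 * ∫ ω, S k ω ∂μ := by
        refine mul_le_mul_of_nonneg_left ?_ zero_le_two
        refine integral_mono_ae (integrable_finsetSum _ fun i _ => hbd (hDi i) k)
          ((hSmem k 1).integrable le_rfl) ?_
        filter_upwards [hSb] with ω h
        exact hdisj' ω _ (h k).1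
    _ = 2 * ∫ ω, ∑ i ∈ Finset.range k, (D i).indicator (fun _ => (1 : ℝ)) ω * 1 ∂μ := by
        simp only [hSe, mul_one]
        rw [integral_finsetSum _ fun i _ => hei i, integral_finsetSum _ fun i _ => hDi i]
        congr 1
        exact Finset.sum_congr rfl fun i _ => integral_condExp (h𝒢 i)
    _ ≤ 2 * ∫ _, (1 : ℝ) ∂μ := by
        refine mul_le_mul_of_nonneg_left ?_ zero_le_two
        refine integral_mono (integrable_finsetSum _ fun i _ => ?_) (integrable_const _) ?_
        · simpa using hDi i
        · exact fun ω => hdisj' ω 1 zero_le_one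
    _ = 2 := by simp

lemma eLpNorm_discComp_le {E : Type*} [NormedAddCommGroup E] [NormedSpace ℝ E] [CompleteSpace E]
    (hD : ∀ i, MeasurableSet (D i)) (hdisj : Pairwise fun i j => Disjoint (D i) (D j)) (k : ℕ)
    (η : Ω → E) : eLpNorm (discComp μ 𝒢 D k η) 1 μ ≤ eLpNorm η 1 μ := by
  refine (eLpNorm_sum_le (fun i _ => integrable_condExp.1) le_rfl).trans ?_
  refine (Finset.sum_le_sum fun i _ => eLpNorm_condExp_le_eLpNorm _ le_rfl).trans ?_
  simp only [eLpNorm_one_eq_lintegral_enorm, enorm_indicator_eq_indicator_enorm]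
  rw [Finset.sum_congr rfl fun i _ => lintegral_indicator (hD i) _,
    ← lintegral_biUnion_finset (fun i _ j _ h => hdisj h) fun i _ => hD i]
  exact setLIntegral_le_lintegral _ _

end Compensator

section Weights

/-- The weighted sum of a sequence. -/
noncomputable def wavg {F : Type*} [AddCommGroup F] [Module ℝ F] (w : ℕ →₀ ℝ) (f : ℕ → F) : F :=
  ∑ j ∈ w.support, w j • f j

variable {Ω : Type*} {m : MeasurableSpace Ω} {μ : Measure Ω}
  {E : Type*} [NormedAddCommGroup E] 

/-- A sequence of functions that is Cauchy for the `L¹` seminorm. -/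
def CauchyL1 (μ : Measure Ω) (U : ℕ → Ω → E) : Prop :=
  Tendsto (fun p : ℕ × ℕ => eLpNorm (U p.1 - U p.2) 1 μ) atTop (nhds 0)

variable [NormedSpace ℝ E]

lemma wavg_apply (w : ℕ →₀ ℝ) (f : ℕ → Ω → E) (ω : Ω) :
    wavg w f ω = wavg w fun j => f j ω := by
  simp [wavg]

lemma eLpNorm_wavg_le {w : ℕ →₀ ℝ} (h0 : ∀ j, 0 ≤ w j) (h1 : ∑ j ∈ w.support, w j = 1)
    {f : ℕ → Ω → E} (hf : ∀ j, AEStronglyMeasurable (f j) μ) {c : ℝ≥0∞}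
    (hc : ∀ j, eLpNorm (f j) 1 μ ≤ c) : eLpNorm (wavg w f) 1 μ ≤ c := by
  refine (eLpNorm_sum_le (fun j _ => (hf j).const_smul _) le_rfl).trans ?_
  calc ∑ j ∈ w.support, eLpNorm (w j • f j) 1 μ ≤ ∑ j ∈ w.support, ENNReal.ofReal (w j) * c := by
        refine Finset.sum_le_sum fun j _ => ?_
        rw [eLpNorm_const_smul, Real.enorm_of_nonneg (h0 j)]
        gcongr
        exact hc j
    _ = c := by
        rw [← Finset.sum_mul, ← ENNReal.ofReal_sum_of_nonneg fun j _ => h0 j, h1]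
        simp

lemma wavg_ae_congr {w : ℕ →₀ ℝ} {f g : ℕ → Ω → E} (h : ∀ j, f j =ᵐ[μ] g j) :
    wavg w f =ᵐ[μ] wavg w g := by
  filter_upwards [ae_all_iff.2 h] with ω hω
  simp [wavg_apply, hω]

variable [CompleteSpace E]

lemma discComp_sub {𝒢 : ℕ → MeasurableSpace Ω} {D : ℕ → Set Ω} (hD : ∀ i, MeasurableSet (D i))
    {f g : Ω → E} (hf : Integrable f μ) (hg : Integrable g μ) (k : ℕ) :
    discComp μ 𝒢 D k (f - g) =ᵐ[μ] discComp μ 𝒢 D k f - discComp μ 𝒢 D k g := by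
  have h : ∀ i, μ[(D i).indicator (f - g) | 𝒢 i] =ᵐ[μ]
      μ[(D i).indicator f | 𝒢 i] - μ[(D i).indicator g | 𝒢 i] := fun i => by
    rw [indicator_sub']
    exact condExp_sub (hf.indicator (hD i)) (hg.indicator (hD i)) _
  filter_upwards [ae_all_iff.2 h] with ω hω
  simp [discComp, hω]

lemma discComp_simpleFunc [IsFiniteMeasure μ] {𝒢 : ℕ → MeasurableSpace Ω} {D : ℕ → Set Ω}
    (hD : ∀ i, MeasurableSet (D i)) (s : SimpleFunc Ω E) (k : ℕ) :
    discComp μ 𝒢 D k s =ᵐ[μ] fun ω => ∑ x ∈ s.range,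
      discComp μ 𝒢 D k ((s ⁻¹' {x}).indicator fun _ => (1 : ℝ)) ω • x := by
  have h1 i : (D i).indicator (s : Ω → E) = ∑ x ∈ s.range,
      ((D i).indicator ((s ⁻¹' {x}).indicator fun _ => (1 : ℝ))) • fun _ => x := by
    ext ω
    rw [Finset.sum_apply, Finset.sum_eq_single (s ω)]
    · by_cases h : ω ∈ D i <;> simp [h]
    · intro x _ hx
      have : ω ∉ s ⁻¹' {x} := fun h => hx h.symm
      by_cases h : ω ∈ D i <;> simp [h, this]
    · simp
  have hi i (x : E) : Integrable ((D i).indicator ((s ⁻¹' {x}).indicator fun _ => (1 : ℝ))) μ :=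
    ((integrable_const _).indicator (s.measurableSet_preimage _)).indicator (hD i)
  have hT (x : E) (f : Ω → ℝ) : (f • fun _ => x) =
      (ContinuousLinearMap.toSpanSingleton ℝ x) ∘ f := by
    ext ω; simp
  have h2 : ∀ i, ∀ x ∈ s.range, μ[((D i).indicator ((s ⁻¹' {x}).indicator fun _ => (1 : ℝ))) •
      (fun _ => x) | 𝒢 i] =ᵐ[μ] fun ω =>
      μ[(D i).indicator ((s ⁻¹' {x}).indicator fun _ => (1 : ℝ)) | 𝒢 i] ω • x := fun i x _ => by
    rw [hT]
    filter_upwards [(ContinuousLinearMap.toSpanSingleton ℝ x).comp_condExp_comm (hi i x)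
      (m := 𝒢 i)] with ω hω
    rw [← hω]; simp
  have h3 : ∀ i, μ[(D i).indicator (s : Ω → E) | 𝒢 i] =ᵐ[μ] fun ω => ∑ x ∈ s.range,
      μ[(D i).indicator ((s ⁻¹' {x}).indicator fun _ => (1 : ℝ)) | 𝒢 i] ω • x := fun i => by
    rw [h1]
    have h4 := condExp_finsetSum (s := s.range) (μ := μ) (f := fun x =>
      ((D i).indicator ((s ⁻¹' {x}).indicator fun _ => (1 : ℝ))) • fun _ => x)
      (fun x _ => by
        rw [hT]; exact (ContinuousLinearMap.toSpanSingleton ℝ x).integrable_comp (hi i x)) (𝒢 i)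
    filter_upwards [h4, (ae_ball_iff s.range.countable_toSet).2 (h2 i)] with ω h5 h6
    rw [h5, Finset.sum_apply]
    exact Finset.sum_congr rfl fun x hx => h6 x hx
  filter_upwards [ae_all_iff.2 h3] with ω hω
  simp only [discComp, Finset.sum_apply, hω, Finset.sum_smul]
  exact Finset.sum_comm

variable {𝒢 : ℕ → ℕ → MeasurableSpace Ω} {D : ℕ → ℕ → Set Ω}

lemma norm_toLp_discComp_le [IsProbabilityMeasure μ]
    {𝒢 : ℕ → MeasurableSpace Ω} {D : ℕ → Set Ω} (h𝒢 : ∀ i, 𝒢 i ≤ m) (hmono : Monotone 𝒢)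
    (hD : ∀ i, MeasurableSet (D i)) (hdisj : Pairwise fun i j => Disjoint (D i) (D j)) (k : ℕ) :
    ‖(memLp_and_integral_sq_discComp_le (μ := μ) h𝒢 hmono hD hdisj k).1.toLp‖ ≤ 2 := by
  obtain ⟨h1, h2⟩ := memLp_and_integral_sq_discComp_le (μ := μ) h𝒢 hmono hD hdisj k
  refine le_of_sq_le_sq ?_ (by norm_num)
  rw [← real_inner_self_eq_norm_sq, L2.inner_def]
  refine (le_of_eq ?_).trans (h2.trans (by norm_num))
  refine integral_congr_ae ?_
  filter_upwards [h1.coeFn_toLp] with ω hω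
  rw [hω, real_inner_self_eq_norm_sq]
  simp

/-- Common convex weights for which the discrete compensators of countably many events
form Cauchy sequences in `L¹`. -/
lemma exists_weights_sets [IsProbabilityMeasure μ] (h𝒢 : ∀ j i, 𝒢 j i ≤ m)
    (hmono : ∀ j, Monotone (𝒢 j)) (hD : ∀ j i, MeasurableSet (D j i))
    (hdisj : ∀ j, Pairwise fun i i' => Disjoint (D j i) (D j i'))
    {κ : Type*} [Countable κ] (B : κ → Set Ω) (hB : ∀ b, MeasurableSet (B b)) (k : κ → ℕ → ℕ) :
    ∃ w : ℕ → ℕ →₀ ℝ, IsConvexWeights w ∧ ∀ b, CauchyL1 μ fun n => wavg (w n) fun j =>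
      discComp μ (𝒢 j) (D j) (k b j) ((B b).indicator fun _ => (1 : ℝ)) := by
  have hBD b j i : MeasurableSet (D j i ∩ B b) := (hD j i).inter (hB b)
  have hdis b j : Pairwise fun i i' => Disjoint (D j i ∩ B b) (D j i' ∩ B b) := fun i i' h =>
    (hdisj j h).mono inter_subset_left inter_subset_left
  have hcomp b j : discComp μ (𝒢 j) (D j) (k b j) ((B b).indicator fun _ => (1 : ℝ)) =
      discComp μ (𝒢 j) (fun i => D j i ∩ B b) (k b j) fun _ => (1 : ℝ) := by
    simp only [discComp, indicator_indicator]
  have hmem b j := (memLp_and_integral_sq_discComp_le (μ := μ) (h𝒢 j) (hmono j) (hBD b j) (hdis b j)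
    (k b j)).1
  let x : κ → ℕ → Lp ℝ 2 μ := fun b j => (hmem b j).toLp
  have hx b j : ‖x b j‖ ≤ 2 :=
    norm_toLp_discComp_le (h𝒢 j) (hmono j) (hBD b j) (hdis b j) (k b j)
  obtain ⟨w, hw, hcau⟩ : ∃ w : ℕ → ℕ →₀ ℝ, IsConvexWeights w ∧
      ∀ b, CauchySeq fun n => wavg (w n) (x b) := by
    rcases isEmpty_or_nonempty κ with h | h
    · obtain ⟨w, hw, -⟩ := exists_isConvexWeights_cauchySeq (fun _ _ => (0 : ℝ)) (fun _ => 0)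
        (by simp)
      exact ⟨w, hw, fun b => h.elim b⟩
    · obtain ⟨f, hf⟩ := exists_surjective_nat κ
      obtain ⟨w, hw, hcau⟩ := exists_isConvexWeights_cauchySeq (fun i => x (f i)) (fun _ => 2)
        (fun i j => hx _ _)
      refine ⟨w, hw, fun b => ?_⟩
      obtain ⟨i, rfl⟩ := hf b
      exact hcau i
  refine ⟨w, hw, fun b => ?_⟩
  have hae n : (wavg (w n) (x b) : Lp ℝ 2 μ) =ᵐ[μ] wavg (w n) fun j =>
      discComp μ (𝒢 j) (D j) (k b j) ((B b).indicator fun _ => (1 : ℝ)) := by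
    have h1 : ∀ j, (w n j • x b j : Lp ℝ 2 μ) =ᵐ[μ] fun ω => w n j •
      discComp μ (𝒢 j) (D j) (k b j) ((B b).indicator fun _ => (1 : ℝ)) ω := fun j => by
      filter_upwards [Lp.coeFn_smul (w n j) (x b j), (hmem b j).coeFn_toLp] with ω h1 h2
      rw [h1, Pi.smul_apply, hcomp, h2]
    filter_upwards [Lp.coeFn_finsetSum (w n).support fun j => w n j • x b j, ae_all_iff.2 h1]
      with ω h2 h3
    rw [wavg, h2, Finset.sum_apply, wavg_apply, wavg]
    exact Finset.sum_congr rfl fun j _ => h3 j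
  have h1 := cauchySeq_iff_tendsto_dist_atTop_0.1 (hcau b)
  have h2 := ENNReal.tendsto_ofReal h1
  rw [ENNReal.ofReal_zero] at h2
  refine tendsto_of_tendsto_of_tendsto_of_le_of_le tendsto_const_nhds h2 (fun _ => zero_le)
    fun p => ?_
  rw [← edist_dist, Lp.edist_def, eLpNorm_congr_ae ((hae p.1).sub (hae p.2))]
  refine eLpNorm_le_eLpNorm_of_exponent_le (by norm_num) ?_
  exact ((Lp.aestronglyMeasurable _).congr (hae p.1)).sub
      ((Lp.aestronglyMeasurable _).congr (hae p.2))

end Weights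

section IntegrableWeights

variable {Ω : Type*} {m : MeasurableSpace Ω} {μ : Measure Ω}
  {E : Type*} [NormedAddCommGroup E] [NormedSpace ℝ E] [CompleteSpace E]

omit [NormedSpace ℝ E] [CompleteSpace E] in
lemma CauchyL1.congr {U V : ℕ → Ω → E} (hU : CauchyL1 μ U) (h : ∀ n, V n =ᵐ[μ] U n) :
    CauchyL1 μ V :=
  Tendsto.congr (fun p => (eLpNorm_congr_ae ((h p.1).sub (h p.2))).symm) hU

variable {𝒢 : ℕ → ℕ → MeasurableSpace Ω} {D : ℕ → ℕ → Set Ω} {w : ℕ → ℕ →₀ ℝ}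

lemma aestronglyMeasurable_discComp {𝒢 : ℕ → MeasurableSpace Ω} {D : ℕ → Set Ω} (k : ℕ)
    (η : Ω → E) : AEStronglyMeasurable (discComp μ 𝒢 D k η) μ :=
  Finset.aestronglyMeasurable_sum _ fun _ _ => integrable_condExp.1

omit [CompleteSpace E] in
lemma aestronglyMeasurable_wavg {v : ℕ →₀ ℝ} {f : ℕ → Ω → E}
    (hf : ∀ j, AEStronglyMeasurable (f j) μ) : AEStronglyMeasurable (wavg v f) μ :=
  Finset.aestronglyMeasurable_sum _ fun j _ => (hf j).const_smul _

lemma cauchyL1_simpleFunc [IsProbabilityMeasure μ] (hD : ∀ j i, MeasurableSet (D j i))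
    (s : SimpleFunc Ω E) (k : ℕ → ℕ)
    (h : ∀ x ∈ s.range, CauchyL1 μ fun n => wavg (w n) fun j =>
      discComp μ (𝒢 j) (D j) (k j) ((s ⁻¹' {x}).indicator fun _ => (1 : ℝ))) :
    CauchyL1 μ fun n => wavg (w n) fun j => discComp μ (𝒢 j) (D j) (k j) s := by
  let u : E → ℕ → Ω → ℝ := fun x n => wavg (w n) fun j =>
      discComp μ (𝒢 j) (D j) (k j) ((s ⁻¹' {x}).indicator fun _ => (1 : ℝ))
  have hum x n : AEStronglyMeasurable (u x n) μ :=
    aestronglyMeasurable_wavg fun j => aestronglyMeasurable_discComp _ _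
  have hae n : (wavg (w n) fun j => discComp μ (𝒢 j) (D j) (k j) s) =ᵐ[μ]
      ∑ x ∈ s.range, fun ω => u x n ω • x := by
    refine (wavg_ae_congr fun j => discComp_simpleFunc (hD j) s (k j)).trans
      (.of_forall fun ω => ?_)
    simp only [wavg_apply, Finset.sum_apply, u]
    simp only [wavg, Finset.smul_sum, Finset.sum_smul, smul_assoc]
    exact Finset.sum_comm
  refine CauchyL1.congr ?_ hae
  have hlim : Tendsto (fun p : ℕ × ℕ => ∑ x ∈ s.range, eLpNorm (u x p.1 - u x p.2) 1 μ * ‖x‖ₑ)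
      atTop (nhds (∑ x ∈ s.range, 0 * ‖x‖ₑ)) :=
    tendsto_finsetSum _ fun x hx => ENNReal.Tendsto.mul_const (h x hx) (by simp)
  simp only [zero_mul, Finset.sum_const_zero] at hlim
  refine tendsto_of_tendsto_of_tendsto_of_le_of_le tendsto_const_nhds hlim (fun _ => zero_le)
    fun p => ?_
  simp only
  rw [← Finset.sum_sub_distrib]
  refine (eLpNorm_sum_le (fun x _ => ?_) le_rfl).trans (Finset.sum_le_sum fun x _ => ?_)
  · exact ((hum x _).smul_const x).sub ((hum x _).smul_const x)
  · simp only [eLpNorm_one_eq_lintegral_enorm, Pi.sub_apply, ← sub_smul, enorm_smul]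
    rw [lintegral_mul_const'']
    exact ((hum x _).sub (hum x _)).enorm

/-- Passing from a dense set of functions to a general one. -/
lemma cauchyL1_of_approx [IsProbabilityMeasure μ] (hw : IsConvexWeights w)
    (hD : ∀ j i, MeasurableSet (D j i))
    (hdisj : ∀ j, Pairwise fun i i' => Disjoint (D j i) (D j i')) (k : ℕ → ℕ)
    {η : Ω → E} (hη : Integrable η μ)
    (h : ∀ ε : ℝ≥0∞, 0 < ε → ∃ s : Ω → E, Integrable s μ ∧ eLpNorm (η - s) 1 μ ≤ ε ∧
      CauchyL1 μ fun n => wavg (w n) fun j => discComp μ (𝒢 j) (D j) (k j) s) :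
    CauchyL1 μ fun n => wavg (w n) fun j => discComp μ (𝒢 j) (D j) (k j) η := by
  refine ENNReal.tendsto_nhds_zero.2 fun ε hε => ?_
  have hε3 : 0 < ε / 3 := ENNReal.div_pos hε.ne' (by simp)
  obtain ⟨s, hs, hηs, hcau⟩ := h (ε / 3) hε3
  let U : (Ω → E) → ℕ → Ω → E := fun ζ n => wavg (w n) fun j => discComp μ (𝒢 j) (D j) (k j) ζ
  have hUm ζ n : AEStronglyMeasurable (U ζ n) μ :=
    aestronglyMeasurable_wavg fun j => aestronglyMeasurable_discComp _ _
  have hsub n : U (η - s) n =ᵐ[μ] U η n - U s n := by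
    refine (wavg_ae_congr fun j => discComp_sub (hD j) hη hs (k j)).trans
      (.of_forall fun ω => ?_)
    simp only [wavg_apply, Pi.sub_apply, U]
    simp [wavg, smul_sub]
  have hbd n : eLpNorm (U (η - s) n) 1 μ ≤ ε / 3 :=
    eLpNorm_wavg_le (hw.nonneg n) (hw.sum_eq_one n) (fun j => aestronglyMeasurable_discComp _ _)
      fun j => (eLpNorm_discComp_le (hD j) (hdisj j) _ _).trans hηs
  filter_upwards [ENNReal.tendsto_nhds_zero.1 hcau (ε / 3) hε3] with p hp
  have e : U η p.1 - U η p.2 =ᵐ[μ] (U (η - s) p.1 + (U s p.1 - U s p.2)) - U (η - s) p.2 := by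
    filter_upwards [hsub p.1, hsub p.2] with ω h1 h2
    simp only [Pi.sub_apply, Pi.add_apply] at h1 h2 ⊢
    rw [h1, h2]; abel
  change eLpNorm (U η p.1 - U η p.2) 1 μ ≤ ε
  rw [eLpNorm_congr_ae e]
  refine (eLpNorm_sub_le ((hUm _ _).add ((hUm _ _).sub (hUm _ _))) (hUm _ _) le_rfl).trans ?_
  refine (add_le_add (eLpNorm_add_le (hUm _ _) ((hUm _ _).sub (hUm _ _)) le_rfl) le_rfl).trans ?_
  calc _ ≤ ε / 3 + ε / 3 + ε / 3 := add_le_add (add_le_add (hbd _) hp) (hbd _)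
    _ = ε := ENNReal.add_thirds ε

/-- Common convex weights for which the discrete compensators of countably many integrable
functions form Cauchy sequences in `L¹`. -/
lemma exists_weights_cauchyL1 [IsProbabilityMeasure μ] (h𝒢 : ∀ j i, 𝒢 j i ≤ m)
    (hmono : ∀ j, Monotone (𝒢 j)) (hD : ∀ j i, MeasurableSet (D j i))
    (hdisj : ∀ j, Pairwise fun i i' => Disjoint (D j i) (D j i'))
    {ι : Type*} [Countable ι] (η : ι → Ω → E) (hη : ∀ p, Integrable (η p) μ) (k : ι → ℕ → ℕ) :
    ∃ w : ℕ → ℕ →₀ ℝ, IsConvexWeights w ∧ ∀ p, CauchyL1 μ fun n => wavg (w n) fun j =>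
      discComp μ (𝒢 j) (D j) (k p j) (η p) := by
  have hex (p : ι) (r : ℕ) := (memLp_one_iff_integrable.2 (hη p)).exists_simpleFunc_eLpNorm_sub_lt
    ENNReal.one_ne_top (ε := ((r : ℝ≥0∞) + 1)⁻¹) (by simp)
  choose s hs hsi using hex
  obtain ⟨w, hw, hcau⟩ := exists_weights_sets (μ := μ) h𝒢 hmono hD hdisj
    (κ := Σ pr : ι × ℕ, (s pr.1 pr.2).range)
    (fun b => s b.1.1 b.1.2 ⁻¹' {(b.2 : E)}) (fun b => SimpleFunc.measurableSet_preimage _ _)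
    fun b => k b.1.1
  refine ⟨w, hw, fun p => cauchyL1_of_approx hw hD hdisj (k p) (hη p) fun ε hε => ?_⟩
  obtain ⟨r, hr⟩ := ENNReal.exists_inv_nat_lt hε.ne'
  refine ⟨s p r, memLp_one_iff_integrable.1 (hsi p r), (hs p r).le.trans ?_,
    cauchyL1_simpleFunc hD (s p r) (k p) fun x hx => hcau ⟨(p, r), ⟨x, hx⟩⟩⟩
  exact (ENNReal.inv_le_inv.2 le_self_add).trans hr.le

omit [NormedSpace ℝ E] in
/-- Countably many `L¹`-Cauchy sequences converge almost everywhere along a common subsequence. -/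
lemma exists_subseq_tendsto {ι : Type*} [Encodable ι] {U : ι → ℕ → Ω → E}
    (hm : ∀ p n, AEStronglyMeasurable (U p n) μ) (hU : ∀ p, CauchyL1 μ (U p)) :
    ∃ φ : ℕ → ℕ, (∀ n, n ≤ φ n) ∧ ∃ g : ι → Ω → E,
      (∀ p, ∀ᵐ ω ∂μ, Tendsto (fun n => U p (φ n) ω) atTop (nhds (g p ω))) ∧
      ∀ p, Tendsto (fun n => eLpNorm (U p (φ n) - g p) 1 μ) atTop (nhds 0) := by
  have hex (p : ι) (n : ℕ) : ∃ N, ∀ a b, N ≤ a → N ≤ b →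
      eLpNorm (U p a - U p b) 1 μ < 2⁻¹ ^ n := by
    have := (hU p).eventually (gt_mem_nhds (show (0 : ℝ≥0∞) < 2⁻¹ ^ n from
      ENNReal.pow_pos (by simp) n))
    obtain ⟨N, hN⟩ := eventually_atTop.1 this
    exact ⟨max N.1 N.2, fun a b ha hb => hN (a, b)
      ⟨(le_max_left _ _).trans ha, (le_max_right _ _).trans hb⟩⟩
  choose T hT using hex
  let S : ℕ → ℕ → ℕ := fun e n => match Encodable.decode (α := ι) e with
    | some p => T p n
    | none => 0
  let φ : ℕ → ℕ := fun n => n + ∑ i ∈ Finset.range (n + 1), ∑ e ∈ Finset.range (n + 1), S e i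
  have hφmono : Monotone φ := fun a b hab => by
    refine add_le_add hab ?_
    have hsub : Finset.range (a + 1) ⊆ Finset.range (b + 1) := Finset.range_mono (by omega)
    exact (Finset.sum_le_sum fun i _ => Finset.sum_le_sum_of_subset hsub).trans
      (Finset.sum_le_sum_of_subset hsub)
  have hφT (p : ι) (n : ℕ) (h : Encodable.encode p ≤ n) (i : ℕ) (hi : i ≤ n) : T p i ≤ φ n := by
    have h1 : T p i = S (Encodable.encode p) i := by simp [S]
    rw [h1]
    refine le_trans ?_ (Nat.le_add_left _ _)
    refine le_trans ?_ (Finset.single_le_sum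
      (f := fun i => ∑ e ∈ Finset.range (n + 1), S e i) (fun _ _ => Nat.zero_le _)
      (Finset.mem_range.2 (Nat.lt_succ_of_le hi)))
    exact Finset.single_le_sum (f := fun e => S e i) (fun _ _ => Nat.zero_le _)
      (Finset.mem_range.2 (Nat.lt_succ_of_le h))
  have hB : ∑' n : ℕ, (2⁻¹ : ℝ≥0∞) ^ n ≠ ∞ := by
    rw [ENNReal.tsum_geometric]; simp
  have hcau (p : ι) (N n n' : ℕ) (hn : N ≤ n) (hn' : N ≤ n') :
      eLpNorm (U p (φ (n + Encodable.encode p)) - U p (φ (n' + Encodable.encode p))) 1 μ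
        < 2⁻¹ ^ N :=
    hT p N _ _ (hφT p _ (Nat.le_add_left _ _) N (by omega))
      (hφT p _ (Nat.le_add_left _ _) N (by omega))
  have hae (p : ι) := Lp.ae_tendsto_of_cauchy_eLpNorm (fun n => hm p (φ (n + Encodable.encode p)))
    le_rfl hB (hcau p)
  classical
  have hg (p : ι) : ∃ g : Ω → E, ∀ᵐ ω ∂μ,
      Tendsto (fun n => U p (φ (n + Encodable.encode p)) ω) atTop (nhds (g ω)) :=
    ⟨fun ω => if h : ∃ l, Tendsto (fun n => U p (φ (n + Encodable.encode p)) ω) atTop (nhds l)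
      then h.choose else 0, by
      filter_upwards [hae p] with ω h
      rw [dif_pos h]
      exact h.choose_spec⟩
  choose g hg using hg
  refine ⟨φ, fun n => Nat.le_add_right _ _, g, fun p => ?_, fun p => ?_⟩
  · filter_upwards [hg p] with ω h
    exact (tendsto_add_atTop_iff_nat (f := fun n => U p (φ n) ω) _).1 h
  · exact (tendsto_add_atTop_iff_nat (f := fun n => eLpNorm (U p (φ n) - g p) 1 μ) _).1
      (Lp.cauchy_tendsto_of_tendsto (fun n => hm p (φ (n + Encodable.encode p))) (g p) hB
        (hcau p) (hg p))

/-- Common convex weights for which the discrete compensators of countably many integrable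
functions converge, almost everywhere and in `L¹`. -/
lemma exists_weights_tendsto [IsProbabilityMeasure μ] (h𝒢 : ∀ j i, 𝒢 j i ≤ m)
    (hmono : ∀ j, Monotone (𝒢 j)) (hD : ∀ j i, MeasurableSet (D j i))
    (hdisj : ∀ j, Pairwise fun i i' => Disjoint (D j i) (D j i'))
    {ι : Type*} [Encodable ι] (η : ι → Ω → E) (hη : ∀ p, Integrable (η p) μ) (k : ι → ℕ → ℕ) :
    ∃ w : ℕ → ℕ →₀ ℝ, IsConvexWeights w ∧ ∃ g : ι → Ω → E,
      (∀ p, ∀ᵐ ω ∂μ, Tendsto (fun n => wavg (w n) (fun j =>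
        discComp μ (𝒢 j) (D j) (k p j) (η p)) ω) atTop (nhds (g p ω))) ∧
      ∀ p, Tendsto (fun n => eLpNorm ((wavg (w n) fun j =>
        discComp μ (𝒢 j) (D j) (k p j) (η p)) - g p) 1 μ) atTop (nhds 0) := by
  obtain ⟨w, hw, hcau⟩ := exists_weights_cauchyL1 (μ := μ) h𝒢 hmono hD hdisj η hη k
  obtain ⟨φ, hφ, g, h1, h2⟩ := exists_subseq_tendsto
    (fun p n => aestronglyMeasurable_wavg fun j => aestronglyMeasurable_discComp _ _) hcau
  exact ⟨fun n => w (φ n), ⟨fun n => hw.nonneg _,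
    fun n j h => hw.zero_of_lt _ j (h.trans_le (hφ n)),
    fun n => hw.sum_eq_one _⟩, g, h1, h2⟩

end IntegrableWeights

section Cone

variable {X : Type*} [NormedAddCommGroup X]

/-- The closed convex cone of all `(x, r)` with `‖x‖ ≤ r`. -/
def cone (X : Type*) [NormedAddCommGroup X] : Set (X × ℝ) := {p | ‖p.1‖ ≤ p.2}

lemma mem_cone {p : X × ℝ} : p ∈ cone X ↔ ‖p.1‖ ≤ p.2 := Iff.rfl

lemma cone_snd_nonneg {p : X × ℝ} (h : p ∈ cone X) : 0 ≤ p.2 := (norm_nonneg _).trans h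

lemma cone_norm_eq {p : X × ℝ} (h : p ∈ cone X) : ‖p‖ = p.2 := by
  rw [Prod.norm_def, Real.norm_of_nonneg (cone_snd_nonneg h), max_eq_right h]

lemma zero_mem_cone : (0 : X × ℝ) ∈ cone X := by simp [mem_cone]

lemma add_mem_cone {p q : X × ℝ} (hp : p ∈ cone X) (hq : q ∈ cone X) : p + q ∈ cone X :=
  (norm_add_le _ _).trans (add_le_add hp hq)

lemma smul_mem_cone [NormedSpace ℝ X] {c : ℝ} (hc : 0 ≤ c) {p : X × ℝ} (hp : p ∈ cone X) :
    c • p ∈ cone X := by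
  have : ‖c • p.1‖ ≤ c • p.2 := by
    rw [norm_smul, Real.norm_of_nonneg hc]
    exact mul_le_mul_of_nonneg_left hp hc
  exact this

lemma sum_mem_cone {ι : Type*} (s : Finset ι) {f : ι → X × ℝ} (h : ∀ i ∈ s, f i ∈ cone X) :
    ∑ i ∈ s, f i ∈ cone X :=
  Finset.sum_induction _ (· ∈ cone X) (fun _ _ => add_mem_cone) zero_mem_cone h

lemma isClosed_cone : IsClosed (cone X) :=
  isClosed_le continuous_fst.norm continuous_snd

lemma sub_mem_cone_trans {p q r : X × ℝ} (h1 : p - q ∈ cone X) (h2 : q - r ∈ cone X) :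
    p - r ∈ cone X := by
  simpa using add_mem_cone h1 h2

lemma norm_sub_eq_of_sub_mem_cone {p q : X × ℝ} (h : p - q ∈ cone X) :
    ‖p - q‖ = p.2 - q.2 := cone_norm_eq h

/-- Dyadic times. -/
def dyadics : Set ℝ≥0 := range fun p : ℕ × ℕ => dy p.1 p.2

lemma dy_mem (l q : ℕ) : dy l q ∈ dyadics := ⟨(l, q), rfl⟩

lemma dyUp_mem (n : ℕ) (t : ℝ≥0) : dyUp n t ∈ dyadics := dy_mem _ _

lemma zero_mem_dyadics : (0 : ℝ≥0) ∈ dyadics := ⟨(0, 0), by simp [dy]⟩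

lemma dist_le_of_cone {f : ℝ≥0 → X × ℝ} (h : ∀ s t, s ≤ t → f t - f s ∈ cone X) (s t : ℝ≥0) :
    dist (f s) (f t) ≤ dist (f s).2 (f t).2 := by
  rcases le_total s t with hst | hst
  · rw [dist_comm, dist_comm (f s).2, dist_eq_norm, norm_sub_eq_of_sub_mem_cone (h s t hst)]
    exact le_abs_self _
  · rw [dist_eq_norm, norm_sub_eq_of_sub_mem_cone (h t s hst)]
    exact le_abs_self _

/-- A path with increments in the cone has left limits. -/
lemma exists_leftLim_of_cone [CompleteSpace X] {f : ℝ≥0 → X × ℝ}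
    (h : ∀ s t, s ≤ t → f t - f s ∈ cone X) (t : ℝ≥0) (ht : 0 < t) :
    ∃ l, Tendsto f (nhdsWithin t (Iio t)) (nhds l) := by
  have hmono : Monotone fun s => (f s).2 := fun s u hsu =>
    sub_nonneg.1 (cone_snd_nonneg (h s u hsu))
  have hne : (nhdsWithin t (Iio t)).NeBot := nhdsLT_neBot_of_exists_lt ⟨0, ht⟩
  rw [← cauchy_map_iff_exists_tendsto]
  have hc : Cauchy (map (fun s => (f s).2) (nhdsWithin t (Iio t))) :=
    cauchy_map_iff_exists_tendsto.2 ⟨_, hmono.tendsto_leftLim t⟩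
  rw [cauchy_map_iff] at hc ⊢
  refine ⟨hne, Metric.uniformity_basis_dist.tendsto_right_iff.2 fun ε hε => ?_⟩
  filter_upwards [Metric.uniformity_basis_dist.tendsto_right_iff.1 hc.2 ε hε] with p hp
  exact (dist_le_of_cone h _ _).trans_lt hp

/-- Right-continuous regularization of a path given on dyadic times. -/
lemma exists_regularization [CompleteSpace X] {b : ℝ≥0 → X × ℝ}
    (h : ∀ s ∈ dyadics, ∀ t ∈ dyadics, s ≤ t → b t - b s ∈ cone X) (h0 : b 0 = 0) (t : ℝ≥0) :
    ∃ l, Tendsto (fun n => b (dyUp n t)) atTop (nhds l) := by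
  have hb n m (hnm : n ≤ m) : b (dyUp n t) - b (dyUp m t) ∈ cone X :=
    h _ (dyUp_mem _ _) _ (dyUp_mem _ _) (dyUp_anti hnm t)
  have hanti : Antitone fun n => (b (dyUp n t)).2 := fun n m hnm =>
    sub_nonneg.1 (cone_snd_nonneg (hb n m hnm))
  have hnn n : 0 ≤ (b (dyUp n t)).2 := by
    have := cone_snd_nonneg (h 0 zero_mem_dyadics _ (dyUp_mem n t) zero_le)
    simpa [h0] using this
  have hc : CauchySeq fun n => (b (dyUp n t)).2 :=
    (tendsto_atTop_ciInf hanti ⟨0, by rintro _ ⟨n, rfl⟩; exact hnn n⟩).cauchySeq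
  refine cauchySeq_tendsto_of_complete ?_
  rw [Metric.cauchySeq_iff] at hc ⊢
  intro ε hε
  obtain ⟨N, hN⟩ := hc ε hε
  refine ⟨N, fun n hn m hm => lt_of_le_of_lt ?_ (hN n hn m hm)⟩
  rcases le_total n m with hnm | hnm
  · rw [dist_eq_norm, norm_sub_eq_of_sub_mem_cone (hb n m hnm)]
    exact le_abs_self _
  · rw [dist_comm, dist_comm (b (dyUp n t)).2, dist_eq_norm,
      norm_sub_eq_of_sub_mem_cone (hb m n hnm)]
    exact le_abs_self _

variable {b B : ℝ≥0 → X × ℝ}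

lemma regularization_sub_mem (h : ∀ s ∈ dyadics, ∀ t ∈ dyadics, s ≤ t → b t - b s ∈ cone X)
    (hB : ∀ t, Tendsto (fun n => b (dyUp n t)) atTop (nhds (B t))) (s t : ℝ≥0) (hst : s ≤ t) :
    B t - B s ∈ cone X :=
  isClosed_cone.mem_of_tendsto ((hB t).sub (hB s)) (.of_forall fun n =>
    h _ (dyUp_mem _ _) _ (dyUp_mem _ _) (dyUp_mono n hst))

lemma sub_regularization_mem (h : ∀ s ∈ dyadics, ∀ t ∈ dyadics, s ≤ t → b t - b s ∈ cone X)
    (hB : ∀ t, Tendsto (fun n => b (dyUp n t)) atTop (nhds (B t))) {s t : ℝ≥0} (hst : s < t)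
    (ht : t ∈ dyadics) : b t - B s ∈ cone X := by
  refine isClosed_cone.mem_of_tendsto ((hB s).const_sub (b t)) ?_
  obtain ⟨n, hn⟩ := exists_dyUp_lt hst
  filter_upwards [eventually_ge_atTop n] with m hm
  exact h _ (dyUp_mem _ _) _ ht ((dyUp_anti hm s).trans hn.le)

lemma regularization_mem (h : ∀ s ∈ dyadics, ∀ t ∈ dyadics, s ≤ t → b t - b s ∈ cone X)
    (hB : ∀ t, Tendsto (fun n => b (dyUp n t)) atTop (nhds (B t))) (h0 : b 0 = 0) (t : ℝ≥0) :
    B t ∈ cone X :=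
  isClosed_cone.mem_of_tendsto (hB t) (.of_forall fun n => by
    simpa [h0] using h 0 zero_mem_dyadics _ (dyUp_mem n t) zero_le)

lemma regularization_rightContinuous
    (h : ∀ s ∈ dyadics, ∀ t ∈ dyadics, s ≤ t → b t - b s ∈ cone X)
    (hB : ∀ t, Tendsto (fun n => b (dyUp n t)) atTop (nhds (B t))) (t : ℝ≥0) :
    ContinuousWithinAt B (Ici t) t := by
  rw [ContinuousWithinAt, Metric.tendsto_nhds]
  intro ε hε
  obtain ⟨n, hn⟩ := ((Metric.tendsto_nhds.1 (hB t)) ε hε).exists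
  filter_upwards [self_mem_nhdsWithin, mem_nhdsWithin_of_mem_nhds (Iio_mem_nhds (lt_dyUp n t))]
    with s hs hs'
  have h1 := sub_regularization_mem h hB hs' (dyUp_mem n t)
  have h2 := regularization_sub_mem h hB t s hs
  rw [dist_eq_norm, norm_sub_eq_of_sub_mem_cone (sub_mem_cone_trans h1 h2)] at hn
  rw [dist_eq_norm, norm_sub_eq_of_sub_mem_cone h2]
  have := cone_snd_nonneg h1
  simp only [Prod.snd_sub] at this
  linarith

end Cone

section CompensatorLimit

variable {Ω : Type*} {m : MeasurableSpace Ω} {μ : Measure Ω} {ℱ : Filtration ℝ≥0 m}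
  {X : Type*} [NormedAddCommGroup X]
  {τ : Ω → ℝ≥0∞} {ζ : Ω → X × ℝ}

/-- The process that jumps from `0` to `ζ` at time `τ`. -/
noncomputable def jump {Ω F : Type*} [Zero F] (τ : Ω → ℝ≥0∞) (ζ : Ω → F) (t : ℝ≥0) : Ω → F :=
  {ω | τ ω ≤ t}.indicator ζ

lemma jump_of_le {F : Type*} [Zero F] {ζ : Ω → F} {t : ℝ≥0} {ω : Ω} (h : τ ω ≤ t) :
    jump τ ζ t ω = ζ ω :=
  indicator_of_mem (show ω ∈ {ω | τ ω ≤ t} from h) _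

lemma jump_of_lt {F : Type*} [Zero F] {ζ : Ω → F} {t : ℝ≥0} {ω : Ω} (h : t < τ ω) :
    jump τ ζ t ω = 0 :=
  indicator_of_notMem (show ω ∉ {ω | τ ω ≤ t} from not_le.2 h) _

lemma jump_rightContinuous {F : Type*} [Zero F] [TopologicalSpace F] (ζ : Ω → F) (ω : Ω)
    (t : ℝ≥0) : ContinuousWithinAt (fun s => jump τ ζ s ω) (Ici t) t := by
  rcases le_or_gt (τ ω) t with h | h
  · refine (continuousWithinAt_const (b := ζ ω)).congr (fun s hs => jump_of_le ?_) (jump_of_le h)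
    exact h.trans (by exact_mod_cast hs)
  · obtain ⟨u, hu, hu'⟩ := ENNReal.lt_iff_exists_nnreal_btwn.1 h
    refine (continuousWithinAt_const (b := (0 : F))).congr_of_eventuallyEq ?_ (jump_of_lt h)
    filter_upwards [mem_nhdsWithin_of_mem_nhds (Iio_mem_nhds (ENNReal.coe_lt_coe.1 hu))] with s hs
    exact jump_of_lt (lt_trans (by exact_mod_cast hs) hu')

lemma jump_leftLim {F : Type*} [Zero F] [TopologicalSpace F] (ζ : Ω → F) (ω : Ω)
    (t : ℝ≥0) : ∃ l, Tendsto (fun s => jump τ ζ s ω) (nhdsWithin t (Iio t)) (nhds l) := by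
  rcases lt_or_ge (τ ω) t with h | h
  · obtain ⟨u, hu, hu'⟩ := ENNReal.lt_iff_exists_nnreal_btwn.1 h
    refine ⟨ζ ω, tendsto_const_nhds.congr' ?_⟩
    filter_upwards [mem_nhdsWithin_of_mem_nhds (Ioi_mem_nhds (ENNReal.coe_lt_coe.1 hu'))] with s hs
    exact (jump_of_le (hu.le.trans (by exact_mod_cast (mem_Ioi.1 hs).le))).symm
  · refine ⟨0, tendsto_const_nhds.congr' ?_⟩
    filter_upwards [self_mem_nhdsWithin] with s hs
    exact (jump_of_lt (lt_of_lt_of_le (by exact_mod_cast hs) h)).symm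

lemma norm_jump_le {F : Type*} [NormedAddCommGroup F] {ζ : Ω → F} {s t : ℝ≥0} (h : s ≤ t) (ω : Ω) :
    ‖jump τ ζ s ω‖ ≤ ‖jump τ ζ t ω‖ := by
  rcases le_or_gt (τ ω) s with hs | hs
  · rw [jump_of_le hs, jump_of_le (hs.trans (by exact_mod_cast h))]
  · simp [jump_of_lt hs]

/-- An adapted integrable process with a single jump, with values in the cone. -/
structure IsJump (μ : Measure Ω) (ℱ : Filtration ℝ≥0 m) (τ : Ω → ℝ≥0∞) (ζ : Ω → X × ℝ) : Prop where
  isStop : IsStop ℱ τ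
  sm : ∀ t, StronglyMeasurable[ℱ t] (jump τ ζ t)
  int : ∀ t, Integrable (jump τ ζ t) μ
  mem_cone : ∀ ω, ζ ω ∈ cone X

lemma IsJump.sub_mem_cone (h : IsJump μ ℱ τ ζ) {s t : ℝ≥0} (hst : s ≤ t) (ω : Ω) :
    jump τ ζ t ω - jump τ ζ s ω ∈ cone X := by
  rcases le_or_gt (τ ω) s with hs | hs
  · rw [jump_of_le hs, jump_of_le (hs.trans (by exact_mod_cast hst)), sub_self]
    exact zero_mem_cone
  · rw [jump_of_lt hs, sub_zero]
    rcases le_or_gt (τ ω) t with ht | ht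
    · rw [jump_of_le ht]; exact h.mem_cone ω
    · rw [jump_of_lt ht]; exact zero_mem_cone

/-- The event that `τ` falls in the `i`-th dyadic interval of level `j`. -/
def cell (τ : Ω → ℝ≥0∞) (j i : ℕ) : Set Ω := {ω | τ ω ≤ dy j (i + 1)} \ {ω | τ ω ≤ dy j i}

lemma measurableSet_cell (h : IsStop ℱ τ) (j i : ℕ) : MeasurableSet (cell τ j i) :=
  (ℱ.le _ _ (h _)).diff (ℱ.le _ _ (h _))

lemma disjoint_cell (τ : Ω → ℝ≥0∞) (j : ℕ) :
    Pairwise fun i i' => Disjoint (cell τ j i) (cell τ j i') := by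
  have key : ∀ i i', i < i' → Disjoint (cell τ j i) (cell τ j i') := fun i i' hii => by
    refine Set.disjoint_left.2 fun ω h1 h2 => h2.2 (show τ ω ≤ _ from le_trans h1.1 ?_)
    exact_mod_cast dy_mono j hii
  intro i i' hii
  rcases hii.lt_or_gt with h | h
  exacts [key _ _ h, (key _ _ h).symm]

lemma cell_indicator_eq (τ : Ω → ℝ≥0∞) (ζ : Ω → X × ℝ) (j i : ℕ) :
    (cell τ j i).indicator ζ = jump τ ζ (dy j (i + 1)) - jump τ ζ (dy j i) := by
  have hd : (dy j i : ℝ≥0∞) ≤ dy j (i + 1) := by exact_mod_cast dy_mono j i.le_succ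
  ext1 ω
  by_cases h : ω ∈ cell τ j i
  · rw [indicator_of_mem h, Pi.sub_apply, jump_of_le h.1, jump_of_lt (not_le.1 h.2), sub_zero]
  · rw [indicator_of_notMem h, Pi.sub_apply]
    rcases le_or_gt (τ ω) (dy j i) with h1 | h1
    · rw [jump_of_le h1, jump_of_le (h1.trans hd), sub_self]
    · rw [jump_of_lt h1, jump_of_lt, sub_zero]
      exact not_le.1 fun h2 => h ⟨h2, not_le.2 h1⟩

lemma cell_indicator_jump {j i : ℕ} {t : ℝ≥0} (h : dy j (i + 1) ≤ t) :
    (cell τ j i).indicator (jump τ ζ t) = (cell τ j i).indicator ζ :=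
  indicator_congr fun _ hω => jump_of_le (le_trans hω.1 (by exact_mod_cast h))

lemma IsJump.integrable_cell (h : IsJump μ ℱ τ ζ) (j i : ℕ) :
    Integrable ((cell τ j i).indicator ζ) μ := by
  rw [cell_indicator_eq]
  exact (h.int _).sub (h.int _)

variable [NormedSpace ℝ X]

lemma condExp_mem_cone [CompleteSpace X] [IsFiniteMeasure μ] {m' : MeasurableSpace Ω} (hm' : m' ≤ m)
    {f : Ω → X × ℝ} (hf : Integrable f μ) (h : ∀ ω, f ω ∈ cone X) :
    ∀ᵐ ω ∂μ, μ[f | m'] ω ∈ cone X := by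
  have hc : ConvexOn ℝ univ fun p : X × ℝ => ‖p.1‖ - p.2 :=
    ((convexOn_univ_norm (E := X)).comp_linearMap (LinearMap.fst ℝ X ℝ)).sub
      (LinearMap.concaveOn (LinearMap.snd ℝ X ℝ) convex_univ)
  have hcont : Continuous fun p : X × ℝ => ‖p.1‖ - p.2 := continuous_fst.norm.sub continuous_snd
  have hi : Integrable ((fun p : X × ℝ => ‖p.1‖ - p.2) ∘ f) μ := hf.fst.norm.sub hf.snd
  have hle : (fun p : X × ℝ => ‖p.1‖ - p.2) ∘ f ≤ᵐ[μ] 0 := .of_forall fun ω =>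
    sub_nonpos.2 (h ω)
  have h1 := condExp_mono (m := m') hi (integrable_zero _ _ _) hle
  rw [condExp_zero] at h1
  filter_upwards [hc.map_condExp_le hm'
    (hcont.lowerSemicontinuous.lowerSemicontinuousOn _) (.of_forall fun _ => mem_univ _)
    isClosed_univ hf hi, h1] with ω h2 h3
  exact sub_nonpos.1 (h2.trans h3)

/-- The conditional expectation of the increment of the jump process over a dyadic interval. -/
noncomputable def cellExp (μ : Measure Ω) (ℱ : Filtration ℝ≥0 m) (τ : Ω → ℝ≥0∞) (ζ : Ω → X × ℝ)
    (j i : ℕ) : Ω → X × ℝ :=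
  μ[(cell τ j i).indicator ζ | ℱ (dy j i)]

/-- The discrete compensator of the jump process along the dyadic partition of level `j`. -/
noncomputable def dyComp (μ : Measure Ω) (ℱ : Filtration ℝ≥0 m) (τ : Ω → ℝ≥0∞) (ζ : Ω → X × ℝ)
    (j : ℕ) (t : ℝ≥0) : Ω → X × ℝ :=
  ∑ i ∈ Finset.range ⌈t * 2 ^ j⌉₊, cellExp μ ℱ τ ζ j i

lemma ceil_dy_mul {l j : ℕ} (h : l ≤ j) (q : ℕ) : ⌈dy l q * 2 ^ j⌉₊ = q * 2 ^ (j - l) := by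
  rw [dy_refine h]
  unfold dy
  rw [div_mul_cancel₀ _ (by positivity), Nat.ceil_natCast]

lemma lt_ceil_iff_dy_lt {j i : ℕ} {t : ℝ≥0} : i < ⌈t * 2 ^ j⌉₊ ↔ dy j i < t := by
  unfold dy
  rw [Nat.lt_ceil, div_lt_iff₀ (by positivity)]

lemma discComp_eq_dyComp [CompleteSpace X] {l j : ℕ} (h : l ≤ j) (q : ℕ) :
    discComp μ (fun i => ℱ (dy j i)) (cell τ j) ⌈dy l q * 2 ^ j⌉₊ (jump τ ζ (dy l q)) =
      dyComp μ ℱ τ ζ j (dy l q) := by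
  refine Finset.sum_congr rfl fun i hi => ?_
  rw [cellExp, cell_indicator_jump]
  rw [dy_refine h]
  refine dy_mono j ?_
  rw [Finset.mem_range, ceil_dy_mul h] at hi
  exact hi

lemma integrable_dyComp [CompleteSpace X] (j : ℕ) (t : ℝ≥0) : Integrable (dyComp μ ℱ τ ζ j t) μ :=
  integrable_finsetSum' _ fun _ _ => integrable_condExp

lemma stronglyMeasurable_dyComp (j : ℕ) (t : ℝ≥0) :
    StronglyMeasurable[ℱ t] (dyComp μ ℱ τ ζ j t) := by
  refine Finset.stronglyMeasurable_sum _ fun i hi => stronglyMeasurable_condExp.mono (ℱ.mono ?_)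
  exact (lt_ceil_iff_dy_lt.1 (Finset.mem_range.1 hi)).le

lemma wavg_congr_of_zero {F : Type*} [AddCommGroup F] [Module ℝ F] {v : ℕ →₀ ℝ} {l : ℕ}
    (hv : ∀ j < l, v j = 0) {f g : ℕ → F} (h : ∀ j, l ≤ j → f j = g j) : wavg v f = wavg v g := by
  refine Finset.sum_congr rfl fun j _ => ?_
  rcases lt_or_ge j l with hj | hj
  · simp [hv j hj]
  · rw [h j hj]

/-- Averages of the discrete compensators converge at all dyadic times, almost everywhere and in
`L¹`. -/
lemma IsJump.exists_weights [CompleteSpace X] [IsProbabilityMeasure μ] (h : IsJump μ ℱ τ ζ) :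
    ∃ w : ℕ → ℕ →₀ ℝ, IsConvexWeights w ∧ ∃ b : ℝ≥0 → Ω → X × ℝ,
      (∀ t ∈ dyadics, ∀ᵐ ω ∂μ, Tendsto (fun n => wavg (w n) (fun j => dyComp μ ℱ τ ζ j t) ω) atTop
        (nhds (b t ω))) ∧
      ∀ t ∈ dyadics, Tendsto (fun n => eLpNorm ((wavg (w n) fun j => dyComp μ ℱ τ ζ j t) - b t) 1 μ)
        atTop (nhds 0) := by
  have hcount : dyadics.Countable := countable_range _
  have := hcount.to_subtype
  have : Encodable dyadics := Encodable.ofCountable _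
  obtain ⟨w, hw, g, h1, h2⟩ := exists_weights_tendsto (μ := μ) (𝒢 := fun j i => ℱ (dy j i))
    (D := cell τ) (fun _ _ => ℱ.le _) (fun j _ _ hii => ℱ.mono (dy_mono j hii))
    (measurableSet_cell h.isStop) (disjoint_cell τ) (fun t : dyadics => jump τ ζ t)
    (fun t => h.int t) fun t j => ⌈(t : ℝ≥0) * 2 ^ j⌉₊
  have key (l q : ℕ) : ∀ᶠ n in atTop, (wavg (w n) fun j =>
      discComp μ (fun i => ℱ (dy j i)) (cell τ j) ⌈dy l q * 2 ^ j⌉₊ (jump τ ζ (dy l q))) =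
      wavg (w n) fun j => dyComp μ ℱ τ ζ j (dy l q) := by
    filter_upwards [eventually_ge_atTop l] with n hn
    exact wavg_congr_of_zero (l := l) (fun j hj => hw.zero_of_lt n j (hj.trans_le hn))
      fun j hj => discComp_eq_dyComp hj q
  classical
  refine ⟨w, hw, fun t => if ht : t ∈ dyadics then g ⟨t, ht⟩ else 0, ?_, ?_⟩
  · rintro _ ⟨⟨l, q⟩, rfl⟩
    simp only [dy_mem, dite_true]
    filter_upwards [h1 ⟨_, dy_mem l q⟩] with ω hω
    exact hω.congr' ((key l q).mono fun n hn => congrFun hn ω)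
  · rintro _ ⟨⟨l, q⟩, rfl⟩
    simp only [dy_mem, dite_true]
    exact (h2 ⟨_, dy_mem l q⟩).congr' ((key l q).mono fun n hn => by simp only [hn])

end CompensatorLimit

section Regularization

variable {Ω : Type*} {m : MeasurableSpace Ω} {μ : Measure Ω} {ℱ : Filtration ℝ≥0 m}
  {X : Type*} [NormedAddCommGroup X] [NormedSpace ℝ X]
  {τ : Ω → ℝ≥0∞} {ζ : Ω → X × ℝ}

lemma exists_common_dy {s t : ℝ≥0} (hs : s ∈ dyadics) (ht : t ∈ dyadics) (hst : s ≤ t) :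
    ∃ l p q, s = dy l p ∧ t = dy l q ∧ p ≤ q := by
  obtain ⟨⟨l, q⟩, rfl⟩ := ht
  obtain ⟨⟨l', p⟩, rfl⟩ := hs
  refine ⟨max l l', _, _, dy_refine (le_max_right l l') p, dy_refine (le_max_left l l') q, ?_⟩
  simp only at hst
  rw [dy_refine (le_max_left l l') q, dy_refine (le_max_right l l') p] at hst
  unfold dy at hst
  rw [div_le_div_iff_of_pos_right (by positivity)] at hst
  exact_mod_cast hst

lemma dyComp_apply (j : ℕ) (t : ℝ≥0) (ω : Ω) : dyComp μ ℱ τ ζ j t ω =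
    ∑ i ∈ Finset.range ⌈t * 2 ^ j⌉₊, cellExp μ ℱ τ ζ j i ω := by
  simp [dyComp]

lemma dyComp_sub (j : ℕ) {s t : ℝ≥0} (hst : s ≤ t) : dyComp μ ℱ τ ζ j t - dyComp μ ℱ τ ζ j s =
    ∑ i ∈ Finset.Ico ⌈s * 2 ^ j⌉₊ ⌈t * 2 ^ j⌉₊, cellExp μ ℱ τ ζ j i := by
  rw [Finset.sum_Ico_eq_sub _ (by gcongr)]
  rfl

lemma dyComp_sub_mem_cone {ω : Ω} (hω : ∀ j i, cellExp μ ℱ τ ζ j i ω ∈ cone X) (j : ℕ)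
    {s t : ℝ≥0} (hst : s ≤ t) : dyComp μ ℱ τ ζ j t ω - dyComp μ ℱ τ ζ j s ω ∈ cone X := by
  rw [← Pi.sub_apply, dyComp_sub j hst, Finset.sum_apply]
  exact sum_mem_cone _ fun i _ => hω j i

lemma wavg_sub {F : Type*} [AddCommGroup F] [Module ℝ F] (v : ℕ →₀ ℝ) (f g : ℕ → F) :
    wavg v f - wavg v g = wavg v fun j => f j - g j := by
  simp [wavg, smul_sub]

lemma wavg_mem_cone {v : ℕ →₀ ℝ} (hv : ∀ j, 0 ≤ v j) {f : ℕ → X × ℝ} (hf : ∀ j, f j ∈ cone X) :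
    wavg v f ∈ cone X :=
  sum_mem_cone _ fun j _ => smul_mem_cone (hv j) (hf j)

lemma wavg_const {F : Type*} [AddCommGroup F] [Module ℝ F] {v : ℕ →₀ ℝ}
    (hv : ∑ j ∈ v.support, v j = 1) (x : F) : wavg v (fun _ => x) = x := by
  rw [wavg, ← Finset.sum_smul, hv, one_smul]

variable [CompleteSpace X]

lemma IsJump.cellExp_mem_cone [IsFiniteMeasure μ] (h : IsJump μ ℱ τ ζ) :
    ∀ᵐ ω ∂μ, ∀ j i, cellExp μ ℱ τ ζ j i ω ∈ cone X := by
  refine ae_all_iff.2 fun j => ae_all_iff.2 fun i => ?_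
  refine condExp_mem_cone (ℱ.le _) (h.integrable_cell j i) fun ω => ?_
  by_cases hω : ω ∈ cell τ j i
  · rw [indicator_of_mem hω]; exact h.mem_cone ω
  · rw [indicator_of_notMem hω]; exact zero_mem_cone

lemma IsJump.setIntegral_dyComp_sub [IsFiniteMeasure μ] (h : IsJump μ ℱ τ ζ) {l j : ℕ}
    (hlj : l ≤ j) {p q : ℕ} (hpq : p ≤ q) {G : Set Ω} (hG : MeasurableSet[ℱ (dy l p)] G) :
    ∫ ω in G, (dyComp μ ℱ τ ζ j (dy l q) ω - dyComp μ ℱ τ ζ j (dy l p) ω) ∂μ =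
      ∫ ω in G, (jump τ ζ (dy l q) ω - jump τ ζ (dy l p) ω) ∂μ := by
  have hle : p * 2 ^ (j - l) ≤ q * 2 ^ (j - l) := Nat.mul_le_mul_right _ hpq
  simp_rw [← Pi.sub_apply, dyComp_sub j (dy_mono l hpq), Finset.sum_apply, ceil_dy_mul hlj]
  have e : jump τ ζ (dy l q) - jump τ ζ (dy l p) =
      ∑ i ∈ Finset.Ico (p * 2 ^ (j - l)) (q * 2 ^ (j - l)), (cell τ j i).indicator ζ := by
    simp_rw [cell_indicator_eq]
    rw [Finset.sum_Ico_sub (fun i => jump τ ζ (dy j i)) hle, dy_refine hlj, dy_refine hlj]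
  rw [e]
  simp_rw [Finset.sum_apply]
  rw [integral_finsetSum (f := fun i => cellExp μ ℱ τ ζ j i) _
      fun i _ => (integrable_condExp (μ := μ)).integrableOn,
    integral_finsetSum _ fun i _ => (h.integrable_cell j i).integrableOn]
  refine Finset.sum_congr rfl fun i hi => setIntegral_condExp (ℱ.le _) (h.integrable_cell j i) ?_
  refine ℱ.mono ?_ _ hG
  rw [dy_refine hlj]
  exact dy_mono j (Finset.mem_Ico.1 hi).1

/-- The compensator along dyadic times: a limit of averages of discrete compensators. -/
structure IsDyadicCompensator (μ : Measure Ω) (ℱ : Filtration ℝ≥0 m) (τ : Ω → ℝ≥0∞)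
    (ζ : Ω → X × ℝ) (w : ℕ → ℕ →₀ ℝ) (b : ℝ≥0 → Ω → X × ℝ) : Prop where
  weights : IsConvexWeights w
  sm : ∀ t, StronglyMeasurable[ℱ t] (b t)
  sub_mem : ∀ ω, ∀ s ∈ dyadics, ∀ t ∈ dyadics, s ≤ t → b t ω - b s ω ∈ cone X
  zero : ∀ ω, b 0 ω = 0
  ae_tendsto : ∀ᵐ ω ∂μ, ∀ t ∈ dyadics,
    Tendsto (fun n => wavg (w n) (fun j => dyComp μ ℱ τ ζ j t ω)) atTop (nhds (b t ω))
  tendsto_L1 : ∀ t ∈ dyadics,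
    Tendsto (fun n => eLpNorm ((wavg (w n) fun j => dyComp μ ℱ τ ζ j t) - b t) 1 μ) atTop (nhds 0)

lemma IsJump.exists_isDyadicCompensator [IsProbabilityMeasure μ] (h : IsJump μ ℱ τ ζ)
    (hcompl : CompleteFiltration μ ℱ) : ∃ w b, IsDyadicCompensator μ ℱ τ ζ w b := by
  obtain ⟨w, hw, b, h1, h2⟩ := h.exists_weights
  let N : Set Ω := {ω | (∀ t ∈ dyadics,
    Tendsto (fun n => wavg (w n) (fun j => dyComp μ ℱ τ ζ j t ω)) atTop (nhds (b t ω))) ∧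
    ∀ j i, cellExp μ ℱ τ ζ j i ω ∈ cone X}
  have hN : ∀ᵐ ω ∂μ, ω ∈ N := by
    have h1' := (ae_ball_iff (countable_range _)).2 h1
    filter_upwards [h1', h.cellExp_mem_cone] with ω ha hb
    refine ⟨fun t ht => ?_, hb⟩
    simpa only [wavg_apply] using ha t ht
  have hNm (t : ℝ≥0) : MeasurableSet[ℱ t] N :=
    ℱ.mono zero_le _ (MeasurableSet.compl_iff.1 (hcompl _ hN))
  classical
  let b' : ℝ≥0 → Ω → X × ℝ := fun t => if t ∈ dyadics then N.indicator (b t) else 0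
  have hb' {t : ℝ≥0} (ht : t ∈ dyadics) : b' t = N.indicator (b t) := if_pos ht
  have hb'N {t : ℝ≥0} (ht : t ∈ dyadics) : b' t =ᵐ[μ] b t := by
    filter_upwards [hN] with ω hω
    rw [hb' ht, indicator_of_mem hω]
  refine ⟨w, b', hw, fun t => ?_, fun ω s hs t ht hst => ?_, fun ω => ?_, ?_, fun t ht => ?_⟩
  · by_cases ht : t ∈ dyadics
    · rw [hb' ht]
      refine stronglyMeasurable_of_tendsto (u := atTop) (f := fun n => N.indicator
        (wavg (w n) fun j => dyComp μ ℱ τ ζ j t)) (fun n => StronglyMeasurable.indicator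
          (Finset.stronglyMeasurable_sum _ fun j _ =>
            (stronglyMeasurable_dyComp j t).const_smul _) (hNm t)) (tendsto_pi_nhds.2 fun ω => ?_)
      by_cases hω : ω ∈ N
      · simpa only [indicator_of_mem hω, wavg_apply] using hω.1 t ht
      · simp only [indicator_of_notMem hω]
        exact tendsto_const_nhds
    · simp only [b', if_neg ht]
      exact stronglyMeasurable_zero
  · rw [hb' ht, hb' hs]
    by_cases hω : ω ∈ N
    · rw [indicator_of_mem hω, indicator_of_mem hω]
      refine isClosed_cone.mem_of_tendsto ((hω.1 t ht).sub (hω.1 s hs)) (.of_forall fun n => ?_)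
      rw [wavg_sub]
      exact wavg_mem_cone (hw.nonneg n) fun j => dyComp_sub_mem_cone hω.2 j hst
    · rw [indicator_of_notMem hω, indicator_of_notMem hω, sub_zero]
      exact zero_mem_cone
  · rw [hb' zero_mem_dyadics]
    by_cases hω : ω ∈ N
    · rw [indicator_of_mem hω]
      refine tendsto_nhds_unique (hω.1 0 zero_mem_dyadics) ?_
      simp [dyComp, wavg]
    · rw [indicator_of_notMem hω]
  · filter_upwards [hN] with ω hω t ht
    rw [hb' ht, indicator_of_mem hω]
    exact hω.1 t ht
  · refine (h2 t ht).congr fun n => eLpNorm_congr_ae ?_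
    filter_upwards [hb'N ht] with ω hω
    simp [hω]

namespace IsDyadicCompensator

variable {w : ℕ → ℕ →₀ ℝ} {b : ℝ≥0 → Ω → X × ℝ}

lemma integrable_wavg (t : ℝ≥0) (v : ℕ →₀ ℝ) :
    Integrable (wavg v fun j => dyComp μ ℱ τ ζ j t) μ :=
  integrable_finsetSum' _ fun j _ => (integrable_dyComp j t).smul _

lemma integrable (hb : IsDyadicCompensator μ ℱ τ ζ w b) {t : ℝ≥0} (ht : t ∈ dyadics) :
    Integrable (b t) μ := by
  obtain ⟨n, hn⟩ := ((hb.tendsto_L1 t ht).eventually (gt_mem_nhds one_pos)).exists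
  have h1 : Integrable ((wavg (w n) fun j => dyComp μ ℱ τ ζ j t) - b t) μ :=
    memLp_one_iff_integrable.1 ⟨(integrable_wavg t _).1.sub
      ((hb.sm t).mono (ℱ.le t)).aestronglyMeasurable, hn.trans ENNReal.one_lt_top⟩
  simpa using (integrable_wavg (μ := μ) (ℱ := ℱ) (τ := τ) (ζ := ζ) t (w n)).sub h1

lemma tendsto_setIntegral [IsFiniteMeasure μ] (hb : IsDyadicCompensator μ ℱ τ ζ w b) {t : ℝ≥0}
    (ht : t ∈ dyadics) (G : Set Ω) :
    Tendsto (fun n => ∫ ω in G, wavg (w n) (fun j => dyComp μ ℱ τ ζ j t) ω ∂μ) atTop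
      (nhds (∫ ω in G, b t ω ∂μ)) :=
  tendsto_setIntegral_of_L1' (b t) (hb.integrable ht).1 (.of_forall fun _ => integrable_wavg t _)
    (hb.tendsto_L1 t ht) G

lemma setIntegral_sub [IsProbabilityMeasure μ] (h : IsJump μ ℱ τ ζ)
    (hb : IsDyadicCompensator μ ℱ τ ζ w b) {s t : ℝ≥0} (hs : s ∈ dyadics) (ht : t ∈ dyadics)
    (hst : s ≤ t) {G : Set Ω} (hG : MeasurableSet[ℱ s] G) :
    ∫ ω in G, (b t ω - b s ω) ∂μ = ∫ ω in G, (jump τ ζ t ω - jump τ ζ s ω) ∂μ := by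
  rw [integral_sub (hb.integrable ht).integrableOn (hb.integrable hs).integrableOn]
  refine tendsto_nhds_unique ((hb.tendsto_setIntegral ht G).sub (hb.tendsto_setIntegral hs G)) ?_
  obtain ⟨L, p', q', rfl, rfl, hpq⟩ := exists_common_dy hs ht hst
  refine tendsto_const_nhds.congr' ?_
  filter_upwards [eventually_ge_atTop L] with n hn
  have hiw (t : ℝ≥0) : IntegrableOn (wavg (w n) fun j => dyComp μ ℱ τ ζ j t) G μ :=
    (integrable_wavg t _).integrableOn
  rw [← integral_sub (hiw _) (hiw _)]
  have hi (j : ℕ) : Integrable (fun ω => dyComp μ ℱ τ ζ j (dy L q') ω -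
    dyComp μ ℱ τ ζ j (dy L p') ω) μ := (integrable_dyComp j _).sub (integrable_dyComp j _)
  simp only [wavg_apply, wavg_sub]
  simp only [wavg]
  have hi' (j : ℕ) : Integrable (fun ω => w n j • (dyComp μ ℱ τ ζ j (dy L q') ω -
    dyComp μ ℱ τ ζ j (dy L p') ω)) μ := (hi j).smul (w n j)
  rw [integral_finsetSum _ fun j _ => (hi' j).integrableOn]
  simp only [integral_smul]
  change _ = wavg (w n) _
  rw [wavg_congr_of_zero (l := L) (fun j hj => hb.weights.zero_of_lt n j (hj.trans_le hn))
    (fun j hj => h.setIntegral_dyComp_sub hj hpq hG), wavg_const (hb.weights.sum_eq_one n)]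

end IsDyadicCompensator

end Regularization

section Compensator

variable {Ω : Type*} {m : MeasurableSpace Ω} {μ : Measure Ω} {ℱ : Filtration ℝ≥0 m}
  {X : Type*} [NormedAddCommGroup X] [NormedSpace ℝ X]
  {τ : Ω → ℝ≥0∞} {ζ : Ω → X × ℝ} {w : ℕ → ℕ →₀ ℝ} {b B : ℝ≥0 → Ω → X × ℝ}

/-- The right-continuous compensator of the jump process. -/
structure IsCompensator (μ : Measure Ω) (ℱ : Filtration ℝ≥0 m) (τ : Ω → ℝ≥0∞)
    (ζ : Ω → X × ℝ) (w : ℕ → ℕ →₀ ℝ) (b B : ℝ≥0 → Ω → X × ℝ) : Prop where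
  dyadic : IsDyadicCompensator μ ℱ τ ζ w b
  tendsto : ∀ t ω, Tendsto (fun n => b (dyUp n t) ω) atTop (nhds (B t ω))

lemma IsDyadicCompensator.exists_isCompensator [CompleteSpace X]
    (hb : IsDyadicCompensator μ ℱ τ ζ w b) : ∃ B, IsCompensator μ ℱ τ ζ w b B := by
  choose B hB using fun ω t => exists_regularization (hb.sub_mem ω) (hb.zero ω) t
  exact ⟨fun t ω => B ω t, hb, fun t ω => hB ω t⟩

namespace IsCompensator

lemma sub_mem (hB : IsCompensator μ ℱ τ ζ w b B) (ω : Ω) (s t : ℝ≥0) (hst : s ≤ t) :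
    B t ω - B s ω ∈ cone X :=
  regularization_sub_mem (B := fun t => B t ω) (hB.dyadic.sub_mem ω) (hB.tendsto · ω) s t hst

lemma mem (hB : IsCompensator μ ℱ τ ζ w b B) (t : ℝ≥0) (ω : Ω) : B t ω ∈ cone X :=
  regularization_mem (B := fun t => B t ω) (hB.dyadic.sub_mem ω) (hB.tendsto · ω)
    (hB.dyadic.zero ω) t

lemma rightContinuous (hB : IsCompensator μ ℱ τ ζ w b B) (ω : Ω) (t : ℝ≥0) :
    ContinuousWithinAt (fun s => B s ω) (Ici t) t :=
  regularization_rightContinuous (hB.dyadic.sub_mem ω) (hB.tendsto · ω) t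

lemma leftLim [CompleteSpace X] (hB : IsCompensator μ ℱ τ ζ w b B) (ω : Ω) (t : ℝ≥0)
    (ht : 0 < t) : ∃ l, Tendsto (fun s => B s ω) (nhdsWithin t (Iio t)) (nhds l) :=
  exists_leftLim_of_cone (f := fun t => B t ω) (hB.sub_mem ω) t ht

lemma mono (hB : IsCompensator μ ℱ τ ζ w b B) (ω : Ω) : Monotone fun t => (B t ω).2 :=
  fun s t hst => sub_nonneg.1 (cone_snd_nonneg (hB.sub_mem ω s t hst))

lemma nonneg (hB : IsCompensator μ ℱ τ ζ w b B) (t : ℝ≥0) (ω : Ω) : 0 ≤ (B t ω).2 :=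
  cone_snd_nonneg (hB.mem t ω)

lemma sm (hright : RightContinuousFiltration ℱ) (hB : IsCompensator μ ℱ τ ζ w b B) (t : ℝ≥0) :
    StronglyMeasurable[ℱ t] (B t) :=
  stronglyMeasurable_of_tendsto_dyUp hright (fun s _ => hB.dyadic.sm s) (hB.tendsto t)

lemma dominated (hB : IsCompensator μ ℱ τ ζ w b B) (t : ℝ≥0) (n : ℕ) (ω : Ω) :
    ‖b (dyUp n t) ω‖ ≤ ‖b (dyUp 0 t) ω‖ := by
  have h0 k : b (dyUp k t) ω ∈ cone X := by
    simpa [hB.dyadic.zero] using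
      hB.dyadic.sub_mem ω 0 zero_mem_dyadics _ (dyUp_mem k t) zero_le
  rw [cone_norm_eq (h0 n), cone_norm_eq (h0 0)]
  exact sub_nonneg.1 (cone_snd_nonneg (hB.dyadic.sub_mem ω _ (dyUp_mem n t) _ (dyUp_mem 0 t)
    (dyUp_anti (Nat.zero_le n) t)))

variable [CompleteSpace X]

lemma tendsto_setIntegral (hB : IsCompensator μ ℱ τ ζ w b B) (t : ℝ≥0) (G : Set Ω) :
    Tendsto (fun n => ∫ ω in G, b (dyUp n t) ω ∂μ) atTop (nhds (∫ ω in G, B t ω ∂μ)) :=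
  tendsto_integral_of_dominated_convergence (fun ω => ‖b (dyUp 0 t) ω‖)
    (fun n => (hB.dyadic.integrable (dyUp_mem n t)).1.restrict)
    (hB.dyadic.integrable (dyUp_mem 0 t)).norm.integrableOn
    (fun n => .of_forall (hB.dominated t n)) (.of_forall (hB.tendsto t))

lemma integrable (hB : IsCompensator μ ℱ τ ζ w b B) (t : ℝ≥0) : Integrable (B t) μ := by
  refine (hB.dyadic.integrable (dyUp_mem 0 t)).norm.mono' ?_ (.of_forall fun ω => ?_)
  · exact aestronglyMeasurable_of_tendsto_ae atTop
      (fun n => (hB.dyadic.integrable (dyUp_mem n t)).1) (.of_forall (hB.tendsto t))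
  · exact le_of_tendsto (hB.tendsto t ω).norm (.of_forall fun n => hB.dominated t n ω)

omit [NormedSpace ℝ X] [CompleteSpace X] in
lemma _root_.Gundy.jump_tendsto_dyUp (t : ℝ≥0) (ω : Ω) :
    Tendsto (fun n => jump τ ζ (dyUp n t) ω) atTop (nhds (jump τ ζ t ω)) :=
  (jump_rightContinuous ζ ω t).tendsto.comp (tendsto_dyUp t)

omit [CompleteSpace X] in
lemma _root_.Gundy.IsJump.tendsto_setIntegral (h : IsJump μ ℱ τ ζ) (t : ℝ≥0) (G : Set Ω) :
    Tendsto (fun n => ∫ ω in G, jump τ ζ (dyUp n t) ω ∂μ) atTop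
      (nhds (∫ ω in G, jump τ ζ t ω ∂μ)) :=
  tendsto_integral_of_dominated_convergence (fun ω => ‖jump τ ζ (dyUp 0 t) ω‖)
    (fun _ => (h.int _).1.restrict) (h.int _).norm.integrableOn
    (fun n => .of_forall (norm_jump_le (dyUp_anti (Nat.zero_le n) t)))
    (.of_forall (jump_tendsto_dyUp t))

lemma setIntegral_sub_jump [IsProbabilityMeasure μ] (h : IsJump μ ℱ τ ζ)
    (hB : IsCompensator μ ℱ τ ζ w b B) {s t : ℝ≥0} (hst : s ≤ t) {G : Set Ω}
    (hG : MeasurableSet[ℱ s] G) :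
    ∫ ω in G, (jump τ ζ s ω - B s ω) ∂μ = ∫ ω in G, (jump τ ζ t ω - B t ω) ∂μ := by
  rw [integral_sub (h.int s).integrableOn (hB.integrable s).integrableOn,
    integral_sub (h.int t).integrableOn (hB.integrable t).integrableOn]
  have key n : ∫ ω in G, jump τ ζ (dyUp n s) ω ∂μ - ∫ ω in G, b (dyUp n s) ω ∂μ =
      ∫ ω in G, jump τ ζ (dyUp n t) ω ∂μ - ∫ ω in G, b (dyUp n t) ω ∂μ := by
    have := hB.dyadic.setIntegral_sub h (dyUp_mem n s) (dyUp_mem n t) (dyUp_mono n hst)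
      (ℱ.mono (lt_dyUp n s).le _ hG)
    rw [integral_sub (hB.dyadic.integrable (dyUp_mem n t)).integrableOn
      (hB.dyadic.integrable (dyUp_mem n s)).integrableOn,
      integral_sub (h.int _).integrableOn (h.int _).integrableOn] at this
    rw [sub_eq_sub_iff_sub_eq_sub, ← neg_inj, neg_sub, ← this, neg_sub]
  refine tendsto_nhds_unique ((h.tendsto_setIntegral s G).sub (hB.tendsto_setIntegral s G)) ?_
  simp_rw [key]
  exact (h.tendsto_setIntegral t G).sub (hB.tendsto_setIntegral t G)

lemma martingale [IsProbabilityMeasure μ] (hright : RightContinuousFiltration ℱ)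
    (h : IsJump μ ℱ τ ζ) (hB : IsCompensator μ ℱ τ ζ w b B) :
    Martingale (fun t ω => jump τ ζ t ω - B t ω) ℱ μ :=
  martingale_of_setIntegral (fun t => (h.sm t).sub (hB.sm hright t))
    (fun t => (h.int t).sub (hB.integrable t))
    fun _ _ hst _ hG => hB.setIntegral_sub_jump h hst hG

lemma integral_zero [IsProbabilityMeasure μ] (h : IsJump μ ℱ τ ζ)
    (hB : IsCompensator μ ℱ τ ζ w b B) : ∫ ω, B 0 ω ∂μ = 0 := by
  have h1 := hB.tendsto_setIntegral 0 univ
  have h2 := (h.tendsto_setIntegral 0 univ).sub_const (∫ ω in univ, jump τ ζ 0 ω ∂μ)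
  rw [sub_self] at h2
  simp only [Measure.restrict_univ] at h1 h2
  refine tendsto_nhds_unique h1 (h2.congr fun n => ?_)
  have := hB.dyadic.setIntegral_sub h zero_mem_dyadics (dyUp_mem n 0) zero_le
    (G := univ) MeasurableSet.univ
  simp only [hB.dyadic.zero, Measure.restrict_univ, sub_zero] at this
  rw [this, integral_sub (h.int _) (h.int _)]

end IsCompensator

end Compensator

section StoppedCompensator

variable {Ω : Type*} {m : MeasurableSpace Ω} {μ : Measure Ω} {ℱ : Filtration ℝ≥0 m}
  {X : Type*} [NormedAddCommGroup X] [NormedSpace ℝ X]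
  {τ : Ω → ℝ≥0∞} {ζ : Ω → X × ℝ} {w : ℕ → ℕ →₀ ℝ} {b B : ℝ≥0 → Ω → X × ℝ}
  {ρ : Ω → ℝ≥0} {T : ℝ≥0}

lemma sum_range_ceil_stopped {F : Type*} [AddCommMonoid F] (hT : ∀ ω, ρ ω ≤ T) (j : ℕ)
    (f : ℕ → Ω → F) (ω : Ω) : ∑ i ∈ Finset.range ⌈ρ ω * 2 ^ j⌉₊, f i ω =
      ∑ i ∈ Finset.range ⌈T * 2 ^ j⌉₊, {ω | dy j i < ρ ω}.indicator (f i) ω := by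
  simp only [indicator_apply, mem_ofPred_eq, ← lt_ceil_iff_dy_lt]
  rw [← Finset.sum_filter]
  congr 1
  ext i
  simp only [Finset.mem_range, Finset.mem_filter]
  have h1 : ⌈ρ ω * 2 ^ j⌉₊ ≤ ⌈T * 2 ^ j⌉₊ := by gcongr; exact hT ω
  exact ⟨fun h => ⟨h.trans_le h1, h⟩, fun h => h.2⟩

lemma le_dy_ceil (j : ℕ) (t : ℝ≥0) : t ≤ dy j ⌈t * 2 ^ j⌉₊ := by
  unfold dy
  rw [le_div_iff₀ (by positivity)]
  exact Nat.le_ceil _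

omit [NormedSpace ℝ X] in
lemma sum_cell_indicator (τ : Ω → ℝ≥0∞) (ζ : Ω → X × ℝ) (j k : ℕ) (ω : Ω) :
    ∑ i ∈ Finset.range k, (cell τ j i).indicator ζ ω = jump τ ζ (dy j k) ω - jump τ ζ 0 ω := by
  simp_rw [cell_indicator_eq, Pi.sub_apply]
  rw [Finset.sum_range_sub (fun i => jump τ ζ (dy j i) ω)]
  simp [dy]

lemma IsStop'.measurableSet_lt (hρ : IsStop' ℱ ρ) (t : ℝ≥0) : MeasurableSet[ℱ t] {ω | t < ρ ω} := by
  convert (hρ t).compl using 1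
  ext ω
  simp

variable [CompleteSpace X]

lemma integrable_dyComp_stopped (hρ : IsStop' ℱ ρ) (hT : ∀ ω, ρ ω ≤ T) (j : ℕ) :
    Integrable (fun ω => dyComp μ ℱ τ ζ j (ρ ω) ω) μ := by
  simp_rw [dyComp_apply, sum_range_ceil_stopped hT]
  exact integrable_finsetSum _ fun i _ =>
    integrable_condExp.indicator (ℱ.le _ _ (hρ.measurableSet_lt _))

lemma IsJump.integral_dyComp_stopped [IsProbabilityMeasure μ] (h : IsJump μ ℱ τ ζ)
    (hρ : IsStop' ℱ ρ) (hT : ∀ ω, ρ ω ≤ T) (j : ℕ) :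
    Integrable (fun ω => jump τ ζ (dy j ⌈ρ ω * 2 ^ j⌉₊) ω - jump τ ζ 0 ω) μ ∧
    ∫ ω, dyComp μ ℱ τ ζ j (ρ ω) ω ∂μ =
      ∫ ω, (jump τ ζ (dy j ⌈ρ ω * 2 ^ j⌉₊) ω - jump τ ζ 0 ω) ∂μ := by
  have hm i := hρ.measurableSet_lt (dy j i)
  have hm' i := ℱ.le _ _ (hm i)
  simp_rw [← sum_cell_indicator, dyComp_apply, sum_range_ceil_stopped hT]
  refine ⟨integrable_finsetSum _ fun i _ => (h.integrable_cell j i).indicator (hm' i), ?_⟩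
  rw [integral_finsetSum (f := fun i => {ω | dy j i < ρ ω}.indicator (cellExp μ ℱ τ ζ j i)) _
      fun i _ => integrable_condExp.indicator (hm' i),
    integral_finsetSum _ fun i _ => (h.integrable_cell j i).indicator (hm' i)]
  refine Finset.sum_congr rfl fun i _ => ?_
  rw [integral_indicator (hm' i), integral_indicator (hm' i)]
  exact setIntegral_condExp (ℱ.le _) (h.integrable_cell j i) (hm i)

namespace IsCompensator

lemma integrable_stopped [IsProbabilityMeasure μ] (hright : RightContinuousFiltration ℱ)
    (hB : IsCompensator μ ℱ τ ζ w b B) (hρ : IsStop' ℱ ρ) (hT : ∀ ω, ρ ω ≤ T) :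
    Integrable (fun ω => B (ρ ω) ω) μ := by
  refine (hB.integrable T).norm.mono' ?_ (.of_forall fun ω => ?_)
  · exact ((stronglyMeasurable_eval (hB.sm hright) hB.rightContinuous hρ hT).mono
      (ℱ.le T)).aestronglyMeasurable
  · rw [cone_norm_eq (hB.mem _ _), cone_norm_eq (hB.mem _ _)]
    exact hB.mono ω (hT ω)

lemma integral_stopped_le [IsProbabilityMeasure μ] (hright : RightContinuousFiltration ℱ)
    (h : IsJump μ ℱ τ ζ) (hB : IsCompensator μ ℱ τ ζ w b B)
    (hρ : IsStop' ℱ ρ) (hT : ∀ ω, ρ ω ≤ T) (j : ℕ) :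
    ∫ ω, (B (ρ ω) ω).2 ∂μ ≤ ∫ ω, (dyComp μ ℱ τ ζ j (ρ ω) ω).2 ∂μ := by
  have hBi := hB.integrable_stopped hright hρ hT
  have hM := hB.martingale hright h
  have hrc : ∀ ω t, ContinuousWithinAt (fun s => jump τ ζ s ω - B s ω) (Ici t) t := fun ω t =>
    (jump_rightContinuous ζ ω t).sub (hB.rightContinuous ω t)
  have hZi := integrable_eval hM hrc hρ hT
  have hJi : Integrable (fun ω => jump τ ζ (ρ ω) ω) μ :=
    (hZi.add hBi).congr (.of_forall fun ω => by simp)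
  have hJ0 : Integrable (fun ω => jump τ ζ (ρ ω) ω - jump τ ζ 0 ω) μ := hJi.sub (h.int 0)
  have h1 : ∫ ω, B (ρ ω) ω ∂μ = ∫ ω, (jump τ ζ (ρ ω) ω - jump τ ζ 0 ω) ∂μ := by
    have h2 := integral_eval hM hrc hρ hT
    have h3 := hB.setIntegral_sub_jump h (zero_le (a := T)) (G := univ) MeasurableSet.univ
    simp only [Measure.restrict_univ] at h3
    rw [← h3, integral_sub hJi hBi, integral_sub (h.int 0) (hB.integrable 0),
      hB.integral_zero h, sub_zero] at h2
    rw [integral_sub hJi (h.int 0), ← h2, sub_sub_cancel]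
  obtain ⟨hi, he⟩ := h.integral_dyComp_stopped hρ hT j
  rw [← snd_integral hBi, ← snd_integral (integrable_dyComp_stopped hρ hT j), h1, he,
    snd_integral hJ0, snd_integral hi]
  refine integral_mono hJ0.snd hi.snd fun ω => ?_
  have := cone_snd_nonneg (h.sub_mem_cone (le_dy_ceil j (ρ ω)) ω)
  simp only [Prod.snd_sub] at this ⊢
  linarith

end IsCompensator

end StoppedCompensator

section LevelTime

variable {Ω : Type*} {m : MeasurableSpace Ω} {ℱ : Filtration ℝ≥0 m}

lemma isStop_of_lt (hright : RightContinuousFiltration ℱ) {τ : Ω → ℝ≥0∞}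
    (h : ∀ t : ℝ≥0, MeasurableSet[ℱ t] {ω | τ ω < t}) : IsStop ℱ τ := by
  refine fun t => measurableSet_of_forall_gt hright fun s hs => ?_
  have e : {ω | τ ω ≤ t} = ⋂ n : ℕ, {ω | τ ω < (min s (dyUp n t) : ℝ≥0)} := by
    ext ω
    simp only [mem_ofPred_eq, mem_iInter]
    refine ⟨fun h n => h.trans_lt (ENNReal.coe_lt_coe.2 (lt_min hs (lt_dyUp n t))), fun h => ?_⟩
    refine ENNReal.le_of_forall_pos_le_add fun ε hε _ => ?_
    obtain ⟨n, hn⟩ := exists_dyUp_lt (show t < t + ε by simpa using hε)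
    exact (h n).le.trans (by exact_mod_cast (min_le_right _ _).trans hn.le)
  rw [e]
  exact MeasurableSet.iInter fun n => ℱ.mono (min_le_left _ _) _ (h _)

/-- The first time at which the process `a` reaches the level `c`. -/
noncomputable def levelTime {Ω : Type*} (a : ℝ≥0 → Ω → ℝ) (c : ℝ) (ω : Ω) : ℝ≥0∞ :=
  ⨅ (t : ℝ≥0) (_ : c ≤ a t ω), (t : ℝ≥0∞)

lemma levelTime_le_iff {a : ℝ≥0 → Ω → ℝ} {c : ℝ} {ω : Ω} (hmono : Monotone fun t => a t ω)
    (hrc : ∀ t, ContinuousWithinAt (fun s => a s ω) (Ici t) t) {t : ℝ≥0} :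
    levelTime a c ω ≤ t ↔ c ≤ a t ω := by
  refine ⟨fun h => ?_, fun h => iInf₂_le t h⟩
  by_contra! hlt
  have h1 : ∀ᶠ n in atTop, a (dyUp n t) ω < c :=
    ((hrc t).tendsto.comp (tendsto_dyUp t)).eventually (gt_mem_nhds hlt)
  obtain ⟨n, hn⟩ := h1.exists
  have h2 : (dyUp n t : ℝ≥0∞) ≤ levelTime a c ω := le_iInf₂ fun s hs => by
    by_contra! hs'
    exact (hs.trans (hmono (ENNReal.coe_lt_coe.1 hs').le)).not_gt hn
  exact (lt_dyUp n t).not_ge (by exact_mod_cast h2.trans h)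

lemma isStop_levelTime {a : ℝ≥0 → Ω → ℝ} {c : ℝ} (hmono : ∀ ω, Monotone fun t => a t ω)
    (hrc : ∀ ω t, ContinuousWithinAt (fun s => a s ω) (Ici t) t)
    (hm : ∀ t, StronglyMeasurable[ℱ t] (a t)) : IsStop ℱ (levelTime a c) := fun t => by
  simp only [levelTime_le_iff (hmono _) (hrc _)]
  exact measurableSet_le measurable_const (hm t).measurable

end LevelTime

section Approximation

variable {Ω : Type*} {m : MeasurableSpace Ω} {μ : Measure Ω} {ℱ : Filtration ℝ≥0 m}
  {X : Type*} [NormedAddCommGroup X] [NormedSpace ℝ X]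
  {τ : Ω → ℝ≥0∞} {ζ : Ω → X × ℝ} {w : ℕ → ℕ →₀ ℝ} {b B : ℝ≥0 → Ω → X × ℝ}
  {ρ : Ω → ℝ≥0} {T : ℝ≥0}

lemma wavg_snd_le {v : ℕ →₀ ℝ} (hv : ∀ j, 0 ≤ v j) {f g : ℕ → X × ℝ}
    (h : ∀ j ∈ v.support, (f j).2 ≤ (g j).2) : (wavg v f).2 ≤ (wavg v g).2 := by
  simp only [wavg, Prod.snd_sum, Prod.smul_snd, smul_eq_mul]
  exact Finset.sum_le_sum fun j hj => mul_le_mul_of_nonneg_left (h j hj) (hv j)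

/-- The discrete approximation of the compensator of the size of the jump. -/
noncomputable def approx (μ : Measure Ω) (ℱ : Filtration ℝ≥0 m) (τ : Ω → ℝ≥0∞) (ζ : Ω → X × ℝ)
    (v : ℕ →₀ ℝ) (t : ℝ≥0) (ω : Ω) : ℝ :=
  (wavg v fun j => dyComp μ ℱ τ ζ j t ω).2

lemma approx_mono {v : ℕ →₀ ℝ} (hv : ∀ j, 0 ≤ v j) {ω : Ω}
    (hω : ∀ j i, cellExp μ ℱ τ ζ j i ω ∈ cone X) :
    Monotone fun t => approx μ ℱ τ ζ v t ω := fun _ _ hst =>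
  wavg_snd_le hv fun j _ => sub_nonneg.1 (cone_snd_nonneg (dyComp_sub_mem_cone hω j hst))

variable [CompleteSpace X]

lemma integrable_approx_stopped (hρ : IsStop' ℱ ρ) (hT : ∀ ω, ρ ω ≤ T) (v : ℕ →₀ ℝ) :
    Integrable (fun ω => approx μ ℱ τ ζ v (ρ ω) ω) μ := by
  refine Integrable.snd (f := fun ω => wavg v fun j => dyComp μ ℱ τ ζ j (ρ ω) ω) ?_
  exact integrable_finsetSum _ fun j _ => (integrable_dyComp_stopped hρ hT j).smul (v j)

lemma integrable_approx (t : ℝ≥0) (v : ℕ →₀ ℝ) : Integrable (approx μ ℱ τ ζ v t) μ := by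
  refine Integrable.snd (f := fun ω => wavg v fun j => dyComp μ ℱ τ ζ j t ω) ?_
  exact integrable_finsetSum _ fun j _ => (integrable_dyComp j t).smul (v j)

namespace IsCompensator

lemma integral_stopped_le_approx [IsProbabilityMeasure μ] (hright : RightContinuousFiltration ℱ)
    (h : IsJump μ ℱ τ ζ) (hB : IsCompensator μ ℱ τ ζ w b B)
    (hρ : IsStop' ℱ ρ) (hT : ∀ ω, ρ ω ≤ T) (n : ℕ) :
    ∫ ω, (B (ρ ω) ω).2 ∂μ ≤ ∫ ω, approx μ ℱ τ ζ (w n) (ρ ω) ω ∂μ := by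
  simp only [approx, wavg, Prod.snd_sum, Prod.smul_snd, smul_eq_mul]
  rw [integral_finsetSum _ fun j _ => (integrable_dyComp_stopped hρ hT j).snd.const_mul _]
  simp only [integral_const_mul]
  calc ∫ ω, (B (ρ ω) ω).2 ∂μ = ∑ j ∈ (w n).support, w n j * ∫ ω, (B (ρ ω) ω).2 ∂μ := by
        rw [← Finset.sum_mul, hB.dyadic.weights.sum_eq_one n, one_mul]
    _ ≤ _ := Finset.sum_le_sum fun j _ => mul_le_mul_of_nonneg_left
        (hB.integral_stopped_le hright h hρ hT j) (hB.dyadic.weights.nonneg n j)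

omit [CompleteSpace X] in
lemma ae_tendsto_approx (hB : IsCompensator μ ℱ τ ζ w b B) : ∀ᵐ ω ∂μ, ∀ t ∈ dyadics,
    Tendsto (fun n => approx μ ℱ τ ζ (w n) t ω) atTop (nhds (b t ω).2) := by
  filter_upwards [hB.dyadic.ae_tendsto] with ω hω t ht
  exact (continuous_snd.tendsto _).comp (hω t ht)

lemma tendsto_integral_abs_approx_sub (hB : IsCompensator μ ℱ τ ζ w b B) {t : ℝ≥0}
    (ht : t ∈ dyadics) :
    Tendsto (fun n => ∫ ω, |approx μ ℱ τ ζ (w n) t ω - (b t ω).2| ∂μ) atTop (nhds 0) := by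
  have hi n : Integrable ((wavg (w n) fun j => dyComp μ ℱ τ ζ j t) - b t) μ :=
    (IsDyadicCompensator.integrable_wavg t _).sub (hB.dyadic.integrable ht)
  have h1 := (ENNReal.tendsto_toReal ENNReal.zero_ne_top).comp (hB.dyadic.tendsto_L1 t ht)
  refine squeeze_zero (fun n => integral_nonneg fun ω => abs_nonneg _) (fun n => ?_) h1
  simp only [Function.comp_apply]
  rw [eLpNorm_one_eq_lintegral_enorm, ← ofReal_integral_norm_eq_lintegral_enorm (hi n),
    ENNReal.toReal_ofReal (integral_nonneg fun ω => norm_nonneg _)]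
  refine integral_mono ((integrable_approx t _).sub (hB.dyadic.integrable ht).snd).abs
    (hi n).norm fun ω => ?_
  rw [Pi.sub_apply, wavg_apply]
  exact norm_snd_le (wavg (w n) (fun j => dyComp μ ℱ τ ζ j t ω) - b t ω)

lemma ae_tendsto_posPart (hB : IsCompensator μ ℱ τ ζ w b B) (h : IsJump μ ℱ τ ζ)
    [IsProbabilityMeasure μ] : ∀ᵐ ω ∂μ, ∀ t,
    Tendsto (fun n => max (approx μ ℱ τ ζ (w n) t ω - (B t ω).2) 0) atTop (nhds 0) := by
  filter_upwards [hB.ae_tendsto_approx, h.cellExp_mem_cone] with ω h1 h2 t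
  refine tendsto_order.2 ⟨fun r hr => .of_forall fun n => hr.trans_le (le_max_right _ _),
    fun r hr => ?_⟩
  have h3 : Tendsto (fun n => (b (dyUp n t) ω).2) atTop (nhds (B t ω).2) :=
    (continuous_snd.tendsto _).comp (hB.tendsto t ω)
  obtain ⟨k, hk⟩ := (h3.eventually (gt_mem_nhds (lt_add_of_pos_right _ hr))).exists
  filter_upwards [(h1 _ (dyUp_mem k t)).eventually (gt_mem_nhds hk)] with n hn
  have := approx_mono (hB.dyadic.weights.nonneg n) h2 (lt_dyUp k t).le
  simp only at this
  exact max_lt (by linarith) hr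

lemma tendsto_integral_posPart [IsProbabilityMeasure μ] (hright : RightContinuousFiltration ℱ)
    (h : IsJump μ ℱ τ ζ) (hB : IsCompensator μ ℱ τ ζ w b B)
    (hρ : IsStop' ℱ ρ) (hT : ∀ ω, ρ ω ≤ T) (hTd : T ∈ dyadics) :
    Tendsto (fun n => ∫ ω, max (approx μ ℱ τ ζ (w n) (ρ ω) ω - (B (ρ ω) ω).2) 0 ∂μ)
      atTop (nhds 0) := by
  set f : ℕ → Ω → ℝ := fun n ω => max (approx μ ℱ τ ζ (w n) (ρ ω) ω - (B (ρ ω) ω).2) 0 with hf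
  set g : Ω → ℝ := fun ω => (b T ω).2
  have hg : Integrable g μ := (hB.dyadic.integrable hTd).snd
  have hfi n : Integrable (f n) μ := ((integrable_approx_stopped hρ hT (w n)).sub
    (hB.integrable_stopped hright hρ hT).snd).pos_part
  have hg0 ω : 0 ≤ g ω := by
    have := cone_snd_nonneg (hB.dyadic.sub_mem ω 0 zero_mem_dyadics T hTd zero_le)
    simpa [hB.dyadic.zero] using this
  have h1 : Tendsto (fun n => ∫ ω, min (f n ω) (g ω) ∂μ) atTop (nhds (∫ _, (0 : ℝ) ∂μ)) := by
    refine tendsto_integral_of_dominated_convergence g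
      (fun n => ((hfi n).inf hg).1) hg (fun n => .of_forall fun ω => ?_) ?_
    · rw [Real.norm_of_nonneg (le_min (le_max_right _ _) (hg0 ω))]
      exact min_le_right _ _
    · filter_upwards [hB.ae_tendsto_posPart h] with ω hω
      simpa [hg0 ω] using (hω (ρ ω)).min (tendsto_const_nhds (x := g ω))
  have h2 := h1.add (hB.tendsto_integral_abs_approx_sub hTd)
  rw [MeasureTheory.integral_zero, add_zero] at h2
  refine squeeze_zero (fun n => integral_nonneg fun ω => le_max_right _ _) (fun n => ?_) h2
  have hi : Integrable (fun ω => |approx μ ℱ τ ζ (w n) T ω - g ω|) μ :=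
    ((integrable_approx T _).sub hg).abs
  have hi' : Integrable (fun ω => min (f n ω) (g ω)) μ := (hfi n).inf hg
  rw [← integral_add hi' hi]
  refine integral_mono_ae (hfi n) (hi'.add hi) ?_
  filter_upwards [h.cellExp_mem_cone] with ω hω
  have h3 := approx_mono (hB.dyadic.weights.nonneg n) hω (hT ω)
  have h4 := approx_mono (hB.dyadic.weights.nonneg n) hω (zero_le (a := T))
  have h5 : approx μ ℱ τ ζ (w n) 0 ω = 0 := by simp [approx, wavg, dyComp]
  have h6 := hB.nonneg (ρ ω) ω
  simp only at h3 h4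
  have h7 : f n ω ≤ approx μ ℱ τ ζ (w n) T ω := max_le (by linarith) (by linarith)
  have h8 := le_abs_self (approx μ ℱ τ ζ (w n) T ω - g ω)
  rcases le_total (f n ω) (g ω) with h9 | h9
  · rw [min_eq_left h9]
    linarith [abs_nonneg (approx μ ℱ τ ζ (w n) T ω - g ω)]
  · rw [min_eq_right h9]
    linarith

lemma tendsto_integral_abs_stopped [IsProbabilityMeasure μ] (hright : RightContinuousFiltration ℱ)
    (h : IsJump μ ℱ τ ζ) (hB : IsCompensator μ ℱ τ ζ w b B)
    (hρ : IsStop' ℱ ρ) (hT : ∀ ω, ρ ω ≤ T) (hTd : T ∈ dyadics) :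
    Tendsto (fun n => ∫ ω, |approx μ ℱ τ ζ (w n) (ρ ω) ω - (B (ρ ω) ω).2| ∂μ)
      atTop (nhds 0) := by
  have h1 := (hB.tendsto_integral_posPart hright h hρ hT hTd).const_mul 2
  rw [mul_zero] at h1
  refine squeeze_zero (fun n => integral_nonneg fun ω => abs_nonneg _) (fun n => ?_) h1
  have hBi := (hB.integrable_stopped hright hρ hT).snd
  have hai := integrable_approx_stopped (μ := μ) (τ := τ) (ζ := ζ) hρ hT (w n)
  have hdi : Integrable (fun ω => approx μ ℱ τ ζ (w n) (ρ ω) ω - (B (ρ ω) ω).2) μ := hai.sub hBi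
  have h2 := hB.integral_stopped_le_approx hright h hρ hT n
  have h3 := integral_sub hai hBi
  calc ∫ ω, |approx μ ℱ τ ζ (w n) (ρ ω) ω - (B (ρ ω) ω).2| ∂μ
      = ∫ ω, (2 * max (approx μ ℱ τ ζ (w n) (ρ ω) ω - (B (ρ ω) ω).2) 0 -
          (approx μ ℱ τ ζ (w n) (ρ ω) ω - (B (ρ ω) ω).2)) ∂μ := by
        refine integral_congr_ae (.of_forall fun ω => ?_)
        simp only
        rcases le_total (approx μ ℱ τ ζ (w n) (ρ ω) ω - (B (ρ ω) ω).2) 0 with h9 | h9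
        · rw [max_eq_right h9, abs_of_nonpos h9]; ring
        · rw [max_eq_left h9, abs_of_nonneg h9]; ring
    _ = 2 * ∫ ω, max (approx μ ℱ τ ζ (w n) (ρ ω) ω - (B (ρ ω) ω).2) 0 ∂μ -
          ∫ ω, (approx μ ℱ τ ζ (w n) (ρ ω) ω - (B (ρ ω) ω).2) ∂μ := by
        rw [integral_sub (hdi.pos_part.const_mul 2) hdi, integral_const_mul]
    _ ≤ _ := by rw [h3]; linarith

end IsCompensator

end Approximation

section Announce

variable {Ω : Type*} {m : MeasurableSpace Ω} {μ : Measure Ω} {ℱ : Filtration ℝ≥0 m}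

lemma exists_subseq_ae_lt [IsFiniteMeasure μ] {y : ℕ → ℕ → Ω → ℝ}
    (hi : ∀ T n, Integrable (y T n) μ)
    (h0 : ∀ T n ω, 0 ≤ y T n ω) (h : ∀ T, Tendsto (fun n => ∫ ω, y T n ω ∂μ) atTop (nhds 0)) :
    ∃ φ : ℕ → ℕ, (∀ k, k ≤ φ k) ∧ ∀ᵐ ω ∂μ, ∀ T, ∀ᶠ k in atTop, y T (φ k) ω < (1 / 2) ^ k := by
  have h1 (k : ℕ) : ∃ n, k ≤ n ∧ ∀ T ∈ Finset.range (k + 1),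
      ∫ ω, y T n ω ∂μ < (1 / 2) ^ k * (1 / 2) ^ k :=
    ((eventually_ge_atTop k).and ((eventually_all_finset _).2 fun T _ =>
      (h T).eventually (gt_mem_nhds (by positivity)))).exists
  choose φ hφ hφ' using h1
  refine ⟨φ, hφ, ae_all_iff.2 fun T => ?_⟩
  let s : ℕ → Set Ω := fun k => {ω | T ≤ k ∧ (1 / 2 : ℝ) ^ k ≤ y T (φ k) ω}
  have hs (k : ℕ) : μ (s k) ≤ ENNReal.ofReal ((1 / 2) ^ k) := by
    by_cases hk : T ≤ k
    · have h2 := mul_meas_ge_le_integral_of_nonneg (.of_forall (h0 T (φ k))) (hi T (φ k))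
        ((1 / 2 : ℝ) ^ k)
      have h3 := h2.trans (hφ' k T (Finset.mem_range.2 (by omega))).le
      have h4 : μ.real {ω | (1 / 2 : ℝ) ^ k ≤ y T (φ k) ω} ≤ (1 / 2) ^ k :=
        le_of_mul_le_mul_left h3 (by positivity)
      have e : s k = {ω | (1 / 2 : ℝ) ^ k ≤ y T (φ k) ω} := by simp [s, hk]
      rw [e, ← ofReal_measureReal]
      exact ENNReal.ofReal_le_ofReal h4
    · simp [s, hk]
  have hsum : ∑' k, μ (s k) ≠ ∞ := by
    refine ne_top_of_le_ne_top ?_ (ENNReal.tsum_le_tsum hs)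
    rw [← ENNReal.ofReal_tsum_of_nonneg (fun k => by positivity) summable_geometric_two]
    exact ENNReal.ofReal_ne_top
  filter_upwards [ae_eventually_notMem hsum] with ω hω
  filter_upwards [hω, eventually_ge_atTop T] with k hk hk'
  by_contra! hlt
  exact hk ⟨hk', hlt⟩

variable {X : Type*} [NormedAddCommGroup X] [NormedSpace ℝ X]
  {τ : Ω → ℝ≥0∞} {ζ : Ω → X × ℝ} {w : ℕ → ℕ →₀ ℝ} {b B : ℝ≥0 → Ω → X × ℝ}

/-- The discrete approximation of the compensator, including the cell that starts at the current
time. -/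
noncomputable def foresight (μ : Measure Ω) (ℱ : Filtration ℝ≥0 m) (τ : Ω → ℝ≥0∞) (ζ : Ω → X × ℝ)
    (v : ℕ →₀ ℝ) (t : ℝ≥0) (ω : Ω) : ℝ :=
  (wavg v fun j => ∑ i ∈ Finset.range (⌊t * 2 ^ j⌋₊ + 1), cellExp μ ℱ τ ζ j i ω).2

lemma measurable_foresight (v : ℕ →₀ ℝ) (t : ℝ≥0) :
    Measurable[ℱ t] (foresight μ ℱ τ ζ v t) := by
  have : StronglyMeasurable[ℱ t] fun ω =>
      wavg v fun j => ∑ i ∈ Finset.range (⌊t * 2 ^ j⌋₊ + 1), cellExp μ ℱ τ ζ j i ω := by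
    refine Finset.stronglyMeasurable_fun_sum _ fun j _ => StronglyMeasurable.fun_const_smul
      (Finset.stronglyMeasurable_fun_sum _ fun i hi => ?_) _
    refine stronglyMeasurable_condExp.mono (ℱ.mono (dy_le_iff.2 ?_))
    have := Finset.mem_range.1 hi
    omega
  exact (continuous_snd.comp_stronglyMeasurable this).measurable

lemma foresight_le_approx {v : ℕ →₀ ℝ} (hv : ∀ j, 0 ≤ v j) {ω : Ω}
    (hω : ∀ j i, cellExp μ ℱ τ ζ j i ω ∈ cone X) {s t : ℝ≥0} (hst : s < t) :
    foresight μ ℱ τ ζ v s ω ≤ approx μ ℱ τ ζ v t ω := by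
  refine wavg_snd_le hv fun j _ => ?_
  rw [dyComp_apply, Prod.snd_sum, Prod.snd_sum]
  refine Finset.sum_le_sum_of_subset_of_nonneg (Finset.range_subset_range.2 ?_)
    fun i _ _ => cone_snd_nonneg (hω j i)
  exact lt_ceil_iff_dy_lt.2 ((dy_le_iff.2 le_rfl).trans_lt hst)

lemma approx_le_foresight {v : ℕ →₀ ℝ} (hv : ∀ j, 0 ≤ v j) {ω : Ω}
    (hω : ∀ j i, cellExp μ ℱ τ ζ j i ω ∈ cone X) {N : ℕ} (hN : ∀ j ∈ v.support, j ≤ N)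
    (t : ℝ≥0) : approx μ ℱ τ ζ v t ω ≤ foresight μ ℱ τ ζ v (dy N (⌈t * 2 ^ N⌉₊ - 1)) ω := by
  refine wavg_snd_le hv fun j hj => ?_
  rw [dyComp_apply, Prod.snd_sum, Prod.snd_sum]
  refine Finset.sum_le_sum_of_subset_of_nonneg (fun i hi => ?_)
    fun i _ _ => cone_snd_nonneg (hω j i)
  rw [Finset.mem_range, lt_ceil_iff_dy_lt, dy_refine (hN j hj), ← lt_ceil_iff_dy_lt] at hi
  rw [Finset.mem_range, Nat.lt_succ_iff, ← dy_le_iff, dy_refine (hN j hj)]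
  exact dy_mono N (by omega)

/-- The first time of the dyadic grid of level `N` at which `foresight` reaches the level `c`. -/
noncomputable def foresightTime (μ : Measure Ω) (ℱ : Filtration ℝ≥0 m) (τ : Ω → ℝ≥0∞)
    (ζ : Ω → X × ℝ) (v : ℕ →₀ ℝ) (N : ℕ) (c : ℝ) (ω : Ω) : ℝ≥0∞ :=
  ⨅ (q : ℕ) (_ : c ≤ foresight μ ℱ τ ζ v (dy N q) ω), (dy N q : ℝ≥0∞)

lemma isStop_foresightTime (hright : RightContinuousFiltration ℱ) (v : ℕ →₀ ℝ) (N : ℕ) (c : ℝ) :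
    IsStop ℱ (foresightTime μ ℱ τ ζ v N c) := by
  refine isStop_of_lt hright fun t => ?_
  have e : {ω | foresightTime μ ℱ τ ζ v N c ω < t} =
      ⋃ q : ℕ, {ω | dy N q < t ∧ c ≤ foresight μ ℱ τ ζ v (dy N q) ω} := by
    ext ω
    simp only [foresightTime, mem_ofPred_eq, iInf_lt_iff, mem_iUnion, ENNReal.coe_lt_coe,
      exists_prop, and_comm]
  rw [e]
  refine MeasurableSet.iUnion fun q => ?_
  by_cases hq : dy N q < t
  · simp only [hq, true_and]
    exact ℱ.mono hq.le _ (measurableSet_le measurable_const (measurable_foresight v _))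
  · simp [hq]

lemma levelTime_snd_le_iff (hB : IsCompensator μ ℱ τ ζ w b B) {c : ℝ} {ω : Ω} {t : ℝ≥0} :
    levelTime (fun t ω => (B t ω).2) c ω ≤ t ↔ c ≤ (B t ω).2 :=
  levelTime_le_iff (hB.mono ω) fun t => (hB.rightContinuous ω t).snd

variable [CompleteSpace X]

lemma IsCompensator.ae_zero [IsProbabilityMeasure μ] (h : IsJump μ ℱ τ ζ)
    (hB : IsCompensator μ ℱ τ ζ w b B) : ∀ᵐ ω ∂μ, (B 0 ω).2 = 0 := by
  have h1 : ∫ ω, (B 0 ω).2 ∂μ = 0 := by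
    rw [← snd_integral (hB.integrable 0), hB.integral_zero h]; rfl
  exact (integral_eq_zero_iff_of_nonneg (fun ω => hB.nonneg 0 ω) (hB.integrable 0).snd).1 h1

/-- The time at which the compensator of the size of the jump reaches the level `c` can be
announced by stopping times. -/
lemma IsCompensator.exists_announcing [IsProbabilityMeasure μ]
    (hright : RightContinuousFiltration ℱ) (h : IsJump μ ℱ τ ζ)
    (hB : IsCompensator μ ℱ τ ζ w b B) {c : ℝ} (hc : 0 < c) :
    ∃ U : ℕ → Ω → ℝ≥0∞, (∀ n, IsStop ℱ (U n)) ∧ ∀ᵐ ω ∂μ,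
      (∀ t : ℝ≥0, (B t ω).2 < c → ∀ᶠ n in atTop, (t : ℝ≥0∞) < U n ω) ∧
      ∀ T, c ≤ (B T ω).2 → ∀ᶠ n in atTop, ∃ s : ℝ≥0, U n ω ≤ s ∧ (B s ω).2 < c := by
  let σ : Ω → ℝ≥0∞ := levelTime (fun t ω => (B t ω).2) c
  have hσ : IsStop ℱ σ := isStop_levelTime hB.mono (fun ω t => (hB.rightContinuous ω t).snd)
    fun t => continuous_snd.comp_stronglyMeasurable (hB.sm hright t)
  have hρ (T : ℕ) := hσ.isStop_capAt (dy 0 T)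
  obtain ⟨φ, hφ, hφ'⟩ := exists_subseq_ae_lt (μ := μ)
    (y := fun T n ω => |approx μ ℱ τ ζ (w n) (capAt σ (dy 0 T) ω) ω - (B (capAt σ (dy 0 T) ω) ω).2|)
    (fun T n => ((integrable_approx_stopped (hρ T) (capAt_le _ _) _).sub
      (hB.integrable_stopped hright (hρ T) (capAt_le _ _)).snd).abs)
    (fun T n ω => abs_nonneg _)
    (fun T => hB.tendsto_integral_abs_stopped hright h (hρ T) (capAt_le _ _) (dy_mem 0 T))
  have hφt : Tendsto φ atTop atTop := tendsto_atTop_mono hφ tendsto_id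
  have hw n := hB.dyadic.weights.nonneg n
  let N : ℕ → ℕ := fun k => (w (φ k)).support.sup id
  have hN k : ∀ j ∈ (w (φ k)).support, j ≤ N k := fun j hj => Finset.le_sup (f := id) hj
  refine ⟨fun k => foresightTime μ ℱ τ ζ (w (φ k)) (N k) (c - (1 / 2) ^ k),
    fun k => isStop_foresightTime hright _ _ _, ?_⟩
  filter_upwards [hφ', h.cellExp_mem_cone, hB.ae_tendsto_approx, hB.ae_zero h] with ω h1 h2 h3 h4
  refine ⟨fun t ht => ?_, fun T hT => ?_⟩
  · have h5 : Tendsto (fun n => (b (dyUp n t) ω).2) atTop (nhds (B t ω).2) :=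
      (continuous_snd.tendsto _).comp (hB.tendsto t ω)
    obtain ⟨k, hk⟩ := (h5.eventually (gt_mem_nhds ht)).exists
    have h6 : Tendsto (fun n : ℕ => c - (1 / 2 : ℝ) ^ n) atTop (nhds c) := by
      simpa using (tendsto_const_nhds (x := c)).sub
        (tendsto_pow_atTop_nhds_zero_of_lt_one (r := (1 / 2 : ℝ)) (by norm_num) (by norm_num))
    filter_upwards [((h3 _ (dyUp_mem k t)).comp hφt).eventually_lt h6 hk] with n hn
    refine lt_of_lt_of_le (ENNReal.coe_lt_coe.2 (lt_dyUp k t)) (le_iInf₂ fun q hq => ?_)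
    by_contra! hlt
    exact ((hq.trans (foresight_le_approx (hw _) h2 (ENNReal.coe_lt_coe.1 hlt)))).not_gt hn
  · obtain ⟨S, hS⟩ := exists_nat_ge T
    have hTS : T ≤ dy 0 S := by simpa [dy] using hS
    have hσS : σ ω ≤ dy 0 S := ((levelTime_snd_le_iff hB).2 hT).trans (by exact_mod_cast hTS)
    have hσr := coe_capAt_of_ge hσS
    set r := capAt σ (dy 0 S) ω
    have hr : c ≤ (B r ω).2 := (levelTime_snd_le_iff hB).1 hσr.ge
    have hr0 : 0 < r := by
      rw [pos_iff_ne_zero]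
      intro hr'
      rw [hr', h4] at hr
      exact hr.not_gt hc
    filter_upwards [h1 S] with k hk
    have h5 := (abs_lt.1 hk).1
    have h6 := approx_le_foresight (hw (φ k)) h2 (hN k) r
    have h7 : dy (N k) (⌈r * 2 ^ N k⌉₊ - 1) < r := by
      rw [← lt_ceil_iff_dy_lt]
      exact Nat.sub_lt (Nat.ceil_pos.2 (by positivity)) one_pos
    refine ⟨dy (N k) (⌈r * 2 ^ N k⌉₊ - 1), iInf₂_le _ ?_, ?_⟩
    · change _ < approx μ ℱ τ ζ (w (φ k)) r ω - (B r ω).2 at h5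
      linarith
    · by_contra! hge
      have h8 := (levelTime_snd_le_iff hB).2 hge
      change σ ω ≤ _ at h8
      rw [← hσr, ENNReal.coe_le_coe] at h8
      exact h8.not_gt h7

end Announce

section Truncation

variable {X : Type*} [NormedAddCommGroup X] [NormedSpace ℝ X] {lam : ℝ}

/-- The part of `x` that exceeds the ball of radius `lam`. -/
noncomputable def excess (lam : ℝ) (x : X) : X := (1 - lam / max lam ‖x‖) • x

lemma continuous_excess (hlam : 0 < lam) : Continuous (excess (X := X) lam) := by
  unfold excess
  refine Continuous.smul (continuous_const.sub (continuous_const.div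
    (continuous_const.max continuous_norm) fun x => (lt_max_of_lt_left hlam).ne')) continuous_id

lemma excess_of_le (hlam : 0 < lam) {x : X} (h : ‖x‖ ≤ lam) : excess lam x = 0 := by
  rw [excess, max_eq_left h, div_self hlam.ne', sub_self, zero_smul]

lemma norm_excess_of_ge (hlam : 0 < lam) {x : X} (h : lam ≤ ‖x‖) :
    ‖excess lam x‖ = ‖x‖ - lam := by
  have hx : 0 < ‖x‖ := hlam.trans_le h
  rw [excess, max_eq_right h, norm_smul, Real.norm_of_nonneg
    (sub_nonneg.2 ((div_le_one hx).2 h)), sub_mul, one_mul, div_mul_cancel₀ _ hx.ne']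

lemma norm_excess_le (hlam : 0 < lam) (x : X) : ‖excess lam x‖ ≤ ‖x‖ := by
  rcases le_total ‖x‖ lam with h | h
  · simp [excess_of_le hlam h]
  · rw [norm_excess_of_ge hlam h]; linarith

lemma norm_sub_excess_le (hlam : 0 < lam) (x : X) : ‖x - excess lam x‖ ≤ lam := by
  have hm : 0 < max lam ‖x‖ := lt_max_of_lt_left hlam
  have e : x - excess lam x = (lam / max lam ‖x‖) • x := by
    rw [excess, sub_smul, one_smul, sub_sub_cancel]
  rw [e, norm_smul, Real.norm_of_nonneg (by positivity), div_mul_eq_mul_div, div_le_iff₀ hm]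
  gcongr
  exact le_max_right _ _

end Truncation

section ExitTime

variable {Ω : Type*} {m : MeasurableSpace Ω} {μ : Measure Ω} {ℱ : Filtration ℝ≥0 m}
  {X : Type*} [NormedAddCommGroup X] {M : ℝ≥0 → Ω → X} {lam : ℝ}

/-- The first time at which `M` leaves the ball of radius `lam`. -/
noncomputable def exitTime (M : ℝ≥0 → Ω → X) (lam : ℝ) (ω : Ω) : ℝ≥0∞ :=
  ⨅ (t : ℝ≥0) (_ : lam < ‖M t ω‖), (t : ℝ≥0∞)

lemma norm_le_of_lt_exitTime {t : ℝ≥0} {ω : Ω} (h : t < exitTime M lam ω) : ‖M t ω‖ ≤ lam := by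
  by_contra! hlt
  have h1 : exitTime M lam ω ≤ t := iInf₂_le t hlt
  exact h1.not_gt h

lemma le_norm_of_exitTime_eq (hrc : ∀ ω t, ContinuousWithinAt (fun s => M s ω) (Ici t) t)
    {t : ℝ≥0} {ω : Ω} (h : exitTime M lam ω = t) : lam ≤ ‖M t ω‖ := by
  by_contra! hlt
  obtain ⟨u, hu, hu'⟩ := mem_nhdsGE_iff_exists_Ico_subset.1
    ((hrc ω t).norm.eventually (gt_mem_nhds hlt))
  have h1 : (u : ℝ≥0∞) ≤ exitTime M lam ω := le_iInf₂ fun s hs => by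
    by_contra! hsu
    have hts : t ≤ s := by
      rw [← ENNReal.coe_le_coe, ← h]
      exact iInf₂_le s hs
    exact (hu' ⟨hts, ENNReal.coe_lt_coe.1 hsu⟩ : ‖M s ω‖ < lam).not_gt hs
  rw [h, ENNReal.coe_le_coe] at h1
  exact h1.not_gt hu

lemma isStop_exitTime (hright : RightContinuousFiltration ℱ)
    (hM : ∀ t, StronglyMeasurable[ℱ t] (M t))
    (hrc : ∀ ω t, ContinuousWithinAt (fun s => M s ω) (Ici t) t) :
    IsStop ℱ (exitTime M lam) := by
  refine isStop_of_lt hright fun t => ?_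
  have e : {ω | exitTime M lam ω < t} =
      ⋃ p : ℕ × ℕ, {ω | dy p.1 p.2 < t ∧ lam < ‖M (dy p.1 p.2) ω‖} := by
    ext ω
    simp only [exitTime, mem_ofPred_eq, iInf_lt_iff, mem_iUnion, ENNReal.coe_lt_coe, exists_prop]
    refine ⟨fun ⟨s, hs, hst⟩ => ?_, fun ⟨p, hp, hp'⟩ => ⟨_, hp', hp⟩⟩
    have h1 : ∀ᶠ n in atTop, lam < ‖M (dyUp n s) ω‖ :=
      ((hrc ω s).norm.tendsto.comp (tendsto_dyUp s)).eventually (lt_mem_nhds hs)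
    have h2 : ∀ᶠ n in atTop, dyUp n s < t :=
      (tendsto_nhdsWithin_iff.1 (tendsto_dyUp s)).1.eventually (gt_mem_nhds hst)
    obtain ⟨n, h1, h2⟩ := (h1.and h2).exists
    exact ⟨(n, ⌊s * 2 ^ n⌋₊ + 1), h2, h1⟩
  rw [e]
  refine MeasurableSet.iUnion fun p => ?_
  by_cases hp : dy p.1 p.2 < t
  · simp only [hp, true_and]
    have hm : Measurable[ℱ (dy p.1 p.2)] fun ω => ‖M (dy p.1 p.2) ω‖ := (hM _).norm.measurable
    exact ℱ.mono hp.le _ (hm measurableSet_Ioi)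
  · simp [hp]

variable [NormedSpace ℝ X]

/-- The excess of `M` at the exit time, together with its norm. -/
noncomputable def exitJump (M : ℝ≥0 → Ω → X) (lam : ℝ) (ω : Ω) : X × ℝ :=
  (excess lam (M (exitTime M lam ω).toNNReal ω), ‖excess lam (M (exitTime M lam ω).toNNReal ω)‖)

lemma jump_exitJump (hlam : 0 < lam) (t : ℝ≥0) (ω : Ω) :
    jump (exitTime M lam) (exitJump M lam) t ω =
      (excess lam (M (capAt (exitTime M lam) t ω) ω),
        ‖excess lam (M (capAt (exitTime M lam) t ω) ω)‖) := by
  rcases le_or_gt (exitTime M lam ω) t with h | h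
  · have e : capAt (exitTime M lam) t ω = (exitTime M lam ω).toNNReal := by
      rw [capAt, min_eq_right h]
    rw [jump_of_le h, exitJump, e]
  · rw [jump_of_lt h, capAt_of_le h.le, excess_of_le hlam (norm_le_of_lt_exitTime h)]
    simp only [norm_zero]
    rfl

lemma isJump_exitJump [IsFiniteMeasure μ] [CompleteSpace X] (hright : RightContinuousFiltration ℱ)
    (hM : Martingale M ℱ μ) (hrc : ∀ ω t, ContinuousWithinAt (fun s => M s ω) (Ici t) t)
    (hlam : 0 < lam) : IsJump μ ℱ (exitTime M lam) (exitJump M lam) := by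
  have hst : IsStop ℱ (exitTime M lam) := isStop_exitTime hright hM.1 hrc
  have hZ := martingale_stopped hM hrc hst
  have e t : jump (exitTime M lam) (exitJump M lam) t = fun ω =>
      (excess lam (M (capAt (exitTime M lam) t ω) ω),
        ‖excess lam (M (capAt (exitTime M lam) t ω) ω)‖) := funext (jump_exitJump hlam t)
  have hsm t : StronglyMeasurable[ℱ t] fun ω => excess lam (M (capAt (exitTime M lam) t ω) ω) :=
    (continuous_excess hlam).comp_stronglyMeasurable (hZ.1 t)
  have hi t : Integrable (fun ω => excess lam (M (capAt (exitTime M lam) t ω) ω)) μ :=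
    (hZ.integrable t).mono ((hsm t).mono (ℱ.le t)).aestronglyMeasurable
      (.of_forall fun ω => norm_excess_le hlam _)
  refine ⟨hst, fun t => ?_, fun t => ?_, fun ω => mem_cone.2 le_rfl⟩
  · rw [e]; exact (hsm t).prodMk (hsm t).norm
  · rw [e]; exact (hi t).prodMk (hi t).norm

lemma jump_exitJump_snd_le (hrc : ∀ ω t, ContinuousWithinAt (fun s => M s ω) (Ici t) t)
    (hlam : 0 < lam) (t : ℝ≥0) (ω : Ω) :
    (jump (exitTime M lam) (exitJump M lam) t ω).2 +
      {ω | exitTime M lam ω ≤ t}.indicator (fun _ => lam) ω ≤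
        ‖M (capAt (exitTime M lam) t ω) ω‖ := by
  rw [jump_exitJump hlam]
  rcases le_or_gt (exitTime M lam ω) t with h | h
  · rw [indicator_of_mem (by exact h), norm_excess_of_ge hlam, sub_add_cancel]
    exact le_norm_of_exitTime_eq hrc (coe_capAt_of_ge h).symm
  · rw [indicator_of_notMem (by exact not_le.2 h), add_zero]
    exact norm_excess_le hlam _

end ExitTime

section LeftStopping

variable {Ω : Type*} {m : MeasurableSpace Ω} {μ : Measure Ω} {ℱ : Filtration ℝ≥0 m}
  {X : Type*} [NormedAddCommGroup X] {c C : ℝ}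

lemma tendsto_capAt {U : ℕ → Ω → ℝ≥0∞} {ω : Ω} {s : ℝ≥0} (hs : ∀ᶠ n in atTop, U n ω < s)
    (hs' : ∀ r < s, ∀ᶠ n in atTop, (r : ℝ≥0∞) < U n ω) {t : ℝ≥0} (hst : s ≤ t) :
    Tendsto (fun n => capAt (U n) t ω) atTop (nhdsWithin s (Iio s)) := by
  have h1 : ∀ᶠ n in atTop, capAt (U n) t ω < s := hs.mono fun n hn => by
    rw [← ENNReal.coe_lt_coe, coe_capAt]
    exact (min_le_right _ _).trans_lt hn
  refine tendsto_nhdsWithin_iff.2 ⟨tendsto_order.2 ⟨fun r hr => ?_, fun r hr => ?_⟩, h1⟩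
  · filter_upwards [hs' r hr] with n hn
    rw [← ENNReal.coe_lt_coe, coe_capAt]
    exact lt_min (by exact_mod_cast hr.trans_le hst) hn
  · exact h1.mono fun n hn => hn.trans hr

/-- A path stopped just before an increasing function reaches the level `c`. -/
lemma exists_left_stopped_path {k : ℝ≥0 → X} {a : ℝ≥0 → ℝ} (hk : CadlagPath k)
    (ha : Monotone a) (hac : ∀ t, ContinuousWithinAt a (Ici t) t)
    {U : ℕ → Ω → ℝ≥0∞} {ω : Ω} (hU : ∀ t, a t < c → ∀ᶠ n in atTop, (t : ℝ≥0∞) < U n ω)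
    (hU' : ∀ T, c ≤ a T → ∀ᶠ n in atTop, ∃ s : ℝ≥0, U n ω ≤ s ∧ a s < c) :
    ∃ l : ℝ≥0 → X, CadlagPath l ∧ (∀ t, a t < c → l t = k t) ∧
      ∀ t, Tendsto (fun n => k (capAt (U n) t ω)) atTop (nhds (l t)) := by
  by_cases hT : ∃ T, c ≤ a T
  swap
  · push Not at hT
    refine ⟨k, hk, fun _ _ => rfl, fun t => tendsto_const_nhds.congr' ?_⟩
    filter_upwards [hU t (hT t)] with n hn
    rw [capAt_of_le hn.le]
  obtain ⟨T, hT⟩ := hT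
  have hσT : levelTime (fun t (_ : Ω) => a t) c ω ≤ T :=
    (levelTime_le_iff ha hac).2 hT
  obtain ⟨σ, hσ⟩ : ∃ σ : ℝ≥0, (σ : ℝ≥0∞) = levelTime (fun t (_ : Ω) => a t) c ω :=
    ⟨_, ENNReal.coe_toNNReal (ne_top_of_le_ne_top ENNReal.coe_ne_top hσT)⟩
  have hσ' {t : ℝ≥0} : σ ≤ t ↔ c ≤ a t := by
    rw [← ENNReal.coe_le_coe, hσ]
    exact levelTime_le_iff (a := fun t (_ : Ω) => a t) ha hac
  have hσ'' {t : ℝ≥0} : t < σ ↔ a t < c := by rw [← not_le, hσ', not_le]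
  obtain ⟨_, r, _, hr⟩ := (hU' T hT).exists
  obtain ⟨x, hx⟩ := hk.2 σ (lt_of_le_of_lt zero_le (hσ''.2 hr))
  classical
  refine ⟨fun t => if a t < c then k t else x, ⟨fun t => ?_, fun t ht => ?_⟩,
    fun t ht => if_pos ht, fun t => ?_⟩
  · by_cases h : a t < c
    · refine (hk.1 t).congr_of_eventuallyEq ?_ (if_pos h)
      filter_upwards [(hac t).eventually (gt_mem_nhds h)] with s hs
      exact if_pos hs
    · refine (continuousWithinAt_const (b := x)).congr (fun s hs => if_neg ?_) (if_neg h)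
      exact not_lt.2 ((not_lt.1 h).trans (ha hs))
  · rcases le_or_gt t σ with h | h
    · obtain ⟨y, hy⟩ := hk.2 t ht
      refine ⟨y, hy.congr' ?_⟩
      filter_upwards [self_mem_nhdsWithin] with s hs
      exact (if_pos (hσ''.1 (lt_of_lt_of_le hs h))).symm
    · refine ⟨x, tendsto_const_nhds.congr' ?_⟩
      filter_upwards [mem_nhdsWithin_of_mem_nhds (Ioi_mem_nhds h)] with s hs
      exact (if_neg (not_lt.2 (hσ'.1 (le_of_lt hs)))).symm
  · by_cases h : a t < c
    · simp only [if_pos h]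
      refine tendsto_const_nhds.congr' ?_
      filter_upwards [hU t h] with n hn
      rw [capAt_of_le hn.le]
    · simp only [if_neg h]
      refine hx.comp (tendsto_capAt ?_ (fun r hr => hU r (hσ''.1 hr)) (hσ'.2 (not_lt.1 h)))
      filter_upwards [hU' T hT] with n ⟨s, hs, hs'⟩
      exact hs.trans_lt (by exact_mod_cast hσ''.2 hs')

lemma eventually_capAt_lt {a : ℝ≥0 → ℝ} (ha : Monotone a)
    {U : ℕ → Ω → ℝ≥0∞} {ω : Ω}
    (hU' : ∀ T, c ≤ a T → ∀ᶠ n in atTop, ∃ s : ℝ≥0, U n ω ≤ s ∧ a s < c) (t : ℝ≥0) :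
    ∀ᶠ n in atTop, a (capAt (U n) t ω) < c := by
  by_cases h : a t < c
  · exact .of_forall fun n => (ha (capAt_le _ _ _)).trans_lt h
  · filter_upwards [hU' t (not_lt.1 h)] with n ⟨s, hs, hs'⟩
    refine (ha ?_).trans_lt hs'
    rw [capAt_le_iff]
    exact .inr hs

variable [NormedSpace ℝ X] [CompleteSpace X]

/-- A martingale stopped just before an increasing process reaches the level `c`, when the time at
which this happens is announced by stopping times. -/
lemma exists_left_stopped [IsFiniteMeasure μ] (hcompl : CompleteFiltration μ ℱ)
    {K : ℝ≥0 → Ω → X} {a : ℝ≥0 → Ω → ℝ} (hK : Martingale K ℱ μ)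
    (hKc : ∀ ω, CadlagPath fun t => K t ω) (ha : ∀ ω, Monotone fun t => a t ω)
    (hac : ∀ ω t, ContinuousWithinAt (fun s => a s ω) (Ici t) t)
    (hai : ∀ t, Integrable (a t) μ) (hKa : ∀ t ω, ‖K t ω‖ ≤ C + a t ω)
    {U : ℕ → Ω → ℝ≥0∞} (hUst : ∀ n, IsStop ℱ (U n))
    (hU : ∀ᵐ ω ∂μ, (∀ t : ℝ≥0, a t ω < c → ∀ᶠ n in atTop, (t : ℝ≥0∞) < U n ω) ∧
      ∀ T, c ≤ a T ω → ∀ᶠ n in atTop, ∃ s : ℝ≥0, U n ω ≤ s ∧ a s ω < c) :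
    ∃ L : ℝ≥0 → Ω → X, Martingale L ℱ μ ∧ (∀ ω, CadlagPath fun t => L t ω) ∧
      (∀ᵐ ω ∂μ, ∀ t, a t ω < c → L t ω = K t ω) ∧ (∀ᵐ ω ∂μ, ∀ t, ‖L t ω‖ ≤ C + c) ∧
      ∀ t, ∫ ω, ‖L t ω‖ ∂μ ≤ ∫ ω, ‖K t ω‖ ∂μ := by
  set G : Set Ω := {ω | (∀ t : ℝ≥0, a t ω < c → ∀ᶠ n in atTop, (t : ℝ≥0∞) < U n ω) ∧
      ∀ T, c ≤ a T ω → ∀ᶠ n in atTop, ∃ s : ℝ≥0, U n ω ≤ s ∧ a s ω < c}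
  have hG (t : ℝ≥0) : MeasurableSet[ℱ t] G :=
    ℱ.mono zero_le _ (MeasurableSet.compl_iff.1 (hcompl _ hU))
  have hpath (ω : Ω) : ∃ l : ℝ≥0 → X, CadlagPath l ∧ (ω ∈ G → ∀ t, a t ω < c → l t = K t ω) ∧
      ∀ t, Tendsto (fun n => G.indicator (fun ω => K (capAt (U n) t ω) ω) ω) atTop
        (nhds (l t)) := by
    by_cases hω : ω ∈ G
    · obtain ⟨l, h1, h2, h3⟩ := exists_left_stopped_path (hKc ω) (ha ω) (hac ω) hω.1 hω.2
      exact ⟨l, h1, fun _ => h2, fun t => by simpa only [indicator_of_mem hω] using h3 t⟩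
    · refine ⟨fun _ => 0, ⟨fun _ => continuousWithinAt_const, fun _ _ => ⟨0, tendsto_const_nhds⟩⟩,
        fun h => absurd h hω, fun t => ?_⟩
      simp only [indicator_of_notMem hω]
      exact tendsto_const_nhds
  choose L hLc hLK hL using hpath
  have hrc ω t : ContinuousWithinAt (fun s => K s ω) (Ici t) t := (hKc ω).1 t
  have hst n := martingale_stopped hK hrc (hUst n)
  have hbound t n ω : ‖K (capAt (U n) t ω) ω‖ ≤ C + a t ω :=
    (hKa _ ω).trans (by gcongr; exact ha ω (capAt_le _ _ _))
  have hlim t : ∀ᵐ ω ∂μ, Tendsto (fun n => K (capAt (U n) t ω) ω) atTop (nhds (L ω t)) := by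
    filter_upwards [hU] with ω hω
    have := hL ω t
    rwa [show (fun n => G.indicator (fun ω => K (capAt (U n) t ω) ω) ω) =
      fun n => K (capAt (U n) t ω) ω from funext fun n => indicator_of_mem (s := G) hω _] at this
  have hdi t : Integrable (fun ω => C + a t ω) μ := (integrable_const C).add (hai t)
  have hLsm t : StronglyMeasurable[ℱ t] fun ω => L ω t :=
    stronglyMeasurable_of_tendsto atTop (fun n => ((hst n).1 t).indicator (hG t))
      (tendsto_pi_nhds.2 fun ω => hL ω t)
  have hLi t : Integrable (fun ω => L ω t) μ := by
    refine (hdi t).mono' ((hLsm t).mono (ℱ.le t)).aestronglyMeasurable ?_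
    filter_upwards [hlim t] with ω hω
    exact le_of_tendsto hω.norm (.of_forall fun n => hbound t n ω)
  have hLint t (S : Set Ω) : Tendsto (fun n => ∫ ω in S, K (capAt (U n) t ω) ω ∂μ) atTop
      (nhds (∫ ω in S, L ω t ∂μ)) :=
    tendsto_integral_of_dominated_convergence (fun ω => C + a t ω)
      (fun n => ((hst n).integrable t).1.restrict) (hdi t).integrableOn
      (fun n => .of_forall (hbound t n)) (ae_restrict_of_ae (hlim t))
  refine ⟨fun t ω => L ω t, martingale_of_setIntegral hLsm hLi fun s t hst' S hS => ?_, hLc,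
    ?_, ?_, fun t => ?_⟩
  · refine tendsto_nhds_unique (hLint s S) ((hLint t S).congr fun n => ?_)
    exact ((hst n).setIntegral_eq hst' hS).symm
  · filter_upwards [hU] with ω hω
    exact hLK ω hω
  · filter_upwards [hU] with ω hω t
    refine le_of_tendsto (hL ω t).norm ?_
    filter_upwards [eventually_capAt_lt (ha ω) hω.2 t] with n hn
    rw [indicator_of_mem (s := G) hω]
    exact (hKa _ ω).trans (by gcongr)
  · refine le_of_tendsto (tendsto_integral_of_dominated_convergence (fun ω => C + a t ω)
      (fun n => ((hst n).integrable t).1.norm) (hdi t) (fun n => .of_forall fun ω => ?_)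
      ((hlim t).mono fun ω h => h.norm)) (.of_forall fun n => ?_)
    · rw [norm_norm]; exact hbound t n ω
    · exact integral_norm_eval_le hK hrc ((hUst n).isStop_capAt t) (capAt_le _ _)

end LeftStopping

section Paths

variable {X : Type*} [NormedAddCommGroup X] {f g : ℝ≥0 → X}

lemma _root_.CadlagPath.sub (hf : CadlagPath f) (hg : CadlagPath g) :
    CadlagPath fun t => f t - g t := by
  refine ⟨fun t => (hf.1 t).sub (hg.1 t), fun t ht => ?_⟩
  obtain ⟨x, hx⟩ := hf.2 t ht
  obtain ⟨y, hy⟩ := hg.2 t ht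
  exact ⟨x - y, hx.sub hy⟩

lemma _root_.CadlagPath.stopped (hf : CadlagPath f) {Ω : Type*} (τ : Ω → ℝ≥0∞) (ω : Ω) :
    CadlagPath fun t => f (capAt τ t ω) := by
  refine ⟨fun t => ?_, fun t ht => ?_⟩
  · rcases le_or_gt (τ ω) t with h | h
    · refine continuousWithinAt_const.congr (fun s hs => ?_) rfl
      rw [capAt_capAt τ hs ω (capAt_le_iff.2 (.inr h))]
    · obtain ⟨u, hu, hu'⟩ := ENNReal.lt_iff_exists_nnreal_btwn.1 h
      refine (hf.1 t).congr_of_eventuallyEq ?_ (by rw [capAt_of_le h.le])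
      filter_upwards [mem_nhdsWithin_of_mem_nhds (Iio_mem_nhds (ENNReal.coe_lt_coe.1 hu))]
        with s hs
      rw [capAt_of_le ((ENNReal.coe_le_coe.2 (le_of_lt hs)).trans hu'.le)]
  · rcases lt_or_ge (τ ω) t with h | h
    · obtain ⟨u, hu, hu'⟩ := ENNReal.lt_iff_exists_nnreal_btwn.1 h
      refine ⟨f (capAt τ u ω), tendsto_const_nhds.congr' ?_⟩
      filter_upwards [mem_nhdsWithin_of_mem_nhds (Ioi_mem_nhds (ENNReal.coe_lt_coe.1 hu'))]
        with s hs
      rw [capAt_capAt τ (le_of_lt hs) ω (capAt_le_iff.2 (.inr hu.le))]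
    · obtain ⟨x, hx⟩ := hf.2 t ht
      refine ⟨x, hx.congr' ?_⟩
      filter_upwards [self_mem_nhdsWithin] with s hs
      rw [capAt_of_le ((ENNReal.coe_le_coe.2 (le_of_lt hs)).trans h)]

/-- A path whose increments are dominated by those of `a` has variation at most that of `a`. -/
lemma nnnorm_add_eVariationOn_le {a : ℝ≥0 → ℝ} (h0 : ‖f 0‖ ≤ a 0)
    (h : ∀ s t, s ≤ t → ‖f t - f s‖ ≤ a t - a s) (t : ℝ≥0) :
    (‖f 0‖₊ : ℝ≥0∞) + eVariationOn f (Icc 0 t) ≤ ENNReal.ofReal (a t) := by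
  have ha : Monotone a := fun s t hst => sub_nonneg.1 ((norm_nonneg _).trans (h s t hst))
  have h1 : eVariationOn f (Icc 0 t) ≤ eVariationOn a (Icc 0 t) := by
    refine iSup_mono fun p => Finset.sum_le_sum fun i _ => ?_
    have hi := h _ _ (p.2.2.1 (Nat.le_succ i))
    rw [edist_dist, edist_dist, dist_eq_norm, dist_eq_norm]
    exact ENNReal.ofReal_le_ofReal (hi.trans (Real.le_norm_self _))
  have h2 : eVariationOn a (Icc 0 t) ≤ ENNReal.ofReal (a t - a 0) := by
    simpa using ((ha.monotoneOn (Icc 0 t)).eVariationOn_eq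
      (left_mem_Icc.2 zero_le) (right_mem_Icc.2 zero_le)).le
  calc (‖f 0‖₊ : ℝ≥0∞) + eVariationOn f (Icc 0 t)
      ≤ ENNReal.ofReal (a 0) + ENNReal.ofReal (a t - a 0) := by
        refine add_le_add ?_ (h1.trans h2)
        rw [← enorm_eq_nnnorm, ← ofReal_norm]
        exact ENNReal.ofReal_le_ofReal h0
    _ = ENNReal.ofReal (a t) := by
        rw [← ENNReal.ofReal_add ((norm_nonneg _).trans h0) (sub_nonneg.2 (ha zero_le)),
          add_sub_cancel]

end Paths

section Decomposition

variable {Ω : Type*} {m : MeasurableSpace Ω} {μ : Measure Ω} {ℱ : Filtration ℝ≥0 m}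
  {X : Type*} [NormedAddCommGroup X] [NormedSpace ℝ X] [CompleteSpace X]

lemma martingale_fst [IsFiniteMeasure μ] {Y : Type*} [NormedAddCommGroup Y] [NormedSpace ℝ Y]
    [CompleteSpace Y] {N : ℝ≥0 → Ω → X × Y} (hN : Martingale N ℱ μ) :
    Martingale (fun t ω => (N t ω).1) ℱ μ :=
  martingale_of_setIntegral (fun t => continuous_fst.comp_stronglyMeasurable (hN.1 t))
    (fun t => (hN.integrable t).fst) fun s t hst G hG => by
      rw [← fst_integral (hN.integrable s).integrableOn,
        ← fst_integral (hN.integrable t).integrableOn, hN.setIntegral_eq hst hG]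

variable {τ : Ω → ℝ≥0∞} {ζ : Ω → X × ℝ} {w : ℕ → ℕ →₀ ℝ} {b B : ℝ≥0 → Ω → X × ℝ}

lemma IsCompensator.integral_snd_le [IsProbabilityMeasure μ] (h : IsJump μ ℱ τ ζ)
    (hB : IsCompensator μ ℱ τ ζ w b B) (t : ℝ≥0) :
    ∫ ω, (B t ω).2 ∂μ ≤ ∫ ω, (jump τ ζ t ω).2 ∂μ := by
  have h1 := hB.setIntegral_sub_jump h (zero_le (a := t)) (G := univ) MeasurableSet.univ
  rw [Measure.restrict_univ, integral_sub (h.int 0) (hB.integrable 0),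
    integral_sub (h.int t) (hB.integrable t), hB.integral_zero h, sub_zero] at h1
  have h2 := congr_arg Prod.snd h1
  rw [Prod.snd_sub, snd_integral (h.int 0), snd_integral (h.int t),
    snd_integral (hB.integrable t)] at h2
  have h3 : 0 ≤ ∫ ω, (jump τ ζ 0 ω).2 ∂μ := integral_nonneg fun ω => by
    rcases le_or_gt (τ ω) (0 : ℝ≥0) with h' | h'
    · rw [jump_of_le h']; exact cone_snd_nonneg (h.mem_cone ω)
    · rw [jump_of_lt h']; exact le_rfl
  linarith

lemma integral_jump_exitJump_snd_add_le [IsProbabilityMeasure μ]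
    (hright : RightContinuousFiltration ℱ) {M : ℝ≥0 → Ω → X} (hM : Martingale M ℱ μ)
    (hrc : ∀ ω t, ContinuousWithinAt (fun s => M s ω) (Ici t) t) {lam : ℝ} (hlam : 0 < lam)
    (t : ℝ≥0) :
    ∫ ω, (jump (exitTime M lam) (exitJump M lam) t ω).2 ∂μ +
      lam * μ.real {ω | exitTime M lam ω ≤ t} ≤ ∫ ω, ‖M t ω‖ ∂μ := by
  have h := isJump_exitJump hright hM hrc hlam
  have hst := h.isStop
  have hms : MeasurableSet {ω | exitTime M lam ω ≤ t} := ℱ.le t _ (hst t)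
  have hind : Integrable ({ω | exitTime M lam ω ≤ t}.indicator fun _ => lam) μ :=
    (integrable_const lam).indicator hms
  refine le_trans ?_ (integral_norm_eval_le hM hrc (hst.isStop_capAt t) (capAt_le _ _))
  have e : lam * μ.real {ω | exitTime M lam ω ≤ t} =
      ∫ ω, {ω | exitTime M lam ω ≤ t}.indicator (fun _ => lam) ω ∂μ := by
    rw [integral_indicator_const _ hms, smul_eq_mul, mul_comm]
  rw [e, ← integral_add (h.int t).snd hind]
  exact integral_mono ((h.int t).snd.add hind)
    ((martingale_stopped hM hrc hst).integrable t).norm (jump_exitJump_snd_le hrc hlam t)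

end Decomposition
end Gundy

/-- **Gundy's decomposition of continuous-time martingales.**
Let `X` be a Banach space and `M` a càdlàg `X`-valued martingale with respect to a
filtration satisfying the usual conditions on a complete probability space. Then for
every `λ > 0` there exist càdlàg martingales `M¹, M², M³` with `M = M¹ + M² + M³` and,
for every `t ≥ 0`:
(i) `‖M¹_t‖ ≤ 2λ` a.s. and `E‖M¹_t‖ ≤ 5 E‖M_t‖`;
(ii) `λ · P(sup_{0≤s≤t} ‖M²_s‖ > 0) ≤ 4 E‖M_t‖`;
(iii) `E (Var M³)_t ≤ 7 E‖M_t‖`, where `(Var N)_t = ‖N_0‖ +` total variation on `[0,t]`. -/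
theorem gundy_decomposition
    {Ω : Type*} {m : MeasurableSpace Ω} {μ : Measure Ω} [IsProbabilityMeasure μ]
    {X : Type*} [NormedAddCommGroup X] [NormedSpace ℝ X] [CompleteSpace X]
    (ℱ : Filtration ℝ≥0 m)
    (hright : RightContinuousFiltration ℱ) (hcompl : CompleteFiltration μ ℱ)
    (M : ℝ≥0 → Ω → X) (hM : Martingale M ℱ μ)
    (hMcadlag : ∀ ω, CadlagPath fun t => M t ω)
    (lam : ℝ) (hlam : 0 < lam) :
    ∃ M1 M2 M3 : ℝ≥0 → Ω → X,
      Martingale M1 ℱ μ ∧ Martingale M2 ℱ μ ∧ Martingale M3 ℱ μ ∧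
      (∀ ω, CadlagPath fun t => M1 t ω) ∧
      (∀ ω, CadlagPath fun t => M2 t ω) ∧
      (∀ ω, CadlagPath fun t => M3 t ω) ∧
      (∀ t ω, M t ω = M1 t ω + M2 t ω + M3 t ω) ∧
      (∀ t : ℝ≥0, (∀ᵐ ω ∂μ, ‖M1 t ω‖ ≤ 2 * lam) ∧
        ∫ ω, ‖M1 t ω‖ ∂μ ≤ 5 * ∫ ω, ‖M t ω‖ ∂μ) ∧
      (∀ t : ℝ≥0,
        ENNReal.ofReal lam * μ {ω | ∃ s ∈ Set.Icc (0 : ℝ≥0) t, M2 s ω ≠ 0}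
          ≤ ENNReal.ofReal (4 * ∫ ω, ‖M t ω‖ ∂μ)) ∧
      (∀ t : ℝ≥0,
        ∫⁻ ω, ((‖M3 0 ω‖₊ : ℝ≥0∞)
            + eVariationOn (fun s => M3 s ω) (Set.Icc (0 : ℝ≥0) t)) ∂μ
          ≤ ENNReal.ofReal (7 * ∫ ω, ‖M t ω‖ ∂μ)) := by
  have hrc ω t : ContinuousWithinAt (fun s => M s ω) (Ici t) t := (hMcadlag ω).1 t
  set τ := Gundy.exitTime M lam
  set ζ := Gundy.exitJump M lam
  have h : Gundy.IsJump μ ℱ τ ζ := Gundy.isJump_exitJump hright hM hrc hlam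
  obtain ⟨w, b, hb⟩ := h.exists_isDyadicCompensator hcompl
  obtain ⟨B, hB⟩ := hb.exists_isCompensator
  set J := Gundy.jump τ ζ
  have hm0 t : 0 ≤ ∫ ω, ‖M t ω‖ ∂μ := integral_nonneg fun ω => norm_nonneg _
  have hJi t : Integrable (fun ω => (J t ω).2) μ := (h.int t).snd
  have hBi t : Integrable (fun ω => (B t ω).2) μ := (hB.integrable t).snd
  have hJBi t : Integrable (fun ω => (J t ω).2 + (B t ω).2) μ := (hJi t).add (hBi t)
  have hP t : ∫ ω, (J t ω).2 ∂μ + lam * μ.real {ω | τ ω ≤ t} ≤ ∫ ω, ‖M t ω‖ ∂μ :=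
    Gundy.integral_jump_exitJump_snd_add_le hright hM hrc hlam t
  have hJm t : ∫ ω, (J t ω).2 ∂μ ≤ ∫ ω, ‖M t ω‖ ∂μ := by
    have : 0 ≤ lam * μ.real {ω | τ ω ≤ t} := by positivity
    linarith [hP t]
  have hBJ t : ∫ ω, (B t ω).2 ∂μ ≤ ∫ ω, (J t ω).2 ∂μ := hB.integral_snd_le h t
  have hJB : Martingale (fun t ω => (J t ω - B t ω).1) ℱ μ :=
    Gundy.martingale_fst (hB.martingale hright h)
  have hJBc ω : CadlagPath fun t => (J t ω - B t ω).1 := by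
    refine ⟨fun t => ((Gundy.jump_rightContinuous ζ ω t).sub (hB.rightContinuous ω t)).fst,
      fun t ht => ?_⟩
    obtain ⟨x, hx⟩ := Gundy.jump_leftLim (τ := τ) ζ ω t
    obtain ⟨y, hy⟩ := hB.leftLim ω t ht
    exact ⟨(x - y).1, (hx.sub hy).fst_nhds⟩
  have hZ : Martingale (fun t ω => M (Gundy.capAt τ t ω) ω) ℱ μ :=
    Gundy.martingale_stopped hM hrc h.isStop
  set K : ℝ≥0 → Ω → X := fun t ω => M (Gundy.capAt τ t ω) ω - (J t ω - B t ω).1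
  have hK : Martingale K ℱ μ := hZ.sub hJB
  have hKc ω : CadlagPath fun t => K t ω := ((hMcadlag ω).stopped τ ω).sub (hJBc ω)
  have hBnorm t ω : ‖(B t ω).1‖ ≤ (B t ω).2 := hB.mem t ω
  have hKa t ω : ‖K t ω‖ ≤ lam + (B t ω).2 := by
    have e : K t ω = (M (Gundy.capAt τ t ω) ω -
        Gundy.excess lam (M (Gundy.capAt τ t ω) ω)) + (B t ω).1 := by
      simp only [K, J, τ, ζ, Prod.fst_sub, Gundy.jump_exitJump hlam]
      abel
    rw [e]
    exact (norm_add_le _ _).trans (add_le_add (Gundy.norm_sub_excess_le hlam _) (hBnorm t ω))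
  have hJn t ω : ‖(J t ω).1‖ ≤ (J t ω).2 := by
    simp only [J, τ, ζ, Gundy.jump_exitJump hlam, le_refl]
  have hKm t : ∫ ω, ‖K t ω‖ ∂μ ≤ 3 * ∫ ω, ‖M t ω‖ ∂μ := by
    have h1 : ∫ ω, ‖M (Gundy.capAt τ t ω) ω‖ ∂μ ≤ ∫ ω, ‖M t ω‖ ∂μ :=
      Gundy.integral_norm_eval_le hM hrc (h.isStop.isStop_capAt t) (Gundy.capAt_le _ _)
    have h2 : ∫ ω, ‖K t ω‖ ∂μ ≤
        ∫ ω, (‖M (Gundy.capAt τ t ω) ω‖ + ((J t ω).2 + (B t ω).2)) ∂μ :=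
      integral_mono (hK.integrable t).norm ((hZ.integrable t).norm.add ((hJi t).add (hBi t)))
        fun ω => (norm_sub_le _ _).trans
          (add_le_add_right ((norm_sub_le _ _).trans (add_le_add (hJn t ω) (hBnorm t ω))) _)
    rw [integral_add (hZ.integrable t).norm (hJBi t),
      integral_add (hJi t) (hBi t)] at h2
    linarith [hJm t, hBJ t]
  obtain ⟨U, hUst, hU⟩ := hB.exists_announcing hright h hlam
  obtain ⟨L, hL, hLc, hLK, hLb, hLi⟩ := Gundy.exists_left_stopped hcompl hK hKc hB.mono
    (fun ω t => (hB.rightContinuous ω t).snd) hBi hKa hUst hU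
  refine ⟨L, fun t ω => M t ω - L t ω - (J t ω - B t ω).1, fun t ω => (J t ω - B t ω).1,
    hL, (hM.sub hL).sub hJB, hJB, hLc, fun ω => ((hMcadlag ω).sub (hLc ω)).sub (hJBc ω), hJBc,
    fun t ω => by simp only [Prod.fst_sub]; abel, fun t => ⟨?_, ?_⟩, fun t => ?_, fun t => ?_⟩
  · filter_upwards [hLb] with ω hω
    linarith [hω t]
  · linarith [hLi t, hKm t, hm0 t]
  · have hsub : μ {ω | ∃ s ∈ Icc (0 : ℝ≥0) t, M s ω - L s ω - (J s ω - B s ω).1 ≠ 0} ≤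
        μ ({ω | τ ω ≤ t} ∪ {ω | lam ≤ (B t ω).2}) := by
      refine measure_mono_ae ?_
      filter_upwards [hLK] with ω hω ⟨s, hs, hne⟩
      by_contra hcon
      obtain ⟨h1, h2⟩ : ¬ τ ω ≤ t ∧ ¬ lam ≤ (B t ω).2 := not_or.1 hcon
      have h3 : (s : ℝ≥0∞) ≤ τ ω := (ENNReal.coe_le_coe.2 hs.2).trans (not_le.1 h1).le
      refine hne ?_
      rw [hω s ((hB.mono ω hs.2).trans_lt (not_le.1 h2))]
      simp only [K, Gundy.capAt_of_le h3, sub_sub_cancel, sub_self]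
    have hmarkov : lam * μ.real {ω | lam ≤ (B t ω).2} ≤ ∫ ω, (B t ω).2 ∂μ :=
      mul_meas_ge_le_integral_of_nonneg (.of_forall fun ω => hB.nonneg t ω) (hBi t) lam
    calc ENNReal.ofReal lam *
          μ {ω | ∃ s ∈ Icc (0 : ℝ≥0) t, M s ω - L s ω - (J s ω - B s ω).1 ≠ 0}
        ≤ ENNReal.ofReal lam * (μ {ω | τ ω ≤ t} + μ {ω | lam ≤ (B t ω).2}) := by
          gcongr
          exact hsub.trans (measure_union_le _ _)
      _ = ENNReal.ofReal (lam * (μ.real {ω | τ ω ≤ t} + μ.real {ω | lam ≤ (B t ω).2})) := by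
          rw [ENNReal.ofReal_mul hlam.le, ENNReal.ofReal_add measureReal_nonneg measureReal_nonneg,
            ofReal_measureReal, ofReal_measureReal]
      _ ≤ ENNReal.ofReal (4 * ∫ ω, ‖M t ω‖ ∂μ) := by
          refine ENNReal.ofReal_le_ofReal ?_
          linarith [hP t, hBJ t, hm0 t]
  · have hvar ω : (‖(J 0 ω - B 0 ω).1‖₊ : ℝ≥0∞) +
        eVariationOn (fun s => (J s ω - B s ω).1) (Icc 0 t) ≤
          ENNReal.ofReal ((J t ω).2 + (B t ω).2) := by
      refine Gundy.nnnorm_add_eVariationOn_le (f := fun s => (J s ω - B s ω).1)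
        (a := fun s => (J s ω).2 + (B s ω).2)
        ((norm_sub_le _ _).trans (add_le_add (hJn 0 ω) (hBnorm 0 ω))) (fun s u hsu => ?_) t
      have e : (J u ω - B u ω).1 - (J s ω - B s ω).1 = (J u ω - J s ω).1 - (B u ω - B s ω).1 := by
        simp only [Prod.fst_sub]
        abel
      have h1 : ‖(J u ω - J s ω).1‖ ≤ (J u ω - J s ω).2 := h.sub_mem_cone hsu ω
      have h2 : ‖(B u ω - B s ω).1‖ ≤ (B u ω - B s ω).2 := hB.sub_mem ω s u hsu
      rw [e]
      refine (norm_sub_le _ _).trans ((add_le_add h1 h2).trans_eq ?_)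
      simp only [Prod.snd_sub]
      ring
    refine (lintegral_mono hvar).trans ?_
    rw [← ofReal_integral_eq_lintegral_ofReal (hJBi t) (.of_forall fun ω =>
      add_nonneg ((norm_nonneg _).trans (hJn t ω)) (hB.nonneg t ω)),
      integral_add (hJi t) (hBi t)]
    exact ENNReal.ofReal_le_ofReal (by linarith [hJm t, hBJ t, hm0 t])
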